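/- arXiv:1305.4262 — 2 statements merged into one kernel-verified Lean document; each statement's English description precedes it below -/
import Mathlib

section
/- Let V be a finite-dimensional real inner product space, ℓ a positive integer, a_1, …, a_ℓ ∈ V \ {0} and b_1, …, b_ℓ ∈ ℝⁿ \ {0}. The following are equivalent: (i) there exists C > 0 such that for every u ∈ C_c^∞(ℝⁿ; V), ∫_{ℝⁿ} |u(x)| / |x| dx ≤ C ∑_{i=1}^{ℓ} ∫_{ℝⁿ} |a_i · Du(x)[b_i]| dx; (ii) for every ξ ∈ ℝⁿ \ {0} and every v ∈ V \ {0} there exists i ∈ {1, …, ℓ} such that a_i · v ≠ 0 and |b_i|² ξ ≠ (ξ · b_i) b_i. -/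
open MeasureTheory ENNReal
open scoped NNReal RealInnerProductSpace

noncomputable section

/-- A homogeneous linear differential operator `A(D)` of order `k` from `V` to `E` on a
Euclidean space `X`, represented through its action `u ↦ A (D^k u)` on the `k`-th
iterated (Fréchet) derivative; this is equivalent to the data of a family of coefficients
`(A_α)_{|α| = k}`, `A_α ∈ 𝓛(V; E)`, acting by `A(D)u = ∑_{|α|=k} A_α (∂^α u)`. -/
abbrev DiffOperator (X : Type*) [NormedAddCommGroup X] [InnerProductSpace ℝ X]
    (k : ℕ) (V E : Type*) [NormedAddCommGroup V] [NormedSpace ℝ V]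
    [NormedAddCommGroup E] [NormedSpace ℝ E] :=
  ContinuousMultilinearMap ℝ (fun _ : Fin k => X) V →L[ℝ] E

namespace DiffOperator

variable {X : Type*} [NormedAddCommGroup X] [InnerProductSpace ℝ X]
  {k : ℕ} {V E : Type*} [NormedAddCommGroup V] [NormedSpace ℝ V]
  [NormedAddCommGroup E] [NormedSpace ℝ E]

/-- The action `A(D)u` of the differential operator on a function `u : X → V`. -/
noncomputable def app (A : DiffOperator X k V E) (u : X → V) (x : X) : E :=
  A (iteratedFDeriv ℝ k u x)

/-- The symbol `A(ξ) = ∑_{|α|=k} ξ^α A_α ∈ 𝓛(V; E)` of the operator: it sends `v : V` to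
`A` applied to the `k`-linear map `(w₁, …, w_k) ↦ (⟪ξ,w₁⟫ ⋯ ⟪ξ,w_k⟫) • v`. -/
noncomputable def symbol (A : DiffOperator X k V E) (ξ : X) : V →L[ℝ] E :=
  A.comp (((ContinuousMultilinearMap.compContinuousLinearMapL
      (fun _ : Fin k => innerSL ℝ ξ)).comp
    (ContinuousMultilinearMap.piFieldEquiv ℝ (Fin k)
      V).toContinuousLinearEquiv.toContinuousLinearMap))

/-- `A(D)` is elliptic if its symbol `A(ξ)` is injective for every `ξ ≠ 0`. -/
def IsElliptic (A : DiffOperator X k V E) : Prop :=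
  ∀ ξ : X, ξ ≠ 0 → Function.Injective (A.symbol ξ)

/-- `A(D)` is canceling if `⋂_{ξ ≠ 0} A(ξ)[V] = {0}`. -/
def IsCanceling (A : DiffOperator X k V E) : Prop :=
  (⋂ (ξ : X) (_ : ξ ≠ 0), Set.range (A.symbol ξ)) = {0}

end DiffOperator

/-- `u ∈ C_c^∞`: a smooth compactly supported function. -/
def IsTestFun {X V : Type*} [NormedAddCommGroup X] [NormedSpace ℝ X]
    [NormedAddCommGroup V] [NormedSpace ℝ V] (u : X → V) : Prop :=
  ContDiff ℝ (⊤ : ℕ∞) u ∧ HasCompactSupport u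

lemma hardy_line {n : ℕ} (b : EuclideanSpace ℝ (Fin n)) (hb : b ≠ 0)
    (y : EuclideanSpace ℝ (Fin n)) :
    ∫⁻ t : ℝ, ENNReal.ofReal (‖(‖b‖ ^ 2) • (y - t • b) - ⟪y - t • b, b⟫ • b‖ / ‖y - t • b‖ ^ 2)
      ≤ ENNReal.ofReal (Real.pi * ‖b‖) := by
  have hb0 : 0 < ‖b‖ := norm_pos_iff.2 hb
  set p := ‖(‖b‖ ^ 2) • y - ⟪y, b⟫ • b‖ with hp
  have hP : ∀ t : ℝ, (‖b‖ ^ 2) • (y - t • b) - ⟪y - t • b, b⟫ • b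
      = (‖b‖ ^ 2) • y - ⟪y, b⟫ • b := by
    intro t
    rw [inner_sub_left, inner_smul_left, real_inner_self_eq_norm_sq]
    simp only [smul_sub, sub_smul, smul_smul, conj_trivial]
    rw [mul_comm t]; abel
  simp_rw [hP, ← hp]
  have hp2 : p ^ 2 = ‖b‖ ^ 4 * ‖y‖ ^ 2 - ‖b‖ ^ 2 * ⟪y, b⟫ ^ 2 := by
    rw [hp, norm_sub_sq_real, norm_smul, norm_smul, inner_smul_left, inner_smul_right]
    simp only [Real.norm_eq_abs, mul_pow, sq_abs, conj_trivial]
    ring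
  by_cases hp0 : p = 0
  · simp [hp0]
  have hppos : 0 < p := lt_of_le_of_ne (norm_nonneg _) (Ne.symm hp0)
  let γ : ℝ≥0 := ⟨p / ‖b‖ ^ 3, by positivity⟩
  have hγ : γ ≠ 0 := by
    intro h
    have : p / ‖b‖ ^ 3 = 0 := congrArg NNReal.toReal h
    have : 0 < p / ‖b‖ ^ 3 := by positivity
    linarith
  have key : ∀ t : ℝ, p / ‖y - t • b‖ ^ 2
      = (Real.pi * ‖b‖) * ProbabilityTheory.cauchyPDFReal (⟪y, b⟫ / ‖b‖ ^ 2) γ t := by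
    intro t
    rw [ProbabilityTheory.cauchyPDFReal_def]
    change _ = _ * (_ * (p / ‖b‖ ^ 3) * ((t - _) ^ 2 + (p / ‖b‖ ^ 3) ^ 2)⁻¹)
    have h1 : (t - ⟪y, b⟫ / ‖b‖ ^ 2) ^ 2 + (p / ‖b‖ ^ 3) ^ 2 = ‖y - t • b‖ ^ 2 / ‖b‖ ^ 2 := by
      rw [div_pow p, hp2, norm_sub_sq_real, inner_smul_right, norm_smul, mul_pow,
        Real.norm_eq_abs, sq_abs]
      field_simp
      ring
    rw [h1]
    have := Real.pi_ne_zero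
    field_simp
  simp_rw [key]
  have := ProbabilityTheory.lintegral_cauchyPDF_eq_one (⟪y, b⟫ / ‖b‖ ^ 2) hγ
  simp_rw [ENNReal.ofReal_mul (show 0 ≤ Real.pi * ‖b‖ by positivity)]
  rw [lintegral_const_mul' _ _ ENNReal.ofReal_ne_top]
  change _ * ∫⁻ t, ProbabilityTheory.cauchyPDF (⟪y, b⟫ / ‖b‖ ^ 2) γ t ≤ _
  rw [this, mul_one]

lemma hardy_scalar {n : ℕ} (b : EuclideanSpace ℝ (Fin n)) (hb : b ≠ 0)
    (g : EuclideanSpace ℝ (Fin n) → ℝ) (hg : ContDiff ℝ 1 g) (hc : HasCompactSupport g) :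
    ∫⁻ x, ENNReal.ofReal (‖(‖b‖ ^ 2) • x - ⟪x, b⟫ • b‖ / ‖x‖ ^ 2) * ‖g x‖ₑ
      ≤ ENNReal.ofReal (Real.pi * ‖b‖) * ∫⁻ x, ‖fderiv ℝ g x b‖ₑ := by
  set W : EuclideanSpace ℝ (Fin n) → ℝ≥0∞ :=
    fun x => ENNReal.ofReal (‖(‖b‖ ^ 2) • x - ⟪x, b⟫ • b‖ / ‖x‖ ^ 2) with hW
  have hWm : Measurable W := by
    apply ENNReal.measurable_ofReal.comp
    apply Measurable.div
    · exact (by fun_prop : Continuous fun x : EuclideanSpace ℝ (Fin n) =>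
        ‖(‖b‖ ^ 2) • x - ⟪x, b⟫ • b‖).measurable
    · fun_prop
  have hGc : Continuous fun x => fderiv ℝ g x b :=
    (hg.continuous_fderiv one_ne_zero).clm_apply continuous_const
  have hGm : Measurable fun x => ‖fderiv ℝ g x b‖ₑ := hGc.measurable.enorm
  have hpt : ∀ x, ‖g x‖ₑ ≤ ∫⁻ t : ℝ, ‖fderiv ℝ g (x + t • b) b‖ₑ := by
    intro x
    have hcl : Topology.IsClosedEmbedding (fun t : ℝ => x + t • b) :=
      (Homeomorph.addLeft x).isClosedEmbedding.comp (isClosedEmbedding_smul_left hb)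
    have h1 : ContDiff ℝ 1 (fun t : ℝ => g (x + t • b)) := hg.comp (by fun_prop)
    have h2 : HasCompactSupport (fun t : ℝ => g (x + t • b)) := hc.comp_isClosedEmbedding hcl
    have h3 := HasCompactSupport.enorm_le_lintegral_Ici_deriv h1 h2 0
    simp only [zero_smul, add_zero] at h3
    refine h3.trans ((setLIntegral_le_lintegral _ _).trans (le_of_eq ?_))
    refine lintegral_congr fun t => ?_
    have hd : HasDerivAt (fun t : ℝ => x + t • b) b t := by
      simpa using ((hasDerivAt_id t).smul_const b).const_add x
    have := ((hg.differentiable one_ne_zero (x + t • b)).hasFDerivAt.comp_hasDerivAt t hd).deriv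
    rw [← this]; rfl
  calc ∫⁻ x, W x * ‖g x‖ₑ
      ≤ ∫⁻ x, ∫⁻ t : ℝ, W x * ‖fderiv ℝ g (x + t • b) b‖ₑ := by
        refine lintegral_mono fun x => ?_
        have hm : Measurable fun t : ℝ => ‖fderiv ℝ g (x + t • b) b‖ₑ :=
          hGm.comp (by fun_prop : Measurable fun t : ℝ => x + t • b)
        rw [lintegral_const_mul _ hm]
        gcongr
        exact hpt x
    _ = ∫⁻ t : ℝ, ∫⁻ x, W x * ‖fderiv ℝ g (x + t • b) b‖ₑ := by
        apply lintegral_lintegral_swap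
        apply Measurable.aemeasurable
        exact (hWm.comp measurable_fst).mul (hGm.comp
          (by fun_prop : Measurable fun z : EuclideanSpace ℝ (Fin n) × ℝ => z.1 + z.2 • b))
    _ = ∫⁻ t : ℝ, ∫⁻ y, W (y - t • b) * ‖fderiv ℝ g y b‖ₑ := by
        refine lintegral_congr fun t => ?_
        rw [← lintegral_add_right_eq_self (fun y => W (y - t • b) * ‖fderiv ℝ g y b‖ₑ) (t • b)]
        simp
    _ = ∫⁻ y, ∫⁻ t : ℝ, W (y - t • b) * ‖fderiv ℝ g y b‖ₑ := by
        apply lintegral_lintegral_swap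
        apply Measurable.aemeasurable
        exact (hWm.comp
          (by fun_prop : Measurable fun z : ℝ × EuclideanSpace ℝ (Fin n) => z.2 - z.1 • b)).mul
          (hGm.comp measurable_snd)
    _ ≤ ∫⁻ y, ENNReal.ofReal (Real.pi * ‖b‖) * ‖fderiv ℝ g y b‖ₑ := by
        refine lintegral_mono fun y => ?_
        have hm : Measurable fun t : ℝ => W (y - t • b) :=
          hWm.comp (by fun_prop : Measurable fun t : ℝ => y - t • b)
        rw [lintegral_mul_const _ hm]
        gcongr
        exact hardy_line b hb y
    _ = _ := lintegral_const_mul _ hGm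

lemma hardy_coercive {V : Type*} [NormedAddCommGroup V] [InnerProductSpace ℝ V]
    [FiniteDimensional ℝ V] {n ℓ : ℕ} (a : Fin ℓ → V) (b : Fin ℓ → EuclideanSpace ℝ (Fin n))
    (h : ∀ ξ : EuclideanSpace ℝ (Fin n), ξ ≠ 0 → ∀ v : V, v ≠ 0 →
          ∃ i, ⟪a i, v⟫ ≠ 0 ∧ (‖b i‖ ^ 2) • ξ ≠ ⟪ξ, b i⟫ • b i) :
    ∃ c : ℝ, 0 < c ∧ ∀ x v, c * (‖x‖ * ‖v‖) ≤
      ∑ i, ‖(‖b i‖ ^ 2) • x - ⟪x, b i⟫ • b i‖ * ‖⟪a i, v⟫‖ := by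
  let Q : EuclideanSpace ℝ (Fin n) × V → ℝ := fun z =>
    ∑ i, ‖(‖b i‖ ^ 2) • z.1 - ⟪z.1, b i⟫ • b i‖ * ‖⟪a i, z.2⟫‖
  have hQ : Continuous Q := by fun_prop
  have hK : IsCompact (Metric.sphere (0 : EuclideanSpace ℝ (Fin n)) 1 ×ˢ
      Metric.sphere (0 : V) 1) := (isCompact_sphere _ _).prod (isCompact_sphere _ _)
  obtain ⟨c, hc, hcQ⟩ := hK.exists_forall_le' hQ.continuousOn (a := 0) (by
    rintro ⟨ξ, v⟩ ⟨h1, h2⟩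
    simp only [mem_sphere_zero_iff_norm] at h1 h2
    obtain ⟨i, hi1, hi2⟩ := h ξ (by rintro rfl; simp at h1) v (by rintro rfl; simp at h2)
    apply Finset.sum_pos' (fun i _ => by positivity)
    refine ⟨i, Finset.mem_univ _, mul_pos (norm_pos_iff.2 (sub_ne_zero.2 hi2))
      (norm_pos_iff.2 hi1)⟩)
  refine ⟨c, hc, fun x v => ?_⟩
  by_cases hx : x = 0
  · subst hx; simp
  by_cases hv : v = 0
  · subst hv; simp
  have hx' : 0 < ‖x‖ := norm_pos_iff.2 hx
  have hv' : 0 < ‖v‖ := norm_pos_iff.2 hv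
  have := hcQ (‖x‖⁻¹ • x, ‖v‖⁻¹ • v) ⟨by simp [norm_smul, hx'.ne'], by simp [norm_smul, hv'.ne']⟩
  have h2 : Q (‖x‖⁻¹ • x, ‖v‖⁻¹ • v) = (‖x‖ * ‖v‖)⁻¹ * Q (x, v) := by
    simp only [Q, Finset.mul_sum]
    refine Finset.sum_congr rfl fun i _ => ?_
    rw [inner_smul_left, inner_smul_right, smul_comm, conj_trivial, mul_smul, ← smul_sub,
      norm_smul, norm_mul]
    simp only [norm_inv, norm_norm, mul_inv]
    ring
  rw [h2] at this
  change _ ≤ Q (x, v)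
  rw [inv_mul_eq_div, le_div_iff₀ (by positivity)] at this
  exact this

lemma hardy_suff {V : Type*} [NormedAddCommGroup V] [InnerProductSpace ℝ V]
    [FiniteDimensional ℝ V] {n ℓ : ℕ} (a : Fin ℓ → V) (b : Fin ℓ → EuclideanSpace ℝ (Fin n))
    (hb : ∀ i, b i ≠ 0)
    (h : ∀ ξ : EuclideanSpace ℝ (Fin n), ξ ≠ 0 → ∀ v : V, v ≠ 0 →
          ∃ i, ⟪a i, v⟫ ≠ 0 ∧ (‖b i‖ ^ 2) • ξ ≠ ⟪ξ, b i⟫ • b i) (hn : 0 < n) :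
    ∃ C : ℝ, 0 < C ∧ ∀ u : EuclideanSpace ℝ (Fin n) → V, IsTestFun u →
        ∫⁻ x, (‖u x‖₊ : ℝ≥0∞) / (‖x‖₊ : ℝ≥0∞)
          ≤ ENNReal.ofReal C *
              ∑ i, ∫⁻ x, (‖⟪a i, fderiv ℝ u x (b i)⟫‖₊ : ℝ≥0∞) := by
  have : Nonempty (Fin n) := ⟨⟨0, hn⟩⟩
  obtain ⟨c, hc, hcc⟩ := hardy_coercive a b h
  let M : ℝ := ∑ i, Real.pi * ‖b i‖ + 1
  have hM0 : 0 < M := by positivity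
  have hM : ∀ i, Real.pi * ‖b i‖ ≤ M := fun i => by
    have : Real.pi * ‖b i‖ ≤ ∑ i, Real.pi * ‖b i‖ :=
      Finset.single_le_sum (f := fun i => Real.pi * ‖b i‖)
        (fun i _ => by positivity) (Finset.mem_univ i)
    simp only [M]; linarith
  refine ⟨c⁻¹ * M, by positivity, fun u hu => ?_⟩
  have hu1 : ContDiff ℝ 1 u := hu.1.of_le (by exact_mod_cast le_top)
  let g : Fin ℓ → EuclideanSpace ℝ (Fin n) → ℝ := fun i x => ⟪a i, u x⟫
  have hg : ∀ i, ContDiff ℝ 1 (g i) := fun i => contDiff_const.inner ℝ hu1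
  have hgc : ∀ i, HasCompactSupport (g i) := fun i =>
    hu.2.comp_left (g := fun v => ⟪a i, v⟫) (inner_zero_right _)
  have hgd : ∀ i x, fderiv ℝ (g i) x (b i) = ⟪a i, fderiv ℝ u x (b i)⟫ := fun i x => by
    have h1 : HasFDerivAt (g i) ((innerSL ℝ (a i)).comp (fderiv ℝ u x)) x :=
      (innerSL ℝ (a i)).hasFDerivAt.comp x (hu1.differentiable one_ne_zero x).hasFDerivAt
    rw [h1.fderiv]; rfl
  let W : Fin ℓ → EuclideanSpace ℝ (Fin n) → ℝ := fun i x =>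
    ‖(‖b i‖ ^ 2) • x - ⟪x, b i⟫ • b i‖ / ‖x‖ ^ 2
  have hWm : ∀ i, Measurable (W i) := fun i => by
    apply Measurable.div
    · exact (by fun_prop : Continuous fun x : EuclideanSpace ℝ (Fin n) =>
        ‖(‖b i‖ ^ 2) • x - ⟪x, b i⟫ • b i‖).measurable
    · fun_prop
  have hpt : ∀ x : EuclideanSpace ℝ (Fin n), x ≠ 0 → (‖u x‖₊ : ℝ≥0∞) / (‖x‖₊ : ℝ≥0∞) ≤
      ENNReal.ofReal c⁻¹ * ∑ i, ENNReal.ofReal (W i x) * ‖g i x‖ₑ := by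
    intro x hx
    have hx' : 0 < ‖x‖ := norm_pos_iff.2 hx
    have e1 : (‖u x‖₊ : ℝ≥0∞) / (‖x‖₊ : ℝ≥0∞) = ENNReal.ofReal (‖u x‖ / ‖x‖) := by
      rw [ENNReal.ofReal_div_of_pos hx', ofReal_norm, ofReal_norm]; rfl
    have e2 : ENNReal.ofReal c⁻¹ * ∑ i, ENNReal.ofReal (W i x) * ‖g i x‖ₑ =
        ENNReal.ofReal (c⁻¹ * ∑ i, W i x * ‖g i x‖) := by
      rw [ENNReal.ofReal_mul (by positivity), ENNReal.ofReal_sum_of_nonneg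
        (fun i _ => by positivity)]
      congr 1
      refine Finset.sum_congr rfl fun i _ => ?_
      rw [ENNReal.ofReal_mul (by positivity), ofReal_norm]
    rw [e1, e2]
    apply ENNReal.ofReal_le_ofReal
    have h1 : ∑ i, W i x * ‖g i x‖ = (∑ i, ‖(‖b i‖ ^ 2) • x - ⟪x, b i⟫ • b i‖ *
        ‖⟪a i, u x⟫‖) / ‖x‖ ^ 2 := by
      rw [Finset.sum_div]
      refine Finset.sum_congr rfl fun i _ => ?_
      simp only [W, g]; ring
    rw [h1]
    have h2 := hcc x (u x)
    calc ‖u x‖ / ‖x‖ = c⁻¹ * (c * (‖x‖ * ‖u x‖) / ‖x‖ ^ 2) := by field_simp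
      _ ≤ _ := by gcongr
  have hae : ∀ᵐ x : EuclideanSpace ℝ (Fin n), x ≠ 0 := by
    have : Nontrivial (EuclideanSpace ℝ (Fin n)) := inferInstance
    exact MeasureTheory.Measure.ae_ne volume 0
  calc ∫⁻ x, (‖u x‖₊ : ℝ≥0∞) / (‖x‖₊ : ℝ≥0∞)
      ≤ ∫⁻ x, ENNReal.ofReal c⁻¹ * ∑ i, ENNReal.ofReal (W i x) * ‖g i x‖ₑ :=
        lintegral_mono_ae (hae.mono hpt)
    _ = ENNReal.ofReal c⁻¹ * ∑ i, ∫⁻ x, ENNReal.ofReal (W i x) * ‖g i x‖ₑ := by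
        rw [lintegral_const_mul' _ _ ENNReal.ofReal_ne_top, lintegral_finsetSum]
        exact fun i _ => (hWm i).ennreal_ofReal.mul (hg i).continuous.measurable.enorm
    _ ≤ ENNReal.ofReal c⁻¹ * ∑ i, ENNReal.ofReal M *
          ∫⁻ x, (‖⟪a i, fderiv ℝ u x (b i)⟫‖₊ : ℝ≥0∞) := by
        gcongr with i
        refine (hardy_scalar (b i) (hb i) (g i) (hg i) (hgc i)).trans ?_
        gcongr
        · exact hM i
        · rw [hgd]; rfl
    _ = _ := by
        rw [← Finset.mul_sum, ENNReal.ofReal_mul (by positivity), mul_assoc]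

lemma hardy_inv_top (c : ℝ) (hc : |c| < 1 / 2) (r : ℝ≥0∞) (hr : r ≠ 0) :
    ∫⁻ t in Set.Ioc (-(1 / 2) : ℝ) (1 / 2), r / ‖c + t‖ₑ = ∞ := by
  have h1 : ¬ IntervalIntegrable (fun t : ℝ => (t - (-c))⁻¹) volume (-(1 / 2)) (1 / 2) := by
    rw [intervalIntegrable_sub_inv_iff]
    rw [abs_lt] at hc
    push Not
    refine ⟨by norm_num, ?_⟩
    rw [Set.uIcc_of_le (by norm_num)]
    constructor <;> linarith [hc.1, hc.2]
  rw [intervalIntegrable_iff_integrableOn_Ioc_of_le (by norm_num)] at h1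
  have h2 : ∫⁻ t in Set.Ioc (-(1 / 2) : ℝ) (1 / 2), ‖(t - (-c))⁻¹‖ₑ = ∞ := by
    by_contra h
    exact h1 ⟨(by fun_prop : Measurable fun t : ℝ => (t - (-c))⁻¹).aestronglyMeasurable,
      lt_top_iff_ne_top.2 h⟩
  have h3 : ∫⁻ t in Set.Ioc (-(1 / 2) : ℝ) (1 / 2), r * ‖(t - (-c))⁻¹‖ₑ = ∞ := by
    rw [lintegral_const_mul _ (by fun_prop), h2, ENNReal.mul_top hr]
  rw [eq_top_iff, ← h3]
  refine lintegral_mono fun t => ?_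
  rw [div_eq_mul_inv]
  gcongr
  by_cases h0 : c + t = 0
  · simp [h0]
  · rw [show t - -c = c + t by ring, enorm_inv h0]

lemma hardy_top {V : Type*} [NormedAddCommGroup V] [InnerProductSpace ℝ V]
    [FiniteDimensional ℝ V] {n : ℕ} (ξ : EuclideanSpace ℝ (Fin n)) (hξ : ‖ξ‖ = 1)
    (u : EuclideanSpace ℝ (Fin n) → V) (hu : Continuous u) (v : V) (hv : v ≠ 0)
    (huv : ∀ x, ‖x‖ ≤ 1 → u x = v) :
    ∫⁻ y, ‖u y‖ₑ / ‖⟪ξ, y⟫‖ₑ = ∞ := by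
  set F : EuclideanSpace ℝ (Fin n) → ℝ≥0∞ := fun y => ‖u y‖ₑ / ‖⟪ξ, y⟫‖ₑ with hF
  have hFm : Measurable F := by
    apply Measurable.div
    · exact hu.enorm.measurable
    · exact (by fun_prop : Continuous fun y : EuclideanSpace ℝ (Fin n) => ‖⟪ξ, y⟫‖ₑ).measurable
  have e1 : ∫⁻ x, ∫⁻ t in Set.Ioc (-(1 / 2) : ℝ) (1 / 2), F (x + t • ξ) = ∫⁻ y, F y := by
    rw [lintegral_lintegral_swap]
    · simp_rw [lintegral_add_right_eq_self F]
      rw [setLIntegral_const, Real.volume_Ioc]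
      norm_num
    · exact (hFm.comp (by fun_prop : Measurable
        fun z : EuclideanSpace ℝ (Fin n) × ℝ => z.1 + z.2 • ξ)).aemeasurable
  rw [← e1, eq_top_iff]
  calc (∞ : ℝ≥0∞) = ∫⁻ x in Metric.ball (0 : EuclideanSpace ℝ (Fin n)) (1 / 2), ∞ := by
        rw [setLIntegral_const, ENNReal.top_mul]
        exact (Metric.measure_ball_pos volume _ (by norm_num)).ne'
    _ ≤ ∫⁻ x in Metric.ball (0 : EuclideanSpace ℝ (Fin n)) (1 / 2),
          ∫⁻ t in Set.Ioc (-(1 / 2) : ℝ) (1 / 2), F (x + t • ξ) := by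
        refine setLIntegral_mono' measurableSet_ball fun x hx => ?_
        rw [mem_ball_zero_iff] at hx
        have hc : |⟪ξ, x⟫| < 1 / 2 := by
          have := abs_real_inner_le_norm ξ x
          rw [hξ, one_mul] at this
          linarith
        rw [← hardy_inv_top ⟪ξ, x⟫ hc ‖v‖ₑ (by simpa using hv)]
        refine setLIntegral_mono' measurableSet_Ioc fun t ht => le_of_eq ?_
        simp only [hF]
        rw [huv, inner_add_right, inner_smul_right, real_inner_self_eq_norm_sq, hξ]
        · simp
        · refine (norm_add_le _ _).trans ?_
          rw [norm_smul, hξ, mul_one, Real.norm_eq_abs]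
          have : |t| ≤ 1 / 2 := abs_le.2 ⟨ht.1.le, ht.2⟩
          linarith
    _ ≤ _ := setLIntegral_le_lintegral _ _

/-- Anisotropic dilation: identity along `ξ`, factor `ε` orthogonally to it. -/
def hardyS {n : ℕ} (ξ : EuclideanSpace ℝ (Fin n)) (ε : ℝ) :
    EuclideanSpace ℝ (Fin n) →L[ℝ] EuclideanSpace ℝ (Fin n) :=
  ε • ContinuousLinearMap.id ℝ _ + (1 - ε) • (innerSL ℝ ξ).smulRight ξ

lemma hardyS_apply {n : ℕ} (ξ : EuclideanSpace ℝ (Fin n)) (ε : ℝ)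
    (x : EuclideanSpace ℝ (Fin n)) :
    hardyS ξ ε x = ε • x + (1 - ε) • ⟪ξ, x⟫ • ξ := by
  simp [hardyS]

lemma hardyS_comp {n : ℕ} (ξ : EuclideanSpace ℝ (Fin n)) (hξ : ‖ξ‖ = 1) (ε δ : ℝ)
    (h : ε * δ = 1) (x : EuclideanSpace ℝ (Fin n)) :
    hardyS ξ ε (hardyS ξ δ x) = x := by
  simp only [hardyS_apply, inner_add_right, inner_smul_right, real_inner_self_eq_norm_sq, hξ,
    smul_add, smul_smul]
  rw [h, one_smul, add_assoc, ← add_smul]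
  convert add_zero x using 2
  convert zero_smul ℝ ξ using 2
  linear_combination (-⟪ξ, x⟫) * h

lemma hardy_change {n : ℕ} (ξ : EuclideanSpace ℝ (Fin n)) (hξ : ‖ξ‖ = 1) (ε δ : ℝ)
    (h : ε * δ = 1) :
    ∃ c : ℝ≥0∞, c ≠ 0 ∧ c ≠ ∞ ∧ ∀ f : EuclideanSpace ℝ (Fin n) → ℝ≥0∞, Measurable f →
      ∫⁻ x, f (hardyS ξ δ x) = c * ∫⁻ x, f x := by
  have hdet : LinearMap.det (hardyS ξ δ : EuclideanSpace ℝ (Fin n) →ₗ[ℝ] _) ≠ 0 := by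
    intro h0
    have h1 : (hardyS ξ ε : EuclideanSpace ℝ (Fin n) →ₗ[ℝ] _) ∘ₗ
        (hardyS ξ δ : EuclideanSpace ℝ (Fin n) →ₗ[ℝ] _) = LinearMap.id :=
      LinearMap.ext fun x => hardyS_comp ξ hξ ε δ h x
    have h2 := congrArg LinearMap.det h1
    rw [LinearMap.det_comp, h0, mul_zero, LinearMap.det_id] at h2
    exact zero_ne_one h2
  refine ⟨ENNReal.ofReal |(LinearMap.det (hardyS ξ δ : EuclideanSpace ℝ (Fin n) →ₗ[ℝ] _))⁻¹|,
    ?_, ENNReal.ofReal_ne_top, fun f hf => ?_⟩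
  · simp [hdet]
  · have := Measure.map_linearMap_addHaar_eq_smul_addHaar
      (volume : Measure (EuclideanSpace ℝ (Fin n))) hdet
    rw [← smul_eq_mul, ← lintegral_smul_measure, ← this]
    exact (lintegral_map hf (hardyS ξ δ).continuous.measurable).symm

lemma hardy_nec {V : Type*} [NormedAddCommGroup V] [InnerProductSpace ℝ V]
    [FiniteDimensional ℝ V] {n ℓ : ℕ} (a : Fin ℓ → V) (b : Fin ℓ → EuclideanSpace ℝ (Fin n))
    (hb : ∀ i, b i ≠ 0) (C : ℝ)
    (hC : ∀ u : EuclideanSpace ℝ (Fin n) → V, IsTestFun u →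
        ∫⁻ x, (‖u x‖₊ : ℝ≥0∞) / (‖x‖₊ : ℝ≥0∞)
          ≤ ENNReal.ofReal C *
              ∑ i, ∫⁻ x, (‖⟪a i, fderiv ℝ u x (b i)⟫‖₊ : ℝ≥0∞))
    (ξ : EuclideanSpace ℝ (Fin n)) (hξ : ‖ξ‖ = 1) (v : V) (hv : v ≠ 0)
    (h : ∀ i, ⟪a i, v⟫ ≠ 0 → (‖b i‖ ^ 2) • ξ = ⟪ξ, b i⟫ • b i) : False := by
  let η : ContDiffBump (0 : EuclideanSpace ℝ (Fin n)) := ⟨1, 2, one_pos, one_lt_two⟩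
  let w : EuclideanSpace ℝ (Fin n) → V := fun x => η x • v
  have hw : ContDiff ℝ (⊤ : ℕ∞) w := η.contDiff.smul contDiff_const
  have hwc : HasCompactSupport w := η.hasCompactSupport.smul_right
  have hw1 : ContDiff ℝ 1 w := hw.of_le (by exact_mod_cast le_top)
  have hwv : ∀ x, ‖x‖ ≤ 1 → w x = v := fun x hx => by
    have : η x = 1 := η.one_of_mem_closedBall (by simpa [η] using hx)
    simp [w, this]
  have hGc : ∀ i, Continuous fun x => ⟪a i, fderiv ℝ w x (b i)⟫ := fun i =>
    continuous_const.inner ((hw1.continuous_fderiv one_ne_zero).clm_apply continuous_const)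
  have hGs : ∀ i, HasCompactSupport fun x => ⟪a i, fderiv ℝ w x (b i)⟫ := fun i =>
    (hwc.fderiv_apply (𝕜 := ℝ) (b i)).comp_left (g := fun v => ⟪a i, v⟫) (inner_zero_right _)
  have hGfin : ∀ i, ∫⁻ x, ‖⟪a i, fderiv ℝ w x (b i)⟫‖ₑ ≠ ∞ := fun i =>
    ((hGc i).integrable_of_hasCompactSupport (hGs i)).2.ne
  set B : ℝ≥0∞ := ENNReal.ofReal C * ∑ i, ∫⁻ x, ‖⟪a i, fderiv ℝ w x (b i)⟫‖ₑ with hB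
  have hBfin : B ≠ ∞ := ENNReal.mul_ne_top ENNReal.ofReal_ne_top
    (ENNReal.sum_ne_top.2 fun i _ => hGfin i)
  have hden : ∀ ε : ℝ, Measurable fun y => ‖w y‖ₑ / ‖hardyS ξ ε y‖ₑ := fun ε =>
    hw.continuous.enorm.measurable.div (hardyS ξ ε).continuous.enorm.measurable
  have hbd : ∀ ε : ℝ, 0 < ε → ∫⁻ y, ‖w y‖ₑ / ‖hardyS ξ ε y‖ₑ ≤ B := by
    intro ε hε
    have hed : ε * ε⁻¹ = 1 := mul_inv_cancel₀ hε.ne'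
    obtain ⟨c, hc0, hct, hcf⟩ := hardy_change ξ hξ ε ε⁻¹ hed
    have hfix : hardyS ξ ε⁻¹ ξ = ξ := by
      rw [hardyS_apply, real_inner_self_eq_norm_sq, hξ, smul_smul, ← add_smul]
      convert one_smul ℝ ξ using 2
      ring
    have hT : IsTestFun (fun x => w (hardyS ξ ε⁻¹ x)) := by
      refine ⟨hw.comp (hardyS ξ ε⁻¹).contDiff, ?_⟩
      have hcl : Topology.IsClosedEmbedding (hardyS ξ ε⁻¹) := by
        refine LinearMap.isClosedEmbedding_of_injective (f := (hardyS ξ ε⁻¹ :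
          EuclideanSpace ℝ (Fin n) →ₗ[ℝ] EuclideanSpace ℝ (Fin n))) ?_
        rw [LinearMap.ker_eq_bot]
        exact Function.LeftInverse.injective (g := hardyS ξ ε) (hardyS_comp ξ hξ ε ε⁻¹ hed)
      exact hwc.comp_isClosedEmbedding hcl
    have h1 := hC _ hT
    have e1 : ∫⁻ x, (‖w (hardyS ξ ε⁻¹ x)‖₊ : ℝ≥0∞) / (‖x‖₊ : ℝ≥0∞)
        = c * ∫⁻ y, ‖w y‖ₑ / ‖hardyS ξ ε y‖ₑ := by
      rw [← hcf _ (hden ε)]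
      refine lintegral_congr fun x => ?_
      rw [hardyS_comp ξ hξ ε ε⁻¹ hed]; rfl
    have e2 : ∀ i, ∫⁻ x, (‖⟪a i, fderiv ℝ (fun x => w (hardyS ξ ε⁻¹ x)) x (b i)⟫‖₊ : ℝ≥0∞)
        = c * ∫⁻ x, ‖⟪a i, fderiv ℝ w x (b i)⟫‖ₑ := by
      intro i
      rw [← hcf _ (hGc i).enorm.measurable]
      refine lintegral_congr fun x => ?_
      have hd : fderiv ℝ (fun x => w (hardyS ξ ε⁻¹ x)) x
          = (fderiv ℝ w (hardyS ξ ε⁻¹ x)).comp (hardyS ξ ε⁻¹) :=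
        ((hw1.differentiable one_ne_zero _).hasFDerivAt.comp x
          (hardyS ξ ε⁻¹).hasFDerivAt).fderiv
      rw [hd]
      change ‖⟪a i, fderiv ℝ w (hardyS ξ ε⁻¹ x) (hardyS ξ ε⁻¹ (b i))⟫‖ₑ = _
      by_cases hav : ⟪a i, v⟫ = 0
      · have hz : ∀ y z, ⟪a i, fderiv ℝ w y z⟫ = 0 := by
          intro y z
          have : fderiv ℝ w y = (fderiv ℝ η y).smulRight v := by
            have hη : DifferentiableAt ℝ η y :=
              (η.contDiff (n := 1)).differentiable one_ne_zero y
            exact (hη.hasFDerivAt.smul_const v).fderiv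
          rw [this, ContinuousLinearMap.smulRight_apply, inner_smul_right, hav, mul_zero]
        rw [hz, hz]
      · have hi := h i hav
        have hk : ⟪ξ, b i⟫ ≠ 0 := by
          intro h0
          rw [h0, zero_smul, smul_eq_zero] at hi
          rcases hi with hi | hi
          · exact hb i (by simpa using hi)
          · simp [hi] at hξ
        have : hardyS ξ ε⁻¹ (b i) = b i := by
          have h5 := congrArg (hardyS ξ ε⁻¹) hi
          rw [map_smul, map_smul, hfix, hi] at h5
          exact (smul_right_injective _ hk h5).symm
        rw [this]
    rw [e1, Finset.sum_congr rfl fun i _ => e2 i, ← Finset.mul_sum, mul_left_comm] at h1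
    exact (ENNReal.mul_le_mul_iff_right hc0 hct).1 h1
  have hlim : ∀ y, Filter.Tendsto (fun k : ℕ => ‖w y‖ₑ / ‖hardyS ξ (1 / ((k : ℝ) + 1)) y‖ₑ)
      Filter.atTop (nhds (‖w y‖ₑ / ‖⟪ξ, y⟫‖ₑ)) := by
    intro y
    apply ENNReal.Tendsto.const_div _ (Or.inr enorm_ne_top)
    have h1 : Filter.Tendsto (fun k : ℕ => hardyS ξ (1 / ((k : ℝ) + 1)) y) Filter.atTop
        (nhds ((0 : ℝ) • y + ((1 : ℝ) - 0) • ⟪ξ, y⟫ • ξ)) := by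
      simp_rw [hardyS_apply]
      have h0 : Filter.Tendsto (fun k : ℕ => 1 / ((k : ℝ) + 1)) Filter.atTop (nhds 0) :=
        tendsto_one_div_add_atTop_nhds_zero_nat
      exact (h0.smul_const y).add ((h0.const_sub 1).smul_const _)
    have h2 := h1.enorm
    have h3 : ‖ξ‖ₑ = 1 := by rw [← ofReal_norm, hξ, ENNReal.ofReal_one]
    simpa [enorm_smul, h3] using h2
  have hF := lintegral_liminf_le (μ := (volume : Measure (EuclideanSpace ℝ (Fin n))))
    (u := Filter.atTop) (fun k : ℕ => hden (1 / ((k : ℝ) + 1)))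
  simp_rw [fun y => (hlim y).liminf_eq] at hF
  rw [hardy_top ξ hξ w hw.continuous v hv hwv, top_le_iff] at hF
  have hF2 : Filter.liminf (fun k : ℕ => ∫⁻ y, ‖w y‖ₑ / ‖hardyS ξ (1 / ((k : ℝ) + 1)) y‖ₑ)
      Filter.atTop ≤ B := by
    refine (Filter.liminf_le_liminf (Filter.Eventually.of_forall fun k : ℕ =>
      hbd (1 / ((k : ℝ) + 1)) Nat.one_div_pos_of_nat)).trans ?_
    simp
  rw [hF, top_le_iff] at hF2
  exact hBfin hF2

/-- Proposition: Hardy inequality for direct sums of directional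
derivatives. For `a_1, …, a_ℓ ∈ V \ {0}` and `b_1, …, b_ℓ ∈ ℝⁿ \ {0}`, the Hardy
inequality `∫ |u(x)|/|x| dx ≤ C ∑_i ∫ |a_i · Du(x)[b_i]| dx` for all `u ∈ C_c^∞(ℝⁿ; V)`
holds iff for every `ξ ≠ 0` and `v ≠ 0` there is `i` with `a_i · v ≠ 0` and
`|b_i|² ξ ≠ (ξ · b_i) b_i`. -/
theorem statement13
    {V : Type*} [NormedAddCommGroup V] [InnerProductSpace ℝ V] [FiniteDimensional ℝ V]
    {n ℓ : ℕ} (hn : 0 < n) (hℓ : 0 < ℓ)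
    (a : Fin ℓ → V) (ha : ∀ i, a i ≠ 0)
    (b : Fin ℓ → EuclideanSpace ℝ (Fin n)) (hb : ∀ i, b i ≠ 0) :
    (∃ C : ℝ, 0 < C ∧ ∀ u : EuclideanSpace ℝ (Fin n) → V, IsTestFun u →
        ∫⁻ x, (‖u x‖₊ : ℝ≥0∞) / (‖x‖₊ : ℝ≥0∞)
          ≤ ENNReal.ofReal C *
              ∑ i, ∫⁻ x, (‖⟪a i, fderiv ℝ u x (b i)⟫‖₊ : ℝ≥0∞))
      ↔ (∀ ξ : EuclideanSpace ℝ (Fin n), ξ ≠ 0 → ∀ v : V, v ≠ 0 →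
          ∃ i, ⟪a i, v⟫ ≠ 0 ∧ (‖b i‖ ^ 2) • ξ ≠ ⟪ξ, b i⟫ • b i) := by
  constructor
  · rintro ⟨C, _, hC⟩ ξ hξ v hv
    by_contra hcon
    push Not at hcon
    have hξ' : ‖ξ‖ ≠ 0 := norm_ne_zero_iff.2 hξ
    refine hardy_nec a b hb C hC (‖ξ‖⁻¹ • ξ) (by simp [norm_smul, hξ']) v hv fun i hi => ?_
    rw [inner_smul_left, smul_comm, hcon i hi, smul_smul]
    rfl
  · exact fun h => hardy_suff a b hb h hn
end
end

section
/- Let V and E_1, …, E_ℓ be finite-dimensional real inner product spaces and E = E_1 ⊕ ⋯ ⊕ E_ℓ. For each i ∈ {1, …, ℓ}, let P_i : ℝⁿ → ℝⁿ be a linear projection with range Π_i, let Q_i : V → V be a linear projection with range V_i, and let A_i be an elliptic homogeneous linear differential operator of order 1 on Π_i from V_i to E_i. Let A(D) be the homogeneous linear differential operator of order 1 on ℝⁿ from V to E with symbol A(ξ) = ∑_{i=1}^{ℓ} A_i(P_i(ξ)) ∘ Q_i (its E_i-component at ξ applied to v ∈ V being A_i(P_i(ξ))[Q_i(v)]). For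 each i set I_i = { j : ker P_i ⊄ ker P_j and ker P_j ⊄ ker P_i }. If ⋂_{i=1}^{ℓ} ker Q_i = {0} and for every i ∈ {1, …, ℓ}, ⋂_{j ∈ I_i} ker Q_j ⊆ ker Q_i, then there exists C > 0 such that for every u ∈ C_c^∞(ℝⁿ; V), ∫_{ℝⁿ} |u(x)| / |x| dx ≤ C ∫_{ℝⁿ} |A(D)u(x)| dx. -/
open MeasureTheory ENNReal
open scoped NNReal RealInnerProductSpace

noncomputable section

section FourierPart
open scoped SchwartzMap FourierTransform LineDeriv

variable {W : Type*} [NormedAddCommGroup W] [InnerProductSpace ℝ W] [FiniteDimensional ℝ W]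
  [MeasurableSpace W] [BorelSpace W]

lemma hd_schwartz_zero (g : 𝓢(W, ℂ)) : g 0 = ∫ ξ, (𝓕 g) ξ := by
  have h : 𝓕⁻ (𝓕 g) = g := FourierTransform.fourierInv_fourier_eq g
  conv_lhs => rw [← h]
  rw [SchwartzMap.fourierInv_coe, Real.fourierInv_eq]
  simp

lemma hd_fourier_lineDeriv (g : 𝓢(W, ℂ)) (w ξ : W) :
    (𝓕 (∂_{w} g)) ξ = (2 * Real.pi * Complex.I) * (⟪ξ, w⟫ : ℝ) * (𝓕 g) ξ := by
  rw [SchwartzMap.fourier_lineDerivOp_eq]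
  rw [smul_apply, SchwartzMap.smulLeftCLM_apply_apply (by fun_prop)]
  simp [mul_assoc]

lemma hd_scale (N F : 𝓢(W, ℂ)) (t : ℝ) (ht : 0 < t) :
    ∫ ξ, N (t • ξ) * (𝓕 F) ξ = ∫ z, (𝓕 N) z * F (t • z) := by
  set L : W →ₗ[ℝ] W →ₗ[ℝ] ℝ := t⁻¹ • innerₗ W with hL
  have key := VectorFourier.integral_fourierIntegral_smul_eq_flip (e := Real.fourierChar)
    (μ := (volume : Measure W)) (ν := (volume : Measure W)) (L := L) (f := F) (g := N)
    Real.continuous_fourierChar (by simp [hL]; fun_prop) F.integrable N.integrable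
  have h1 : ∀ ξ, VectorFourier.fourierIntegral Real.fourierChar volume L F ξ =
      (𝓕 F) (t⁻¹ • ξ) := by
    intro ξ
    rw [SchwartzMap.fourier_coe, Real.fourier_eq]
    simp [VectorFourier.fourierIntegral, hL, inner_smul_right]
  have h2 : ∀ ξ, VectorFourier.fourierIntegral Real.fourierChar volume L.flip N ξ =
      (𝓕 N) (t⁻¹ • ξ) := by
    intro ξ
    rw [SchwartzMap.fourier_coe, Real.fourier_eq]
    simp [VectorFourier.fourierIntegral, hL, inner_smul_right, real_inner_comm]
  simp only [h1, h2, smul_eq_mul] at key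
  have e1 := Measure.integral_comp_smul (volume : Measure W)
    (fun x => N x * (𝓕 F) (t⁻¹ • x)) t
  have e2 := Measure.integral_comp_smul (volume : Measure W)
    (fun x => (𝓕 N) (t⁻¹ • x) * F x) t
  simp only [smul_smul, inv_mul_cancel₀ ht.ne', one_smul] at e1 e2
  rw [e1, e2]
  congr 1
  simpa [mul_comm] using key

lemma hd_parametrix {ι κ : Type*} [Fintype ι] [Fintype κ] [DecidableEq ι]
    (h : 𝓢(W, ℂ)) (N : κ → 𝓢(W, ℂ)) (g : ι → 𝓢(W, ℂ)) (A : κ → ι → W) (l : ι)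
    (h0 : h 0 = 1)
    (hN : ∀ ξ m, ∑ e, N e ξ * (⟪ξ, A e m⟫ : ℝ) = if m = l then fderiv ℝ h ξ ξ else 0) :
    ‖g l 0 - ∫ z, (𝓕 h) z * g l z‖ₑ ≤
      ∑ e, ∫⁻ t in Set.Ioc (0:ℝ) 1, ∫⁻ z, ‖(𝓕 (N e)) z‖ₑ *
        ‖∑ m, (∂_{A e m} (g m)) (t • z)‖ₑ := by
  set Φ := 𝓕 (g l) with hΦ
  have hhd : Differentiable ℝ h := h.differentiable
  have hcd : ∀ ξ, Continuous (fun t : ℝ => fderiv ℝ h (t • ξ) ξ) := by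
    intro ξ
    have : Continuous (fderiv ℝ h) := (h.smooth 1).continuous_fderiv (by simp)
    fun_prop
  have h1 : ∀ ξ, h ξ - 1 = ∫ t in Set.Ioc (0:ℝ) 1, fderiv ℝ h (t • ξ) ξ := by
    intro ξ
    rw [← intervalIntegral.integral_of_le zero_le_one,
      intervalIntegral.integral_eq_sub_of_hasDerivAt (f := fun t : ℝ => h (t • ξ))]
    · simp [h0]
    · intro t _
      have := (hhd (t • ξ)).hasFDerivAt.comp_hasDerivAt t
        ((hasDerivAt_id t).smul_const ξ)
      simpa [Function.comp_def] using this
    · exact (hcd ξ).intervalIntegrable _ _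
  obtain ⟨C, hC⟩ : ∃ C, ∀ x, ‖fderiv ℝ h x‖ ≤ C := by
    obtain ⟨C, -, hC⟩ := h.decay 0 1
    refine ⟨C, fun x => ?_⟩
    have := hC x
    simpa [norm_iteratedFDeriv_one] using this
  have hJint : Integrable (Function.uncurry fun (ξ : W) (t : ℝ) => fderiv ℝ h (t • ξ) ξ * Φ ξ)
      (volume.prod (volume.restrict (Set.Ioc (0:ℝ) 1))) := by
    have hb : Integrable (fun p : W × ℝ => C * (‖p.1‖ ^ 1 * ‖Φ p.1‖))
        (volume.prod (volume.restrict (Set.Ioc (0:ℝ) 1))) :=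
      ((Φ.integrable_pow_mul volume 1).comp_fst _).const_mul C
    refine hb.mono' ?_ ?_
    · apply Continuous.aestronglyMeasurable
      have : Continuous (fderiv ℝ h) := (h.smooth 1).continuous_fderiv (by simp)
      have h2 : Continuous Φ := Φ.continuous
      simp only [Function.uncurry_def]
      fun_prop
    · refine Filter.Eventually.of_forall fun p => ?_
      simp only [Function.uncurry_def, norm_mul, pow_one]
      have := (fderiv ℝ h (p.2 • p.1)).le_opNorm p.1
      have h3 := hC (p.2 • p.1)
      rw [← mul_assoc]
      gcongr
      exact this.trans (by gcongr)
  have hhΦ : Integrable (fun ξ => h ξ * Φ ξ) := by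
    obtain ⟨C', -, hC'⟩ := h.decay 0 0
    refine (Φ.integrable).bdd_mul h.continuous.aestronglyMeasurable (c := C')
      (Filter.Eventually.of_forall fun x => ?_)
    simpa using hC' x
  have e1 : g l 0 - ∫ z, (𝓕 h) z * g l z =
      - ∫ t in Set.Ioc (0:ℝ) 1, ∫ ξ, fderiv ℝ h (t • ξ) ξ * Φ ξ := by
    rw [← integral_integral_swap hJint, hd_schwartz_zero, SchwartzMap.integral_fourier_mul_eq,
      ← integral_sub Φ.integrable hhΦ, ← integral_neg]
    congr 1
    ext ξ
    have := h1 ξ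
    rw [integral_mul_const, ← this]
    ring
  have e2 : ∀ t ∈ Set.Ioc (0:ℝ) 1, ∫ ξ, fderiv ℝ h (t • ξ) ξ * Φ ξ =
      (2 * Real.pi * Complex.I)⁻¹ *
        ∑ e, ∫ z, (𝓕 (N e)) z * (∑ m, (∂_{A e m} (g m))) (t • z) := by
    intro t ht
    have ht0 := ht.1
    have : ∀ ξ, fderiv ℝ h (t • ξ) ξ * Φ ξ = (2 * Real.pi * Complex.I)⁻¹ *
        ∑ e, N e (t • ξ) * (𝓕 (∑ m, (∂_{A e m} (g m)))) ξ := by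
      intro ξ
      have hs : ∀ e, (𝓕 (∑ m, (∂_{A e m} (g m)))) ξ =
          (2 * Real.pi * Complex.I) * ∑ m, ((⟪ξ, A e m⟫ : ℝ) : ℂ) * (𝓕 (g m)) ξ := by
        intro e
        have : 𝓕 (∑ m, (∂_{A e m} (g m))) = ∑ m, 𝓕 (∂_{A e m} (g m)) :=
          map_sum (FourierTransform.fourierCLM ℂ 𝓢(W, ℂ)) _ _
        rw [this, sum_apply, Finset.mul_sum]
        refine Finset.sum_congr rfl fun m _ => ?_
        rw [hd_fourier_lineDeriv]; ring
      have hpi : (2 * Real.pi * Complex.I : ℂ) ≠ 0 := by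
        simp [Real.pi_ne_zero]
      have : ∑ e, N e (t • ξ) * (𝓕 (∑ m, (∂_{A e m} (g m)))) ξ = (2 * Real.pi * Complex.I) *
          ∑ m, (∑ e, N e (t • ξ) * (⟪ξ, A e m⟫ : ℝ)) * (𝓕 (g m)) ξ := by
        simp only [hs, Finset.mul_sum, Finset.sum_mul]
        rw [Finset.sum_comm]
        refine Finset.sum_congr rfl fun m _ => Finset.sum_congr rfl fun e _ => ?_
        ring
      rw [this, inv_mul_cancel_left₀ hpi]
      have h5 : ∀ m, (∑ e, N e (t • ξ) * (⟪ξ, A e m⟫ : ℝ)) =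
          if m = l then fderiv ℝ h (t • ξ) ξ else 0 := by
        intro m
        have := hN (t • ξ) m
        simp only [inner_smul_left, map_smul] at this
        have ht' : (t : ℂ) ≠ 0 := by exact_mod_cast ht0.ne'
        apply mul_left_cancel₀ ht'
        rw [Finset.mul_sum]
        convert this using 1
        · refine Finset.sum_congr rfl fun e _ => ?_
          push_cast
          simp; ring
        · simp
      simp [h5, hΦ]
    simp only [this]
    rw [integral_const_mul, integral_finsetSum]
    · congr 1
      refine Finset.sum_congr rfl fun e _ => ?_
      exact hd_scale _ _ t ht0
    · intro e _
      obtain ⟨C', -, hC'⟩ := (N e).decay 0 0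
      refine ((𝓕 (∑ m, (∂_{A e m} (g m)))).integrable).bdd_mul
        ((N e).continuous.comp (by fun_prop)).aestronglyMeasurable (c := C')
        (Filter.Eventually.of_forall fun x => ?_)
      simpa using hC' (t • x)
  rw [e1, enorm_neg, setIntegral_congr_fun measurableSet_Ioc e2]
  refine (enorm_integral_le_lintegral_enorm _).trans ?_
  rw [← lintegral_finsetSum']
  · refine lintegral_mono fun t => ?_
    rw [enorm_mul]
    have : ‖(2 * Real.pi * Complex.I : ℂ)⁻¹‖ₑ ≤ 1 := by
      rw [← ofReal_norm]
      simp only [norm_inv, norm_mul, Complex.norm_I, mul_one]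
      have := Real.pi_gt_three
      apply ENNReal.ofReal_le_one.2
      apply inv_le_one_of_one_le₀
      simp [abs_of_pos Real.pi_pos]; linarith
    refine (mul_le_mul_left this _).trans ?_
    · rw [one_mul]
      refine (enorm_sum_le _ _).trans ?_
      refine Finset.sum_le_sum fun e _ => ?_
      refine (enorm_integral_le_lintegral_enorm _).trans ?_
      simp [sum_apply, enorm_mul]
  · intro e _
    apply Measurable.aemeasurable
    apply Measurable.lintegral_prod_right
    have c1 : Continuous (fun x => (𝓕 (N e)) x) := (𝓕 (N e)).continuous
    have c2 : ∀ m, Continuous (fun x => (∂_{A e m} (g m)) x) := fun m => SchwartzMap.continuous _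
    simp only [Function.uncurry_def]
    exact ((c1.comp continuous_snd).enorm.measurable).mul
      ((continuous_finsetSum _ fun m _ => (c2 m).comp
        (by fun_prop : Continuous fun p : ℝ × W => p.1 • p.2)).enorm.measurable)
end FourierPart

section ParametrixPart
open scoped SchwartzMap FourierTransform LineDeriv ContDiff

variable {W : Type*} [NormedAddCommGroup W] [InnerProductSpace ℝ W] [FiniteDimensional ℝ W]
  {V : Type*} [NormedAddCommGroup V] [InnerProductSpace ℝ V] [FiniteDimensional ℝ V]
  {E : Type*} [NormedAddCommGroup E] [InnerProductSpace ℝ E] [FiniteDimensional ℝ E]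

/-- Left inverse multiplier. -/
lemma hd_exists_multiplier (a : W →L[ℝ] V →L[ℝ] E) (ha : ∀ ξ, ξ ≠ 0 → Function.Injective (a ξ))
    (h : W → ℝ) (hh : ContDiff ℝ ∞ h) (hc : HasCompactSupport h) (h1 : ∀ᶠ x in nhds 0, h x = 1) :
    ∃ N : W → E →L[ℝ] V, ContDiff ℝ ∞ N ∧ HasCompactSupport N ∧
      ∀ ξ, (N ξ).comp (a ξ) = (fderiv ℝ h ξ ξ) • ContinuousLinearMap.id ℝ V := by
  set T : W → V →L[ℝ] V := fun ξ => ((a ξ).adjoint).comp (a ξ) with hT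
  have hTc : ContDiff ℝ ∞ T := by
    apply ContDiff.clm_comp
    · exact (ContinuousLinearMap.adjoint (𝕜 := ℝ) (E := V)
        (F := E)).toContinuousLinearEquiv.toContinuousLinearMap.contDiff.comp a.contDiff
    · exact a.contDiff
  have hTu : ∀ ξ, ξ ≠ 0 → IsUnit (T ξ) := by
    intro ξ hξ
    have hinj : Function.Injective (T ξ) := by
      rw [injective_iff_map_eq_zero]
      intro v hv
      have : ⟪T ξ v, v⟫ = 0 := by rw [hv]; simp
      simp only [hT, ContinuousLinearMap.comp_apply, ContinuousLinearMap.adjoint_inner_left] at this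
      rw [inner_self_eq_zero] at this
      exact (injective_iff_map_eq_zero _).1 (ha ξ hξ) v this
    have hb : Function.Bijective (T ξ) :=
      ⟨hinj, LinearMap.injective_iff_surjective (f := (T ξ : V →ₗ[ℝ] V)).1 hinj⟩
    exact (ContinuousLinearMap.isUnit_iff_bijective).2 hb
  set M : W → E →L[ℝ] V := fun ξ => (Ring.inverse (T ξ)).comp ((a ξ).adjoint) with hM
  have hMa : ∀ ξ, ξ ≠ 0 → (M ξ).comp (a ξ) = ContinuousLinearMap.id ℝ V := by
    intro ξ hξ
    have := Ring.inverse_mul_cancel (T ξ) (hTu ξ hξ)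
    simp only [hM]
    rw [ContinuousLinearMap.comp_assoc]
    exact this
  have hMc : ∀ ξ, ξ ≠ 0 → ContDiffAt ℝ ∞ M ξ := by
    intro ξ hξ
    obtain ⟨u, hu⟩ := hTu ξ hξ
    have h2 : ContDiffAt ℝ ∞ (fun ξ => Ring.inverse (T ξ)) ξ := by
      have h3 : ContDiffAt ℝ ∞ (Ring.inverse : (V →L[ℝ] V) → (V →L[ℝ] V)) (T ξ) := by
        rw [← hu]
        exact contDiffAt_ringInverse ℝ u
      exact ContDiffAt.comp ξ h3 hTc.contDiffAt
    apply ContDiffAt.clm_comp h2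
    exact ((ContinuousLinearMap.adjoint (𝕜 := ℝ) (E := V)
        (F := E)).toContinuousLinearEquiv.toContinuousLinearMap.contDiff.comp a.contDiff).contDiffAt
  have hd : ContDiff ℝ ∞ (fun ξ => fderiv ℝ h ξ ξ) :=
    (hh.fderiv_right (m := ∞) (by simp)).clm_apply contDiff_id
  refine ⟨fun ξ => (fderiv ℝ h ξ ξ) • M ξ, ?_, ?_, ?_⟩
  · rw [contDiff_iff_contDiffAt]
    intro ξ
    by_cases hξ : ξ = 0
    · subst hξ
      have : (fun ξ => (fderiv ℝ h ξ ξ) • M ξ) =ᶠ[nhds 0] fun _ => 0 := by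
        have := h1.eventually_nhds
        filter_upwards [this] with x hx
        have : h =ᶠ[nhds x] fun _ => 1 := hx
        rw [this.fderiv_eq]; simp
      exact (contDiffAt_const (c := (0 : E →L[ℝ] V))).congr_of_eventuallyEq this
    · exact hd.contDiffAt.smul (hMc ξ hξ)
  · have : HasCompactSupport (fderiv ℝ h) := hc.fderiv (𝕜 := ℝ)
    refine this.mono ?_
    intro x hx
    simp only [Function.mem_support] at hx ⊢
    intro h0
    apply hx
    simp [h0]
  · intro ξ
    by_cases hξ : ξ = 0
    · subst hξ; simp
    · rw [ContinuousLinearMap.smul_comp, hMa ξ hξ]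

variable [MeasurableSpace W] [BorelSpace W]

lemma hd_B {ι : Type*} [Fintype ι] (b : OrthonormalBasis ι ℝ W)
    (a : W →L[ℝ] V →L[ℝ] E) (ha : ∀ ξ, ξ ≠ 0 → Function.Injective (a ξ)) :
    ∃ μp μm κ : Measure W, IsFiniteMeasure μp ∧ IsFiniteMeasure μm ∧ IsFiniteMeasure κ ∧
      (∀ s : AffineSubspace ℝ W, s ≠ ⊤ → μp s = 0 ∧ μm s = 0 ∧ κ s = 0) ∧
      ∀ g : W → V, ContDiff ℝ ∞ g → HasCompactSupport g →
        ‖g 0 - (∫ z, g z ∂μp - ∫ z, g z ∂μm)‖ₑ ≤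
          ∫⁻ z, ‖∑ k, a (b k) (fderiv ℝ g z (b k))‖ₑ ∂κ := by
  classical
  let β : ContDiffBump (0 : W) := ⟨1, 2, by norm_num, by norm_num⟩
  obtain ⟨N, hN, hNc, hNa⟩ := hd_exists_multiplier a ha β β.contDiff β.hasCompactSupport
    β.eventuallyEq_one
  set bV := stdOrthonormalBasis ℝ V
  set bE := stdOrthonormalBasis ℝ E
  have hcs : HasCompactSupport (fun x => ((β x : ℝ) : ℂ)) :=
    β.hasCompactSupport.comp_left (g := fun r : ℝ => (r : ℂ)) (by simp)
  have hcd : ContDiff ℝ ∞ (fun x => ((β x : ℝ) : ℂ)) := Complex.ofRealCLM.contDiff.comp β.contDiff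
  set h : 𝓢(W, ℂ) := hcs.toSchwartzMap hcd with hh
  have hNls : ∀ l e, HasCompactSupport (fun x => ((⟪bV l, N x (bE e)⟫ : ℝ) : ℂ)) := by
    intro l e
    refine hNc.mono ?_
    intro x hx
    simp only [Function.mem_support] at hx ⊢
    intro h0; apply hx; simp [h0]
  have hNld : ∀ l e, ContDiff ℝ ∞ (fun x => ((⟪bV l, N x (bE e)⟫ : ℝ) : ℂ)) := by
    intro l e
    exact Complex.ofRealCLM.contDiff.comp (contDiff_const.inner ℝ (hN.clm_apply contDiff_const))
  set Nn : Fin _ → Fin _ → 𝓢(W, ℂ) := fun l e => (hNls l e).toSchwartzMap (hNld l e) with hNn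
  set A : Fin (Module.finrank ℝ E) → Fin (Module.finrank ℝ V) → W :=
    fun e m => ∑ k, (⟪bE e, a (b k) (bV m)⟫ : ℝ) • b k with hA
  have hAin : ∀ ξ e m, ⟪ξ, A e m⟫ = ⟪bE e, a ξ (bV m)⟫ := by
    intro ξ e m
    conv_rhs => rw [← b.sum_repr' ξ]
    simp [hA, inner_sum, map_sum, inner_smul_right, mul_comm, real_inner_comm]
  have hNA : ∀ l ξ m, ∑ e, Nn l e ξ * ((⟪ξ, A e m⟫ : ℝ) : ℂ) =
      if m = l then fderiv ℝ h ξ ξ else 0 := by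
    intro l ξ m
    have e1 : ∑ e, (⟪bV l, N ξ (bE e)⟫ : ℝ) * ⟪bE e, a ξ (bV m)⟫ =
        if m = l then fderiv ℝ β ξ ξ else 0 := by
      have : ⟪bV l, (N ξ).comp (a ξ) (bV m)⟫ = if m = l then fderiv ℝ β ξ ξ else 0 := by
        rw [hNa]
        simp only [smul_apply, ContinuousLinearMap.id_apply, inner_smul_right,
          bV.inner_eq_ite]
        by_cases hml : m = l
        · simp [hml]
        · simp [hml, Ne.symm hml]
      rw [← this, ContinuousLinearMap.comp_apply]
      conv_rhs => rw [← bE.sum_repr' (a ξ (bV m))]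
      simp [inner_sum, map_sum, inner_smul_right, mul_comm]
    have e2 : fderiv ℝ h ξ ξ = ((fderiv ℝ β ξ ξ : ℝ) : ℂ) := by
      have : HasFDerivAt (fun x => ((β x : ℝ) : ℂ)) (Complex.ofRealCLM.comp (fderiv ℝ β ξ)) ξ :=
        Complex.ofRealCLM.hasFDerivAt.comp ξ
          ((β.contDiff (n := 1)).differentiable (by simp) ξ).hasFDerivAt
      have h3 : fderiv ℝ h ξ = _ := this.fderiv
      rw [h3]; rfl
    rw [e2]
    have : ∑ e, Nn l e ξ * ((⟪ξ, A e m⟫ : ℝ) : ℂ) =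
      ((∑ e, (⟪bV l, N ξ (bE e)⟫ : ℝ) * ⟪bE e, a ξ (bV m)⟫ : ℝ) : ℂ) := by
      push_cast
      refine Finset.sum_congr rfl fun e _ => ?_
      rw [hAin]
      simp [hNn]
    rw [this, e1]
    split_ifs <;> simp
  set ρ : W → ℝ := fun z => ((𝓕 h) z).re with hρ
  have hρi : Integrable ρ := (𝓕 h).integrable.re
  have hρc : Continuous ρ := Complex.continuous_re.comp (𝓕 h).continuous
  set Kd : W → ℝ≥0∞ := fun z => ∑ l, ∑ e, ‖(𝓕 (Nn l e)) z‖ₑ with hKd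
  have hKc : ∀ l e, Continuous (fun z => (𝓕 (Nn l e)) z) := fun l e => (𝓕 (Nn l e)).continuous
  have hKm : Measurable Kd := by
    apply Finset.measurable_fun_sum; intro l _
    apply Finset.measurable_fun_sum; intro e _
    exact (hKc l e).enorm.measurable
  set K : Measure W := volume.withDensity Kd with hK
  have hKf : IsFiniteMeasure K := by
    apply isFiniteMeasure_withDensity
    simp only [hKd]
    rw [lintegral_finsetSum _ (fun l _ => Finset.measurable_fun_sum _
      fun e _ => (hKc l e).enorm.measurable)]
    refine (ENNReal.sum_lt_top.2 fun l _ => ?_).ne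
    rw [lintegral_finsetSum _ (fun e _ => (hKc l e).enorm.measurable)]
    exact ENNReal.sum_lt_top.2 fun e _ => (𝓕 (Nn l e)).integrable.2
  set I : Measure ℝ := volume.restrict (Set.Ioc (0:ℝ) 1) with hI
  have hIf : IsFiniteMeasure I := ⟨by simp [hI]⟩
  have hsm : Measurable (fun p : ℝ × W => p.1 • p.2) :=
    (by fun_prop : Continuous fun p : ℝ × W => p.1 • p.2).measurable
  set κ : Measure W := (I.prod K).map (fun p : ℝ × W => p.1 • p.2) with hκ
  refine ⟨volume.withDensity (fun z => ENNReal.ofReal (ρ z)),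
    volume.withDensity (fun z => ENNReal.ofReal (-ρ z)), κ,
    isFiniteMeasure_withDensity_ofReal hρi.2, isFiniteMeasure_withDensity_ofReal hρi.neg.2,
    inferInstance, ?_, ?_⟩
  · intro s hs
    have hs0 : (volume : Measure W) s = 0 := Measure.addHaar_affineSubspace _ s hs
    refine ⟨withDensity_absolutelyContinuous _ _ hs0,
      withDensity_absolutelyContinuous _ _ hs0, ?_⟩
    have hsmeas : MeasurableSet (s : Set W) := (AffineSubspace.closed_of_finiteDimensional s).measurableSet
    rw [hκ, Measure.map_apply hsm hsmeas, Measure.prod_apply (hsm hsmeas)]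
    rw [lintegral_eq_zero_iff' (measurable_measure_prodMk_left (hsm hsmeas)).aemeasurable]
    rw [hI]
    refine (ae_restrict_iff' measurableSet_Ioc).2 (Filter.Eventually.of_forall fun t ht => ?_)
    simp only [Pi.zero_apply]
    apply withDensity_absolutelyContinuous
    have := Measure.addHaar_preimage_smul (volume : Measure W) ht.1.ne' (s : Set W)
    rw [hs0, mul_zero] at this
    exact this
  · intro g hg hgc
    have hgls : ∀ l, HasCompactSupport (fun x => ((⟪bV l, g x⟫ : ℝ) : ℂ)) := by
      intro l
      refine hgc.mono ?_
      intro x hx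
      simp only [Function.mem_support] at hx ⊢
      intro h0; apply hx; simp [h0]
    have hgld : ∀ l, ContDiff ℝ ∞ (fun x => ((⟪bV l, g x⟫ : ℝ) : ℂ)) := fun l =>
      Complex.ofRealCLM.contDiff.comp (contDiff_const.inner ℝ hg)
    set G : Fin _ → 𝓢(W, ℂ) := fun l => (hgls l).toSchwartzMap (hgld l) with hG
    have hGa : ∀ l x, G l x = ((⟪bV l, g x⟫ : ℝ) : ℂ) := fun l x => by simp [hG]
    have hgd : Differentiable ℝ g := hg.differentiable (by simp)
    have hfe : ∀ e x, ∑ m, (∂_{A e m} (G m)) x =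
        ((⟪bE e, ∑ k, a (b k) (fderiv ℝ g x (b k))⟫ : ℝ) : ℂ) := by
      intro e x
      have e1 : ∀ m w, (∂_{w} (G m)) x = ((⟪bV m, fderiv ℝ g x w⟫ : ℝ) : ℂ) := by
        intro m w
        rw [SchwartzMap.lineDerivOp_apply_eq_fderiv]
        have : HasFDerivAt (fun x => ((⟪bV m, g x⟫ : ℝ) : ℂ))
            (Complex.ofRealCLM.comp ((innerSL ℝ (bV m)).comp (fderiv ℝ g x))) x :=
          Complex.ofRealCLM.hasFDerivAt.comp x
            ((innerSL ℝ (bV m)).hasFDerivAt.comp x (hgd x).hasFDerivAt)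
        have h3 : fderiv ℝ (G m) x = _ := this.fderiv
        rw [h3]; rfl
      simp only [e1]
      norm_cast
      simp only [hA, map_sum, map_smul, inner_sum, inner_smul_right]
      rw [Finset.sum_comm]
      refine Finset.sum_congr rfl fun k _ => ?_
      conv_rhs => rw [← bV.sum_repr' (fderiv ℝ g x (b k))]
      simp [map_sum, inner_sum, inner_smul_right, mul_comm]
    set f : W → E := fun z => ∑ k, a (b k) (fderiv ℝ g z (b k)) with hf
    have hfc : Continuous f := by
      have : Continuous (fderiv ℝ g) := hg.continuous_fderiv (by simp)
      simp only [hf]; fun_prop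
    have hgb : ∃ C, ∀ x, ‖g x‖ ≤ C := hgc.exists_bound_of_continuous hg.continuous
    obtain ⟨Cg, hCg⟩ := hgb
    have hρg : Integrable (fun z => ρ z • g z) :=
      hρi.smul_bdd Cg hg.continuous.aestronglyMeasurable (Filter.Eventually.of_forall hCg)
    have hdiff : (∫ z, g z ∂(volume.withDensity (fun z => ENNReal.ofReal (ρ z))) -
        ∫ z, g z ∂(volume.withDensity (fun z => ENNReal.ofReal (-ρ z)))) = ∫ z, ρ z • g z := by
      rw [integral_withDensity_eq_integral_toReal_smul (by fun_prop) (by simp),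
        integral_withDensity_eq_integral_toReal_smul (by fun_prop) (by simp),
        ← integral_sub]
      · congr 1
        ext z
        rw [← sub_smul]
        congr 1
        simp only [ENNReal.toReal_ofReal']
        rcases le_total 0 (ρ z) with h | h <;> simp [h]
      · refine hρg.mono (by
          apply Continuous.aestronglyMeasurable
          simp only [ENNReal.toReal_ofReal']
          have := hg.continuous
          fun_prop) (Filter.Eventually.of_forall fun z => ?_)
        simp only [norm_smul, ENNReal.toReal_ofReal']
        gcongr
        rcases le_total 0 (ρ z) with h | h <;> simp [h]
      · refine hρg.mono (by
          apply Continuous.aestronglyMeasurable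
          simp only [ENNReal.toReal_ofReal']
          have := hg.continuous
          fun_prop) (Filter.Eventually.of_forall fun z => ?_)
        simp only [norm_smul, ENNReal.toReal_ofReal']
        gcongr
        rcases le_total 0 (ρ z) with h | h <;> simp [h]
    rw [hdiff]
    have hcomp : ∀ l, ‖(⟪bV l, g 0 - ∫ z, ρ z • g z⟫ : ℝ)‖ₑ ≤
        ∑ e, ∫⁻ t in Set.Ioc (0:ℝ) 1, ∫⁻ z, ‖(𝓕 (Nn l e)) z‖ₑ * ‖f (t • z)‖ₑ := by
      intro l
      have key := hd_parametrix h (Nn l) G A l (by simp [hh, β.eventuallyEq_one.self_of_nhds]) (hNA l)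
      have hi : Integrable (fun z => (𝓕 h) z * G l z) := by
        refine (𝓕 h).integrable.mul_bdd (c := Cg)  (G l).continuous.aestronglyMeasurable
          (Filter.Eventually.of_forall fun x => ?_)
        rw [hGa]
        simp only [Complex.norm_real]
        refine (norm_inner_le_norm _ _).trans ?_
        simpa using hCg x
      have hre : (⟪bV l, g 0 - ∫ z, ρ z • g z⟫ : ℝ) = (G l 0 - ∫ z, (𝓕 h) z * G l z).re := by
        rw [inner_sub_right, Complex.sub_re, hGa]
        congr 1
        have e3 := integral_re hi
        have e4 := integral_inner (𝕜 := ℝ) hρg (bV l)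
        rw [← e4]
        refine Eq.trans ?_ e3
        congr 1
        ext z
        simp [hGa, hρ, inner_smul_right]
      rw [hre]
      have h5 : ‖(G l 0 - ∫ z, (𝓕 h) z * G l z).re‖ₑ ≤ ‖G l 0 - ∫ z, (𝓕 h) z * G l z‖ₑ := by
        rw [enorm_le_iff_norm_le]
        exact Complex.abs_re_le_norm _
      refine h5.trans (key.trans ?_)
      refine Finset.sum_le_sum fun e _ => ?_
      refine lintegral_mono fun t => lintegral_mono fun z => ?_
      gcongr
      rw [hfe, enorm_le_iff_norm_le, Complex.norm_real]
      refine (norm_inner_le_norm _ _).trans ?_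
      simp [hf]
    have hsum : ‖g 0 - ∫ z, ρ z • g z‖ₑ ≤ ∑ l, ‖(⟪bV l, g 0 - ∫ z, ρ z • g z⟫ : ℝ)‖ₑ := by
      conv_lhs => rw [← bV.sum_repr' (g 0 - ∫ z, ρ z • g z)]
      refine (enorm_sum_le _ _).trans ?_
      refine Finset.sum_le_sum fun l _ => ?_
      rw [enorm_smul]
      simp [← ofReal_norm]
    have hfm : Measurable (fun z => ‖f z‖ₑ) := hfc.enorm.measurable
    have hκi : ∫⁻ z, ‖f z‖ₑ ∂κ = ∑ l, ∑ e, ∫⁻ t in Set.Ioc (0:ℝ) 1,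
        ∫⁻ z, ‖(𝓕 (Nn l e)) z‖ₑ * ‖f (t • z)‖ₑ := by
      have hm2 : ∀ l e, Measurable fun p : ℝ × W => ‖(𝓕 (Nn l e)) p.2‖ₑ * ‖f (p.1 • p.2)‖ₑ :=
        fun l e => (((hKc l e).comp continuous_snd).enorm.measurable).mul (hfm.comp hsm)
      have hm3 : ∀ l e, Measurable fun t : ℝ => ∫⁻ z, ‖(𝓕 (Nn l e)) z‖ₑ * ‖f (t • z)‖ₑ :=
        fun l e => (hm2 l e).lintegral_prod_right
      rw [hκ, lintegral_map hfm hsm, lintegral_prod (fun p : ℝ × W => ‖f (p.1 • p.2)‖ₑ) (hfm.comp hsm).aemeasurable]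
      simp_rw [← lintegral_finsetSum _ (fun e _ => hm3 _ e)]
      rw [← lintegral_finsetSum _ (fun l _ => Finset.measurable_fun_sum _ fun e _ => hm3 l e)]
      refine lintegral_congr fun t => ?_
      have hft : Measurable fun z => ‖f (t • z)‖ₑ :=
        hfm.comp (measurable_const_smul t)
      rw [hK, lintegral_withDensity_eq_lintegral_mul _ hKm hft]
      simp only [Pi.mul_apply, hKd, Finset.sum_mul]
      have hm4 : ∀ l e, Measurable fun z => ‖(𝓕 (Nn l e)) z‖ₑ * ‖f (t • z)‖ₑ :=
        fun l e => ((hKc l e).enorm.measurable).mul hft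
      rw [lintegral_finsetSum _ (fun l _ => Finset.measurable_fun_sum _ fun e _ => hm4 l e)]
      refine Finset.sum_congr rfl fun l _ => ?_
      rw [lintegral_finsetSum _ (fun e _ => hm4 l e)]
    rw [hκi]
    exact hsum.trans (Finset.sum_le_sum fun l _ => hcomp l)
end ParametrixPart

section LocalPart
open scoped ContDiff

variable {W : Type*} [NormedAddCommGroup W] [InnerProductSpace ℝ W] [FiniteDimensional ℝ W]
  {V : Type*} [NormedAddCommGroup V] [InnerProductSpace ℝ V] [FiniteDimensional ℝ V]
  {E : Type*} [NormedAddCommGroup E] [InnerProductSpace ℝ E] [FiniteDimensional ℝ E]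
  [MeasurableSpace W] [BorelSpace W]

lemma hd_A {ι : Type*} [Fintype ι] (b : OrthonormalBasis ι ℝ W)
    (a : W →L[ℝ] V →L[ℝ] E) (ha : ∀ ξ, ξ ≠ 0 → Function.Injective (a ξ)) :
    ∃ m κ : Measure W, IsFiniteMeasure m ∧ IsFiniteMeasure κ ∧
      m (Metric.closedBall 0 (1/2))ᶜ = 0 ∧ κ (Metric.closedBall 0 (1/2))ᶜ = 0 ∧
      (∀ s : AffineSubspace ℝ W, s ≠ ⊤ → m s = 0) ∧
      ∀ g : W → V, ContDiff ℝ ∞ g →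
        ‖g 0‖ₑ ≤ ∫⁻ z, ‖g z‖ₑ ∂m +
          ∫⁻ z, ‖∑ k, a (b k) (fderiv ℝ g z (b k))‖ₑ ∂κ := by
  obtain ⟨μp, μm, κ, h1, h2, h3, hnull, hB⟩ := hd_B b a ha
  let χ : ContDiffBump (0 : W) := ⟨1/4, 1/2, by norm_num, by norm_num⟩
  set B : Set W := Metric.closedBall 0 (1/2) with hBdef
  have hBm : MeasurableSet B := Metric.isClosed_closedBall.measurableSet
  have hχ : ContDiff ℝ ∞ χ := χ.contDiff
  have hχts : tsupport χ = B := χ.tsupport_eq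
  obtain ⟨C, hC⟩ : ∃ C, ∀ x, ‖fderiv ℝ χ x‖ ≤ C :=
    (χ.hasCompactSupport.fderiv (𝕜 := ℝ)).exists_bound_of_continuous (hχ.continuous_fderiv (by simp))
  have hC0 : 0 ≤ C := (norm_nonneg _).trans (hC 0)
  set c : ℝ := ∑ k, C * ‖b k‖ * ‖a (b k)‖ with hc
  have hc0 : 0 ≤ c := Finset.sum_nonneg fun k _ => by positivity
  refine ⟨(μp + μm + (ENNReal.ofReal c) • κ).restrict B, κ.restrict B, ?_, inferInstance, ?_, ?_, ?_, ?_⟩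
  · have : IsFiniteMeasure (ENNReal.ofReal c • κ) := κ.smul_finite ENNReal.ofReal_ne_top
    infer_instance
  · rw [Measure.restrict_apply hBm.compl]; simp
  · rw [Measure.restrict_apply hBm.compl]; simp
  · intro s hs
    obtain ⟨n1, n2, n3⟩ := hnull s hs
    refine le_antisymm ((Measure.restrict_apply_le _ _).trans ?_) (zero_le)
    simp [n1, n2, n3]
  · intro g hg
    have hgd : Differentiable ℝ g := hg.differentiable (by simp)
    have hχd : Differentiable ℝ χ := hχ.differentiable (by simp)
    have key := hB (fun z => χ z • g z) (hχ.smul hg) (χ.hasCompactSupport.smul_right)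
    have hχ0 : χ (0 : W) = 1 := χ.eventuallyEq_one.self_of_nhds
    simp only [hχ0, one_smul] at key
    have hχB : ∀ z, z ∉ B → χ z = 0 := fun z hz => by
      rw [← hχts] at hz; exact image_eq_zero_of_notMem_tsupport hz
    have hdB : ∀ z, z ∉ B → fderiv ℝ χ z = 0 := fun z hz => by
      have : z ∉ tsupport (fderiv ℝ χ) := fun h => hz (hχts ▸ tsupport_fderiv_subset ℝ h)
      exact image_eq_zero_of_notMem_tsupport this
    have hχg : ∀ z, ‖χ z • g z‖ₑ ≤ B.indicator (fun z => ‖g z‖ₑ) z := by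
      intro z
      by_cases hz : z ∈ B
      · rw [Set.indicator_of_mem hz, enorm_le_iff_norm_le, norm_smul, Real.norm_of_nonneg χ.nonneg]
        exact mul_le_of_le_one_left (norm_nonneg _) χ.le_one
      · simp [hχB z hz]
    have i1 : ∀ μ : Measure W, ‖∫ z, χ z • g z ∂μ‖ₑ ≤ ∫⁻ z in B, ‖g z‖ₑ ∂μ := fun μ => by
      refine (enorm_integral_le_lintegral_enorm _).trans ?_
      rw [← lintegral_indicator hBm]
      exact lintegral_mono hχg
    set f : W → E := fun z => ∑ k, a (b k) (fderiv ℝ g z (b k)) with hf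
    have i2 : ∀ z, ‖∑ k, a (b k) (fderiv ℝ (fun z => χ z • g z) z (b k))‖ₑ ≤
        B.indicator (fun z => ‖f z‖ₑ + ENNReal.ofReal c * ‖g z‖ₑ) z := by
      intro z
      have hfd : fderiv ℝ (fun z => χ z • g z) z =
          χ z • fderiv ℝ g z + (fderiv ℝ χ z).smulRight (g z) :=
        fderiv_fun_smul (hχd z) (hgd z)
      rw [hfd]
      by_cases hz : z ∈ B
      · rw [Set.indicator_of_mem hz]
        have e1 : ∑ k, a (b k) ((χ z • fderiv ℝ g z + (fderiv ℝ χ z).smulRight (g z)) (b k)) =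
            χ z • f z + ∑ k, (fderiv ℝ χ z (b k)) • a (b k) (g z) := by
          simp [hf, Finset.sum_add_distrib, Finset.smul_sum]
        rw [e1]
        refine (enorm_add_le _ _).trans ?_
        gcongr
        · rw [enorm_le_iff_norm_le, norm_smul, Real.norm_of_nonneg χ.nonneg]
          exact mul_le_of_le_one_left (norm_nonneg _) χ.le_one
        · rw [← ofReal_norm, ← ofReal_norm, ← ENNReal.ofReal_mul hc0]
          apply ENNReal.ofReal_le_ofReal
          refine (norm_sum_le _ _).trans ?_
          rw [hc, Finset.sum_mul]
          refine Finset.sum_le_sum fun k _ => ?_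
          rw [norm_smul, mul_assoc]
          gcongr
          · exact ((fderiv ℝ χ z).le_opNorm _).trans (by gcongr; exact hC z)
          · exact (a (b k)).le_opNorm _
      · simp [hχB z hz, hdB z hz]
    have hgm : Measurable fun z => ‖g z‖ₑ := hg.continuous.enorm.measurable
    have hfm : Measurable fun z => ‖f z‖ₑ := by
      have : Continuous (fderiv ℝ g) := hg.continuous_fderiv (by simp)
      have : Continuous f := by simp only [hf]; fun_prop
      exact this.enorm.measurable
    have i3 : ∫⁻ z, ‖∑ k, a (b k) (fderiv ℝ (fun z => χ z • g z) z (b k))‖ₑ ∂κ ≤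
        ∫⁻ z in B, ‖f z‖ₑ ∂κ + ENNReal.ofReal c * ∫⁻ z in B, ‖g z‖ₑ ∂κ := by
      refine (lintegral_mono i2).trans ?_
      rw [lintegral_indicator hBm, lintegral_add_left hfm, lintegral_const_mul _ hgm]
    have i4 : ‖g 0‖ₑ ≤ ‖∫ z, χ z • g z ∂μp‖ₑ + ‖∫ z, χ z • g z ∂μm‖ₑ +
        ‖g 0 - (∫ z, χ z • g z ∂μp - ∫ z, χ z • g z ∂μm)‖ₑ := by
      have : g 0 = (∫ z, χ z • g z ∂μp) + (-∫ z, χ z • g z ∂μm) +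
        (g 0 - (∫ z, χ z • g z ∂μp - ∫ z, χ z • g z ∂μm)) := by abel
      conv_lhs => rw [this]
      refine (enorm_add_le _ _).trans ?_
      gcongr
      refine (enorm_add_le _ _).trans ?_
      rw [enorm_neg]
    rw [Measure.restrict_add, Measure.restrict_add, Measure.restrict_smul, lintegral_add_measure, lintegral_add_measure, lintegral_smul_measure]
    calc _ ≤ _ := i4
      _ ≤ ∫⁻ z in B, ‖g z‖ₑ ∂μp + ∫⁻ z in B, ‖g z‖ₑ ∂μm +
        (∫⁻ z in B, ‖f z‖ₑ ∂κ + ENNReal.ofReal c * ∫⁻ z in B, ‖g z‖ₑ ∂κ) := by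
          gcongr
          · exact i1 _
          · exact i1 _
          · exact key.trans i3
      _ = _ := by rw [smul_eq_mul]; ring
end LocalPart

section TransportPart
open scoped ContDiff

variable {X : Type*} [NormedAddCommGroup X] [InnerProductSpace ℝ X] [FiniteDimensional ℝ X]
  [MeasurableSpace X] [BorelSpace X]
  {V : Type*} [NormedAddCommGroup V] [InnerProductSpace ℝ V] [FiniteDimensional ℝ V]
  {E : Type*} [NormedAddCommGroup E] [InnerProductSpace ℝ E] [FiniteDimensional ℝ E]

/-- `ν` does not charge translates of `Y`. -/
def HdNull (ν : Measure X) (Y : Submodule ℝ X) : Prop := ∀ c : X, ν {v | v - c ∈ Y} = 0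

lemma hd_null_of_map (W : Submodule ℝ X) (ν : Measure W)
    (h : ∀ s : AffineSubspace ℝ W, s ≠ ⊤ → ν s = 0) (Y : Submodule ℝ X) (hY : ¬ W ≤ Y) :
    HdNull (ν.map (Subtype.val : W → X)) Y := by
  intro c
  have hm : MeasurableSet {v : X | v - c ∈ Y} := by
    have : IsClosed (Y : Set X) := Y.closed_of_finiteDimensional
    exact (this.preimage (by fun_prop : Continuous fun v : X => v - c)).measurableSet
  rw [Measure.map_apply measurable_subtype_coe hm]
  by_cases hne : ∃ w0 : W, (w0 : X) - c ∈ Y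
  · obtain ⟨w0, hw0⟩ := hne
    have hs := h (AffineSubspace.mk' w0 (Y.comap W.subtype)) ?_
    · refine measure_mono_null ?_ hs
      intro w hw
      simp only [Set.mem_preimage, Set.mem_ofPred_eq] at hw
      simp only [SetLike.mem_coe, AffineSubspace.mem_mk', vsub_eq_sub, Submodule.mem_comap]
      have : (W.subtype (w - w0)) = ((w : X) - c) - ((w0 : X) - c) := by simp
      rw [this]
      exact Y.sub_mem hw hw0
    · intro htop
      apply hY
      have := congrArg AffineSubspace.direction htop
      rw [AffineSubspace.direction_mk', AffineSubspace.direction_top] at this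
      intro w hw
      have h2 : (⟨w, hw⟩ : W) ∈ Y.comap W.subtype := by rw [this]; trivial
      simpa using h2
  · push Not at hne
    convert measure_empty (μ := ν)
    ext w
    simpa using hne w

lemma hd_trace (P : X →ₗ[ℝ] X) {ι κ : Type*} [Fintype ι] [Fintype κ] (e : OrthonormalBasis ι ℝ X)
    (b : OrthonormalBasis κ ℝ ((LinearMap.ker P)ᗮ : Submodule ℝ X))
    (σ : X →ₗ[ℝ] V →ₗ[ℝ] E) (L : X →ₗ[ℝ] V) :
    ∑ k, σ (P (b k)) (L (b k)) = ∑ j, σ (P (e j)) (L (e j)) := by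
  have hP : ∀ x, P x = ∑ k, (⟪(b k : X), x⟫ : ℝ) • P (b k) := by
    intro x
    let W := (LinearMap.ker P)ᗮ
    have h1 : x - W.starProjection x ∈ Wᗮ := Submodule.sub_starProjection_mem_orthogonal x
    have hWo : Wᗮ = LinearMap.ker P := Submodule.orthogonal_orthogonal _
    rw [hWo, LinearMap.mem_ker, map_sub, sub_eq_zero] at h1
    rw [h1]
    have h2 := b.orthogonalProjectionOnto_apply_eq_sum x
    have h3 : W.starProjection x = ∑ k, (⟪(b k : X), x⟫ : ℝ) • (b k : X) := by
      rw [Submodule.starProjection_apply, h2]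
      simp
    rw [h3]
    simp [map_sum]
  have hL : ∀ x, L x = ∑ j, (⟪e j, x⟫ : ℝ) • L (e j) := by
    intro x
    conv_lhs => rw [← e.sum_repr' x]
    simp [map_sum]
  have r : ∀ j, σ (P (e j)) (L (e j)) = ∑ k, (⟪(b k : X), e j⟫ : ℝ) • σ (P (b k)) (L (e j)) := by
    intro j
    conv_lhs => rw [hP (e j)]
    simp [map_sum, LinearMap.sum_apply]
  have l : ∀ k, σ (P (b k)) (L (b k)) = ∑ j, (⟪(b k : X), e j⟫ : ℝ) • σ (P (b k)) (L (e j)) := by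
    intro k
    conv_lhs => rw [hL (b k)]
    simp [map_sum, real_inner_comm]
  simp_rw [r, l]
  rw [Finset.sum_comm]

lemma hd_transport (P : X →ₗ[ℝ] X) (Q : V →ₗ[ℝ] V)
    (σ : X →ₗ[ℝ] V →ₗ[ℝ] E) {ι : Type*} [Fintype ι] (e : OrthonormalBasis ι ℝ X)
    (hell : ∀ ξ ∈ LinearMap.range P, ξ ≠ 0 → ∀ v ∈ LinearMap.range Q, σ ξ v = 0 → v = 0) :
    ∃ μp μm κ m κ' : Measure X, IsFiniteMeasure μp ∧ IsFiniteMeasure μm ∧ IsFiniteMeasure κ ∧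
      IsFiniteMeasure m ∧ IsFiniteMeasure κ' ∧
      (∀ᵐ v ∂μp, v ∈ (LinearMap.ker P)ᗮ) ∧ (∀ᵐ v ∂μm, v ∈ (LinearMap.ker P)ᗮ) ∧
      (∀ᵐ v ∂κ, v ∈ (LinearMap.ker P)ᗮ) ∧
      (∀ᵐ v ∂m, ‖v‖ ≤ 1/2) ∧ (∀ᵐ v ∂κ', ‖v‖ ≤ 1/2) ∧
      (∀ Y : Submodule ℝ X, ¬ (LinearMap.ker P)ᗮ ≤ Y → HdNull μp Y ∧ HdNull μm Y ∧ HdNull m Y) ∧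
      ∀ u : X → V, ContDiff ℝ ∞ u → HasCompactSupport u → ∀ (x : X) (r : ℝ), 0 < r →
        (‖Q (u x) - (∫ v, Q (u (x + r • v)) ∂μp - ∫ v, Q (u (x + r • v)) ∂μm)‖ₑ ≤
          ENNReal.ofReal r * ∫⁻ v, ‖∑ j, σ (P (e j)) (Q (fderiv ℝ u (x + r • v) (e j)))‖ₑ ∂κ) ∧
        (‖Q (u x)‖ₑ ≤ ∫⁻ v, ‖Q (u (x + r • v))‖ₑ ∂m +
          ENNReal.ofReal r * ∫⁻ v, ‖∑ j, σ (P (e j)) (Q (fderiv ℝ u (x + r • v) (e j)))‖ₑ ∂κ') := by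
  set W : Submodule ℝ X := (LinearMap.ker P)ᗮ with hW
  set V' : Submodule ℝ V := LinearMap.range Q with hV'
  set b := stdOrthonormalBasis ℝ W
  let a0 : W →ₗ[ℝ] V' →L[ℝ] E :=
    { toFun := fun w => LinearMap.toContinuousLinearMap ((σ (P w)).comp V'.subtype)
      map_add' := by intro x y; ext v; simp
      map_smul' := by intro c y; ext v; simp }
  let a : W →L[ℝ] V' →L[ℝ] E := LinearMap.toContinuousLinearMap a0
  have haa : ∀ w v, a w v = σ (P w) (v : V) := fun w v => rfl
  have ha : ∀ ξ, ξ ≠ 0 → Function.Injective (a ξ) := by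
    intro ξ hξ
    rw [injective_iff_map_eq_zero]
    intro v hv
    rw [haa] at hv
    have hPξ : P ξ ≠ 0 := by
      intro h0
      apply hξ
      have h1 : (ξ : X) ∈ LinearMap.ker P := h0
      have h2 : (ξ : X) ∈ (LinearMap.ker P)ᗮ := ξ.2
      have := Submodule.inner_right_of_mem_orthogonal h1 h2
      rw [inner_self_eq_zero] at this
      exact Subtype.ext this
    exact Subtype.ext (hell _ (LinearMap.mem_range_self P ξ) hPξ v v.2 hv)
  obtain ⟨μp, μm, κ, f1, f2, f3, hn, hB⟩ := hd_B b a ha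
  obtain ⟨m, κ', f4, f5, s4, s5, hn', hA⟩ := hd_A b a ha
  have hval : Measurable (Subtype.val : W → X) := measurable_subtype_coe
  have hWm : MeasurableSet (W : Set X) := W.closed_of_finiteDimensional.measurableSet
  have hae : ∀ ν : Measure W, ∀ᵐ v ∂(ν.map (Subtype.val : W → X)), v ∈ W := by
    intro ν
    refine (ae_map_iff (p := fun v => v ∈ W) hval.aemeasurable hWm).2 ?_
    exact Filter.Eventually.of_forall fun w => w.2
  have hball : ∀ ν : Measure W, ν (Metric.closedBall 0 (1/2))ᶜ = 0 →
      ∀ᵐ v ∂(ν.map (Subtype.val : W → X)), ‖v‖ ≤ 1/2 := by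
    intro ν hν
    rw [ae_map_iff hval.aemeasurable (measurableSet_le (by fun_prop) (by fun_prop))]
    rw [ae_iff]
    refine measure_mono_null ?_ hν
    intro w hw
    simpa using hw
  refine ⟨μp.map Subtype.val, μm.map Subtype.val, κ.map Subtype.val, m.map Subtype.val,
    κ'.map Subtype.val, inferInstance, inferInstance, inferInstance, inferInstance, inferInstance,
    hae _, hae _, hae _, hball _ s4, hball _ s5, ?_, ?_⟩
  · intro Y hY
    exact ⟨hd_null_of_map W _ (fun s hs => (hn s hs).1) Y hY,
      hd_null_of_map W _ (fun s hs => (hn s hs).2.1) Y hY,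
      hd_null_of_map W _ hn' Y hY⟩
  · intro u hu huc x r hr
    let Q' : V →L[ℝ] V' := LinearMap.toContinuousLinearMap Q.rangeRestrict
    have hQ' : ∀ v, ((Q' v : V') : V) = Q v := fun v => rfl
    set g : W → V' := fun z => Q' (u (x + r • (z : X))) with hg
    have hud : Differentiable ℝ u := hu.differentiable (by simp)
    have hgs : ContDiff ℝ ∞ g := by
      apply Q'.contDiff.comp
      apply hu.comp
      exact contDiff_const.add ((W.subtypeL.contDiff).const_smul r)
    have hgc : HasCompactSupport g := by
      have h1 : Topology.IsClosedEmbedding (fun z : W => x + r • (z : X)) := by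
        have e1 : Topology.IsClosedEmbedding (Subtype.val : W → X) :=
          (W.closed_of_finiteDimensional).isClosedEmbedding_subtypeVal
        have e2 := (Homeomorph.smulOfNeZero r hr.ne' (α := X)).isClosedEmbedding
        have e3 := (Homeomorph.addLeft x).isClosedEmbedding
        exact e3.comp (e2.comp e1)
      have h2 : HasCompactSupport (u ∘ fun z : W => x + r • (z : X)) := huc.comp_isClosedEmbedding h1
      exact h2.comp_left (g := Q') (by simp)
    have hfd : ∀ z, ∑ k, a (b k) (fderiv ℝ g z (b k)) =
        r • ∑ j, σ (P (e j)) (Q (fderiv ℝ u (x + r • (z : X)) (e j))) := by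
      intro z
      have h1 : HasFDerivAt g (Q'.comp ((fderiv ℝ u (x + r • (z : X))).comp (r • W.subtypeL))) z := by
        apply Q'.hasFDerivAt.comp z
        apply (hud _).hasFDerivAt.comp z
        exact (W.subtypeL.hasFDerivAt.const_smul r).const_add x
      rw [h1.fderiv]
      have := hd_trace P e b σ (Q ∘ₗ (fderiv ℝ u (x + r • (z : X)) : X →ₗ[ℝ] V))
      simp only [LinearMap.comp_apply, ContinuousLinearMap.coe_coe] at this
      rw [← this, Finset.smul_sum]
      refine Finset.sum_congr rfl fun k _ => ?_
      rw [haa]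
      simp [hQ']
    have hQc : Continuous Q := LinearMap.continuous_of_finiteDimensional Q
    have hfc : Continuous fun y => ‖∑ j, σ (P (e j)) (Q (fderiv ℝ u y (e j)))‖ₑ := by
      have h1 : Continuous (fderiv ℝ u) := hu.continuous_fderiv (by simp)
      refine Continuous.enorm (continuous_finsetSum _ fun j _ => ?_)
      have h2 : Continuous (σ (P (e j))) := LinearMap.continuous_of_finiteDimensional _
      exact h2.comp (hQc.comp (by fun_prop))
    have htr : Continuous fun v : X => x + r • v := by fun_prop
    have er : ‖r‖ₑ = ENNReal.ofReal r := by
      rw [← ofReal_norm, Real.norm_of_nonneg hr.le]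
    have hl : ∀ ν : Measure W, ∫⁻ z, ‖∑ k, a (b k) (fderiv ℝ g z (b k))‖ₑ ∂ν =
        ENNReal.ofReal r * ∫⁻ v, ‖∑ j, σ (P (e j)) (Q (fderiv ℝ u (x + r • v) (e j)))‖ₑ
          ∂(ν.map Subtype.val) := by
      intro ν
      simp only [hfd, enorm_smul, er]
      have hmm : Measurable fun v => ‖∑ j, σ (P (e j)) (Q (fderiv ℝ u (x + r • v) (e j)))‖ₑ :=
        (hfc.comp htr).measurable
      rw [lintegral_map hmm hval]
      exact lintegral_const_mul _ (hmm.comp hval)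
    have hi : ∀ ν : Measure W, ((∫ z, g z ∂ν : V') : V) =
        ∫ v, Q (u (x + r • v)) ∂(ν.map Subtype.val) := by
      intro ν
      have h3 := integral_map (μ := ν) hval.aemeasurable (f := fun v => Q (u (x + r • v)))
        (hQc.comp (hu.continuous.comp htr)).aestronglyMeasurable
      rw [h3]
      have h2 : (∫ z, (g z : V) ∂ν) = V'.subtypeₗᵢ (∫ z, g z ∂ν) :=
        V'.subtypeₗᵢ.integral_comp_comm g
      exact h2.symm
    have hnorm : ∀ w : V', ‖w‖ₑ = ‖(w : V)‖ₑ := fun w => rfl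
    have g0 : ((g 0 : V') : V) = Q (u x) := by simp [hg, hQ']
    constructor
    · have h1 := hB g hgs hgc
      rw [hl, hnorm] at h1
      simpa [hi, g0] using h1
    · have h1 := hA g hgs
      rw [hl, hnorm, g0] at h1
      refine h1.trans_eq ?_
      congr 1
      exact (lintegral_map (μ := m) (f := fun v => ‖Q (u (x + r • v))‖ₑ)
        ((hQc.comp (hu.continuous.comp htr)).enorm.measurable) hval).symm
end TransportPart

section AveragePart
open scoped BoundedContinuousFunction

variable {X : Type*} [NormedAddCommGroup X] [InnerProductSpace ℝ X] [FiniteDimensional ℝ X]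
  [MeasurableSpace X] [BorelSpace X]
  {V : Type*} [NormedAddCommGroup V] [InnerProductSpace ℝ V] [FiniteDimensional ℝ V]

/-- average of a nonnegative function with respect to a dilated measure -/
def hdI (ν : Measure X) (r : ℝ) (G : X → ℝ≥0∞) (x : X) : ℝ≥0∞ := ∫⁻ v, G (x + r • v) ∂ν

lemma hdI_mono (ν : Measure X) (r : ℝ) {G H : X → ℝ≥0∞} (h : ∀ x, G x ≤ H x) (x : X) :
    hdI ν r G x ≤ hdI ν r H x := lintegral_mono fun _ => h _

lemma hd_meas_aff (x : X) (r : ℝ) : Measurable fun v : X => x + r • v :=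
  (by fun_prop : Continuous fun v : X => x + r • v).measurable

lemma hdI_add (ν : Measure X) (r : ℝ) {G H : X → ℝ≥0∞} (hG : Measurable G) (x : X) :
    hdI ν r (fun y => G y + H y) x = hdI ν r G x + hdI ν r H x :=
  lintegral_add_left (hG.comp (hd_meas_aff x r)) _

lemma hdI_sum {ι : Type*} (s : Finset ι) (ν : Measure X) (r : ℝ) {G : ι → X → ℝ≥0∞}
    (hG : ∀ i, Measurable (G i)) (x : X) :
    hdI ν r (fun y => ∑ i ∈ s, G i y) x = ∑ i ∈ s, hdI ν r (G i) x :=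
  lintegral_finsetSum _ fun i _ => ((hG i).comp (hd_meas_aff x r))

lemma hdI_mul (ν : Measure X) (r : ℝ) {G : X → ℝ≥0∞} (hG : Measurable G) (c : ℝ≥0∞) (x : X) :
    hdI ν r (fun y => c * G y) x = c * hdI ν r G x :=
  lintegral_const_mul _ (hG.comp (hd_meas_aff x r))

lemma hdI_add_measure (ν ν' : Measure X) (r : ℝ) (G : X → ℝ≥0∞) (x : X) :
    hdI (ν + ν') r G x = hdI ν r G x + hdI ν' r G x := lintegral_add_measure _ _ _

lemma hdI_smul_measure (ν : Measure X) (c : ℝ≥0∞) (r : ℝ) (G : X → ℝ≥0∞) (x : X) :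
    hdI (c • ν) r G x = c * hdI ν r G x := lintegral_smul_measure _ _

lemma hdI_dirac (r : ℝ) {G : X → ℝ≥0∞} (hG : Measurable G) (x : X) :
    hdI (Measure.dirac 0) r G x = G x := by
  have h : Measurable fun v => G (x + r • v) := hG.comp (hd_meas_aff x r)
  unfold hdI
  rw [lintegral_dirac' _ h]
  simp

lemma hdI_meas (ν : Measure X) [SFinite ν] (r : ℝ) {G : X → ℝ≥0∞} (hG : Measurable G) :
    Measurable (hdI ν r G) := by
  unfold hdI
  refine Measurable.lintegral_prod_right' (f := fun p : X × X => G (p.1 + r • p.2)) ?_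
  exact hG.comp (by fun_prop : Continuous fun p : X × X => p.1 + r • p.2).measurable

lemma hdI_conv (μ ν : Measure X) [SFinite ν] (r : ℝ) {G : X → ℝ≥0∞} (hG : Measurable G)
    (x : X) : hdI (μ ∗ ν) r G x = hdI μ r (hdI ν r G) x := by
  have h : Measurable fun v => G (x + r • v) := hG.comp (hd_meas_aff x r)
  unfold hdI
  rw [Measure.lintegral_conv h]
  simp only [smul_add, add_assoc]

lemma hd_null_meas (Y : Submodule ℝ X) (c : X) : MeasurableSet {v : X | v - c ∈ Y} := by
  have : IsClosed (Y : Set X) := Y.closed_of_finiteDimensional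
  exact (this.preimage (by fun_prop : Continuous fun v : X => v - c)).measurableSet

lemma HdNull.add {μ ν : Measure X} {Y : Submodule ℝ X} (h : HdNull μ Y) (h' : HdNull ν Y) :
    HdNull (μ + ν) Y := fun c => by simp [h c, h' c]

lemma HdNull.conv_left {μ : Measure X} {Y : Submodule ℝ X} (h : HdNull μ Y) (ν : Measure X)
    [SFinite μ] [SFinite ν] : HdNull (μ ∗ ν) Y := by
  intro c
  rw [Measure.conv_comm, Measure.conv, Measure.map_apply (by fun_prop) (hd_null_meas Y c),
    Measure.prod_apply ((by fun_prop : Measurable fun p : X × X => p.1 + p.2) (hd_null_meas Y c))]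
  rw [lintegral_eq_zero_iff' (measurable_measure_prodMk_left
    ((by fun_prop : Measurable fun p : X × X => p.1 + p.2) (hd_null_meas Y c))).aemeasurable]
  refine Filter.Eventually.of_forall fun w => ?_
  simp only [Pi.zero_apply]
  refine measure_mono_null ?_ (h (c - w))
  intro v hv
  have hv' : w + v - c ∈ Y := hv
  change v - (c - w) ∈ Y
  convert hv' using 1
  abel

lemma HdNull.conv_right {μ : Measure X} {Y : Submodule ℝ X} (h : HdNull μ Y) (ν : Measure X)
    [SFinite μ] [SFinite ν] : HdNull (ν ∗ μ) Y := by
  rw [Measure.conv_comm]; exact h.conv_left ν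

lemma hd_int_bcf (ν : Measure X) [IsFiniteMeasure ν] (r : ℝ) (G : X →ᵇ V) (x : X) :
    Integrable (fun v => G (x + r • v)) ν := by
  refine Integrable.of_bound (C := ‖G‖)
    (G.continuous.comp (by fun_prop : Continuous fun v : X => x + r • v)).aestronglyMeasurable
    (Filter.Eventually.of_forall fun v => G.norm_coe_le_norm _)

/-- averaging operator -/
def hdC (ν : Measure X) [IsFiniteMeasure ν] (r : ℝ) : Module.End ℝ (X →ᵇ V) where
  toFun G := BoundedContinuousFunction.ofNormedAddCommGroup (fun x => ∫ v, G (x + r • v) ∂ν)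
    (by
      refine continuous_of_dominated (bound := fun _ => ‖G‖) ?_ ?_ ?_ ?_
      · intro x
        exact (G.continuous.comp (by fun_prop : Continuous fun v : X => x + r • v)).aestronglyMeasurable
      · intro x
        exact Filter.Eventually.of_forall fun v => G.norm_coe_le_norm _
      · exact integrable_const _
      · exact Filter.Eventually.of_forall fun v =>
          G.continuous.comp (by fun_prop : Continuous fun x : X => x + r • v))
    (‖G‖ * ν.real Set.univ)
    (fun x => norm_integral_le_of_norm_le_const
      (Filter.Eventually.of_forall fun v => G.norm_coe_le_norm _))
  map_add' G H := by
    ext x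
    exact integral_add (hd_int_bcf ν r G x) (hd_int_bcf ν r H x)
  map_smul' c G := by
    ext x
    exact integral_smul c _

lemma hdC_apply (ν : Measure X) [IsFiniteMeasure ν] (r : ℝ) (G : X →ᵇ V) (x : X) :
    hdC ν r G x = ∫ v, G (x + r • v) ∂ν := rfl

lemma hdC_commute (μ ν : Measure X) [IsFiniteMeasure μ] [IsFiniteMeasure ν] (r : ℝ) :
    Commute (hdC (V := V) μ r) (hdC ν r) := by
  apply LinearMap.ext
  intro G
  ext x
  change ∫ v, (∫ w, G ((x + r • v) + r • w) ∂ν) ∂μ = ∫ w, (∫ v, G ((x + r • w) + r • v) ∂μ) ∂ν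
  rw [integral_integral_swap]
  · simp only [add_right_comm]
  · refine Integrable.of_bound (C := ‖G‖)
      (G.continuous.comp (by fun_prop : Continuous
        fun p : X × X => (x + r • p.1) + r • p.2)).aestronglyMeasurable
      (Filter.Eventually.of_forall fun v => G.norm_coe_le_norm _)

lemma hdC_enorm (ν : Measure X) [IsFiniteMeasure ν] (r : ℝ) (G : X →ᵇ V) (x : X) :
    ‖hdC ν r G x‖ₑ ≤ hdI ν r (fun y => ‖G y‖ₑ) x :=
  enorm_integral_le_lintegral_enorm _

/-- difference operator -/
def hdD (μp μm : Measure X) [IsFiniteMeasure μp] [IsFiniteMeasure μm] (r : ℝ) :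
    Module.End ℝ (X →ᵇ V) := 1 - (hdC μp r - hdC μm r)

lemma hdD_apply (μp μm : Measure X) [IsFiniteMeasure μp] [IsFiniteMeasure μm] (r : ℝ)
    (G : X →ᵇ V) (x : X) : hdD μp μm r G x =
      G x - (∫ v, G (x + r • v) ∂μp - ∫ v, G (x + r • v) ∂μm) := rfl

lemma hd_ring_commute {R : Type*} [Ring R] {a a' b b' : R} (h1 : Commute a b) (h2 : Commute a b')
    (h3 : Commute a' b) (h4 : Commute a' b') : Commute (1 - (a - a')) (1 - (b - b')) := by
  have h : Commute (a - a') (b - b') := (h1.sub_right h2).sub_left (h3.sub_right h4)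
  exact (Commute.one_left _).sub_left ((Commute.one_right _).sub_right h)

lemma hdD_commute (μp μm νp νm : Measure X) [IsFiniteMeasure μp] [IsFiniteMeasure μm]
    [IsFiniteMeasure νp] [IsFiniteMeasure νm] (r : ℝ) :
    Commute (hdD (V := V) μp μm r) (hdD νp νm r) := by
  exact hd_ring_commute (hdC_commute μp νp r) (hdC_commute μp νm r) (hdC_commute μm νp r)
    (hdC_commute μm νm r)

lemma hd_bcf_meas (G : X →ᵇ V) : Measurable fun y => ‖G y‖ₑ := G.continuous.enorm.measurable

lemma hdD_enorm (μp μm : Measure X) [IsFiniteMeasure μp] [IsFiniteMeasure μm] (r : ℝ)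
    (G : X →ᵇ V) (x : X) : ‖hdD μp μm r G x‖ₑ ≤
      hdI (Measure.dirac 0 + (μp + μm)) r (fun y => ‖G y‖ₑ) x := by
  rw [hdI_add_measure, hdI_add_measure, hdI_dirac r (hd_bcf_meas G), hdD_apply]
  refine enorm_sub_le.trans ?_
  gcongr
  refine enorm_sub_le.trans ?_
  gcongr
  · exact hdC_enorm μp r G x
  · exact hdC_enorm μm r G x

lemma hdD_enorm' (μp μm : Measure X) [IsFiniteMeasure μp] [IsFiniteMeasure μm] (r : ℝ)
    (G : X →ᵇ V) (x : X) : ‖G x‖ₑ ≤ ‖hdD μp μm r G x‖ₑ +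
      hdI (μp + μm) r (fun y => ‖G y‖ₑ) x := by
  rw [hdI_add_measure]
  have : G x = hdD μp μm r G x + (hdC μp r G x - hdC μm r G x) := by
    rw [hdD_apply, hdC_apply, hdC_apply]; abel
  conv_lhs => rw [this]
  refine (enorm_add_le _ _).trans ?_
  gcongr
  refine enorm_sub_le.trans ?_
  gcongr
  · exact hdC_enorm μp r G x
  · exact hdC_enorm μm r G x

lemma hd_elim {ι : Type*} [DecidableEq ι] (μp μm : ι → Measure X) [∀ i, IsFiniteMeasure (μp i)]
    [∀ i, IsFiniteMeasure (μm i)] (s : Finset ι) :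
    ∃ (α : ι → Measure X) (β : Measure X), (∀ j, IsFiniteMeasure (α j)) ∧ IsFiniteMeasure β ∧
      (∀ Y, (∀ k ∈ s, HdNull (μp k + μm k) Y) → HdNull β Y) ∧
      ∀ (r : ℝ) (G : ι → X →ᵇ V) (x : X),
        ‖(∑ j ∈ s, G j) x‖ₑ ≤ ∑ j ∈ s, hdI (α j) r (fun y => ‖hdD (μp j) (μm j) r (G j) y‖ₑ) x +
          hdI β r (fun y => ‖(∑ j ∈ s, G j) y‖ₑ) x := by
  induction s using Finset.induction_on with
  | empty =>
    refine ⟨fun _ => 0, 0, fun _ => inferInstance, inferInstance, fun Y _ c => rfl, ?_⟩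
    intro r G x
    simp
  | insert k s hk ih =>
    obtain ⟨α, β, hα, hβ, hn, hb⟩ := ih
    set γ : Measure X := Measure.dirac 0 + (μp k + μm k) with hγ
    refine ⟨fun j => if j = k then Measure.dirac 0 + β else α j ∗ γ, (μp k + μm k) + β ∗ γ,
      ?_, inferInstance, ?_, ?_⟩
    · intro j
      by_cases hj : j = k
      · simp only [hj, if_true]; infer_instance
      · simp only [hj, if_false]; infer_instance
    · intro Y hY
      refine (hY k (Finset.mem_insert_self _ _)).add (HdNull.conv_left (hn Y fun j hj =>
        hY j (Finset.mem_insert_of_mem hj)) γ)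
    · intro r G x
      set T := ∑ j ∈ insert k s, G j with hT
      set D := fun j => hdD (V := V) (μp j) (μm j) r with hD
      have hDT : D k T = D k (G k) + ∑ j ∈ s, D k (G j) := by
        rw [hT, Finset.sum_insert hk, map_add, map_sum]
      have hmT := hd_bcf_meas T
      have h1 := hdD_enorm' (μp k) (μm k) r T x
      have h2 : ‖D k T x‖ₑ ≤ ‖D k (G k) x‖ₑ + ‖(∑ j ∈ s, D k (G j)) x‖ₑ := by
        rw [hDT]
        exact enorm_add_le _ _
      have h3 := hb r (fun j => D k (G j)) x
      have h4 : ∀ j ∈ s, hdI (α j) r (fun y => ‖D j (D k (G j)) y‖ₑ) x ≤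
          hdI (α j ∗ γ) r (fun y => ‖D j (G j) y‖ₑ) x := by
        intro j _
        rw [hdI_conv _ _ _ (hd_bcf_meas _)]
        refine hdI_mono _ _ (fun y => ?_) x
        have hc : D j (D k (G j)) = D k (D j (G j)) :=
          LinearMap.congr_fun (hdD_commute (V := V) (μp j) (μm j) (μp k) (μm k) r).eq (G j)
        rw [hc]
        exact hdD_enorm _ _ _ _ _
      have h5 : hdI β r (fun y => ‖(∑ j ∈ s, D k (G j)) y‖ₑ) x ≤
          hdI β r (fun y => ‖D k (G k) y‖ₑ) x + hdI (β ∗ γ) r (fun y => ‖T y‖ₑ) x := by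
        rw [hdI_conv _ _ _ hmT, ← hdI_add _ _ (hd_bcf_meas _)]
        refine hdI_mono _ _ (fun y => ?_) x
        have : ∑ j ∈ s, D k (G j) = D k T - D k (G k) := by rw [hDT]; abel
        rw [this, add_comm]
        refine (enorm_sub_le (a := D k T y) (b := D k (G k) y)).trans ?_
        gcongr
        exact hdD_enorm _ _ _ _ _
      rw [Finset.sum_insert hk]
      have h6 : ∑ j ∈ s, hdI (if j = k then Measure.dirac 0 + β else α j ∗ γ) r
          (fun y => ‖D j (G j) y‖ₑ) x = ∑ j ∈ s, hdI (α j ∗ γ) r (fun y => ‖D j (G j) y‖ₑ) x := by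
        refine Finset.sum_congr rfl fun j hj => ?_
        have : j ≠ k := fun h => hk (h ▸ hj)
        simp [this]
      rw [h6]
      simp only [if_true]
      rw [hdI_add_measure (Measure.dirac 0) β, hdI_dirac r (hd_bcf_meas _),
        hdI_add_measure (μp k + μm k)]
      calc _ ≤ _ := h1
        _ ≤ (‖D k (G k) x‖ₑ + (∑ j ∈ s, hdI (α j ∗ γ) r (fun y => ‖D j (G j) y‖ₑ) x +
            (hdI β r (fun y => ‖D k (G k) y‖ₑ) x + hdI (β ∗ γ) r (fun y => ‖T y‖ₑ) x))) +
            hdI (μp k + μm k) r (fun y => ‖T y‖ₑ) x := by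
          gcongr
          refine h2.trans ?_
          gcongr
          refine h3.trans ?_
          exact add_le_add (Finset.sum_le_sum h4) h5
        _ = _ := by
          simp only [hD]
          ring

lemma hdD_comp (μp μm : Measure X) [IsFiniteMeasure μp] [IsFiniteMeasure μm] (r : ℝ)
    (L : V →L[ℝ] V) (G : X →ᵇ V) (x : X) :
    hdD μp μm r (L.compLeftContinuousBounded X G) x = L (hdD μp μm r G x) := by
  rw [hdD_apply, hdD_apply, map_sub, map_sub,
    ← L.integral_comp_comm (hd_int_bcf μp r G x), ← L.integral_comp_comm (hd_int_bcf μm r G x)]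
  rfl

lemma hd_pointwise {ι : Type*} [Fintype ι] [DecidableEq ι] (μp μm : ι → Measure X)
    [∀ i, IsFiniteMeasure (μp i)] [∀ i, IsFiniteMeasure (μm i)] (s : Finset ι) (i : ι)
    (L : ι → V →L[ℝ] V) :
    ∃ (α : ι → Measure X) (ν : Measure X), (∀ j, IsFiniteMeasure (α j)) ∧ IsFiniteMeasure ν ∧
      (∀ Y, ((∀ k ∈ s, HdNull (μp k + μm k) Y) ∨ HdNull (μp i + μm i) Y) → HdNull ν Y) ∧
      ∀ (r : ℝ) (U : ι → X →ᵇ V) (_ : ∀ x, U i x = ∑ j ∈ s, L j (U j x)) (x : X),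
        ‖U i x‖ₑ ≤ ∑ j, hdI (α j) r (fun y => ‖hdD (μp j) (μm j) r (U j) y‖ₑ) x +
          hdI ν r (fun y => ‖U i y‖ₑ) x := by
  obtain ⟨α, β, hα, hβ, hn, hb⟩ := hd_elim (V := V) μp μm s
  refine ⟨fun j => (if j ∈ s then ENNReal.ofReal ‖L j‖ • α j else 0) + (if j = i then β else 0),
    β ∗ (μp i + μm i), ?_, inferInstance, ?_, ?_⟩
  · intro j
    have h1 : IsFiniteMeasure (ENNReal.ofReal ‖L j‖ • α j) := (α j).smul_finite ENNReal.ofReal_ne_top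
    dsimp only
    split_ifs <;> infer_instance
  · rintro Y (h | h)
    · exact (hn Y h).conv_left _
    · exact h.conv_right _
  · intro r U hU x
    set G : ι → X →ᵇ V := fun j => (L j).compLeftContinuousBounded X (U j) with hG
    have hGU : ∑ j ∈ s, G j = U i := by
      ext y
      rw [hU y]
      simp [hG]
    have h1 := hb r G x
    rw [hGU] at h1
    have h2 : ∀ j ∈ s, hdI (α j) r (fun y => ‖hdD (μp j) (μm j) r (G j) y‖ₑ) x ≤
        ENNReal.ofReal ‖L j‖ * hdI (α j) r (fun y => ‖hdD (μp j) (μm j) r (U j) y‖ₑ) x := by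
      intro j _
      rw [← hdI_mul _ _ (hd_bcf_meas _)]
      refine hdI_mono _ _ (fun y => ?_) x
      rw [hG, hdD_comp, ← ofReal_norm, ← ofReal_norm, ← ENNReal.ofReal_mul (norm_nonneg _)]
      exact ENNReal.ofReal_le_ofReal ((L j).le_opNorm _)
    have h3 : hdI β r (fun y => ‖U i y‖ₑ) x ≤
        hdI β r (fun y => ‖hdD (μp i) (μm i) r (U i) y‖ₑ) x +
        hdI (β ∗ (μp i + μm i)) r (fun y => ‖U i y‖ₑ) x := by
      rw [hdI_conv _ _ _ (hd_bcf_meas _), ← hdI_add _ _ (hd_bcf_meas _)]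
      exact hdI_mono _ _ (fun y => hdD_enorm' _ _ _ _ _) x
    refine h1.trans ?_
    have h4 : ∑ j, hdI ((if j ∈ s then ENNReal.ofReal ‖L j‖ • α j else 0) +
        (if j = i then β else 0)) r (fun y => ‖hdD (μp j) (μm j) r (U j) y‖ₑ) x =
        ∑ j ∈ s, ENNReal.ofReal ‖L j‖ * hdI (α j) r (fun y => ‖hdD (μp j) (μm j) r (U j) y‖ₑ) x +
          hdI β r (fun y => ‖hdD (μp i) (μm i) r (U i) y‖ₑ) x := by
      have e0 : ∀ (G : X → ℝ≥0∞), hdI (0 : Measure X) r G x = 0 := fun G => lintegral_zero_measure _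
      have e1 : ∀ (p : Prop) [Decidable p] (ν : Measure X) (G : X → ℝ≥0∞),
          hdI (if p then ν else 0) r G x = if p then hdI ν r G x else 0 := by
        intro p _ ν G
        split_ifs <;> simp [e0]
      simp only [hdI_add_measure, Finset.sum_add_distrib, e1, hdI_smul_measure]
      congr 1
      · simp
      · simp
    rw [h4, add_assoc]
    exact add_le_add (Finset.sum_le_sum h2) h3
end AveragePart

section IntegrationPart

variable {X : Type*} [NormedAddCommGroup X] [InnerProductSpace ℝ X] [FiniteDimensional ℝ X]
  [MeasurableSpace X] [BorelSpace X]

/-- integration in scale and position -/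
def hdJ (a : X → ℝ≥0∞) (F : ℝ → X → ℝ≥0∞) : ℝ≥0∞ :=
  ∫⁻ τ in Set.Ioi (0 : ℝ), ∫⁻ x, a (τ • x) * F τ x

/-- indicator of an annulus -/
def hdAnn (ε : ℝ) : X → ℝ≥0∞ := Set.indicator {w : X | ε ≤ ‖w‖ ∧ ‖w‖ < 2 * ε} (fun _ => 1)

lemma hdAnn_meas (ε : ℝ) : Measurable (hdAnn (X := X) ε) := by
  refine measurable_const.indicator ?_
  exact (measurableSet_le measurable_const measurable_norm).inter
    (measurableSet_lt measurable_norm measurable_const)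

lemma hdAnn_le (ε : ℝ) (w : X) : hdAnn ε w ≤ 1 := by
  unfold hdAnn; exact Set.indicator_le_self' (fun _ _ => zero_le) w

lemma hdJ_mono {a b : X → ℝ≥0∞} {F G : ℝ → X → ℝ≥0∞}
    (h : ∀ τ, 0 < τ → ∀ x, a (τ • x) * F τ x ≤ b (τ • x) * G τ x) : hdJ a F ≤ hdJ b G := by
  refine setLIntegral_mono' measurableSet_Ioi fun τ hτ => lintegral_mono fun x => h τ hτ x

lemma hd_meas_smul : Measurable fun p : ℝ × X => p.1 • p.2 :=
  (by fun_prop : Continuous fun p : ℝ × X => p.1 • p.2).measurable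

lemma hdJ_add {a : X → ℝ≥0∞} (ha : Measurable a) {F G : ℝ → X → ℝ≥0∞}
    (hF : Measurable (fun p : ℝ × X => F p.1 p.2)) :
    hdJ a (fun τ x => F τ x + G τ x) = hdJ a F + hdJ a G := by
  unfold hdJ
  have h1 : Measurable fun p : ℝ × X => a (p.1 • p.2) * F p.1 p.2 :=
    (ha.comp hd_meas_smul).mul hF
  rw [← lintegral_add_left h1.lintegral_prod_right']
  refine lintegral_congr fun τ => ?_
  have h2 : Measurable fun x => a (τ • x) * F τ x := h1.comp measurable_prodMk_left
  dsimp only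
  rw [← lintegral_add_left h2]
  simp only [mul_add]

lemma hdJ_zero (a : X → ℝ≥0∞) : hdJ a (fun _ _ => 0) = 0 := by simp [hdJ]

lemma hdJ_sum {ι : Type*} (s : Finset ι) {a : X → ℝ≥0∞} (ha : Measurable a)
    {F : ι → ℝ → X → ℝ≥0∞} (hF : ∀ i, Measurable (fun p : ℝ × X => F i p.1 p.2)) :
    hdJ a (fun τ x => ∑ i ∈ s, F i τ x) = ∑ i ∈ s, hdJ a (F i) := by
  classical
  induction s using Finset.induction_on with
  | empty => simp [hdJ_zero]
  | insert k s hk ih =>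
    simp only [Finset.sum_insert hk]
    rw [hdJ_add ha (hF k), ih]

lemma hdJ_mul {a : X → ℝ≥0∞} (ha : Measurable a) {F : ℝ → X → ℝ≥0∞}
    (hF : Measurable (fun p : ℝ × X => F p.1 p.2)) (c : ℝ≥0∞) :
    hdJ a (fun τ x => c * F τ x) = c * hdJ a F := by
  unfold hdJ
  have h1 : Measurable fun p : ℝ × X => a (p.1 • p.2) * F p.1 p.2 :=
    (ha.comp hd_meas_smul).mul hF
  rw [← lintegral_const_mul _ h1.lintegral_prod_right']
  refine lintegral_congr fun τ => ?_
  have h2 : Measurable fun x => a (τ • x) * F τ x := h1.comp measurable_prodMk_left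
  dsimp only
  rw [← lintegral_const_mul _ h2]
  refine lintegral_congr fun x => ?_
  ring

lemma hdI_meas2 (μ : Measure X) [SFinite μ] {Φ : ℝ → X → ℝ≥0∞}
    (hΦ : Measurable (fun p : ℝ × X => Φ p.1 p.2)) :
    Measurable (fun p : ℝ × X => hdI μ p.1⁻¹ (Φ p.1) p.2) := by
  unfold hdI
  refine Measurable.lintegral_prod_right'
    (f := fun q : (ℝ × X) × X => Φ q.1.1 (q.1.2 + q.1.1⁻¹ • q.2)) ?_
  exact hΦ.comp (by fun_prop : Measurable fun q : (ℝ × X) × X => (q.1.1, q.1.2 + q.1.1⁻¹ • q.2))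

lemma hdJ_master {a : X → ℝ≥0∞} (ha : Measurable a) (μ : Measure X) [IsFiniteMeasure μ]
    {Φ : ℝ → X → ℝ≥0∞} (hΦ : Measurable (fun p : ℝ × X => Φ p.1 p.2)) :
    hdJ a (fun τ x => hdI μ τ⁻¹ (Φ τ) x) =
      ∫⁻ y, ∫⁻ τ in Set.Ioi (0 : ℝ), ∫⁻ v, a (τ • y - v) * Φ τ y ∂μ := by
  have hm : Measurable fun p : (X × ℝ) × X => a (p.1.2 • p.1.1 - p.2) * Φ p.1.2 p.1.1 := by
    refine (ha.comp ?_).mul (hΦ.comp (by fun_prop : Measurable fun p : (X × ℝ) × X =>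
      (p.1.2, p.1.1)))
    exact (by fun_prop : Continuous fun p : (X × ℝ) × X => p.1.2 • p.1.1 - p.2).measurable
  have h1 : ∀ τ ∈ Set.Ioi (0 : ℝ), (∫⁻ x, a (τ • x) * hdI μ τ⁻¹ (Φ τ) x) =
      ∫⁻ y, ∫⁻ v, a (τ • y - v) * Φ τ y ∂μ := by
    intro τ hτ
    have hτ0 : τ ≠ 0 := ne_of_gt hτ
    have hΦτ : Measurable (Φ τ) := hΦ.comp measurable_prodMk_left
    have e1 : ∀ x, a (τ • x) * hdI μ τ⁻¹ (Φ τ) x =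
        ∫⁻ v, a (τ • x) * Φ τ (x + τ⁻¹ • v) ∂μ := by
      intro x
      have h : Measurable fun v => Φ τ (x + τ⁻¹ • v) := hΦτ.comp (hd_meas_aff x _)
      unfold hdI
      rw [lintegral_const_mul _ h]
    simp_rw [e1]
    have m1 : Measurable fun p : X × X => a (τ • p.1) * Φ τ (p.1 + τ⁻¹ • p.2) := by
      refine (ha.comp ?_).mul (hΦτ.comp ?_)
      · exact (by fun_prop : Continuous fun p : X × X => τ • p.1).measurable
      · exact (by fun_prop : Continuous fun p : X × X => p.1 + τ⁻¹ • p.2).measurable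
    rw [lintegral_lintegral_swap m1.aemeasurable]
    have e2 : ∀ v, (∫⁻ x, a (τ • x) * Φ τ (x + τ⁻¹ • v)) = ∫⁻ y, a (τ • y - v) * Φ τ y := by
      intro v
      rw [← lintegral_add_right_eq_self (fun y => a (τ • y - v) * Φ τ y) (τ⁻¹ • v)]
      refine lintegral_congr fun x => ?_
      rw [smul_add, smul_inv_smul₀ hτ0, add_sub_cancel_right]
    simp_rw [e2]
    have m2 : Measurable fun p : X × X => a (τ • p.2 - p.1) * Φ τ p.2 := by
      refine (ha.comp ?_).mul (hΦτ.comp measurable_snd)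
      exact (by fun_prop : Continuous fun p : X × X => τ • p.2 - p.1).measurable
    rw [lintegral_lintegral_swap m2.aemeasurable]
  unfold hdJ
  rw [setLIntegral_congr_fun measurableSet_Ioi h1]
  rw [lintegral_lintegral_swap]
  have := hm.lintegral_prod_right' (ν := μ)
  exact (this.comp measurable_swap).aemeasurable

lemma hdJ_master' {a : X → ℝ≥0∞} (ha : Measurable a) (μ : Measure X) [IsFiniteMeasure μ]
    {Φ : ℝ → X → ℝ≥0∞} (hΦ : Measurable (fun p : ℝ × X => Φ p.1 p.2)) :
    hdJ a (fun τ x => hdI μ τ⁻¹ (Φ τ) x) =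
      ∫⁻ y, ∫⁻ v, (∫⁻ τ in Set.Ioi (0 : ℝ), a (τ • y - v) * Φ τ y) ∂μ := by
  rw [hdJ_master ha μ hΦ]
  refine lintegral_congr fun y => ?_
  rw [lintegral_lintegral_swap]
  have : Measurable fun p : ℝ × X => a (p.1 • y - p.2) * Φ p.1 y := by
    refine (ha.comp ?_).mul (hΦ.comp (by fun_prop : Measurable fun p : ℝ × X => (p.1, y)))
    exact (by fun_prop : Continuous fun p : ℝ × X => p.1 • y - p.2).measurable
  exact this.aemeasurable

lemma hd_ae_ne [Nontrivial X] : ∀ᵐ x : X, x ≠ 0 := by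
  have : volume ({0} : Set X) = 0 := measure_singleton 0
  exact compl_mem_ae_iff.mpr this

lemma hdJ_lower [Nontrivial X] (ε : ℝ) (hε : 0 < ε) {G : X → ℝ≥0∞} (hG : Measurable G) :
    ∫⁻ x, G x / ‖x‖ₑ ≤ ENNReal.ofReal ε⁻¹ * hdJ (hdAnn ε) (fun _ x => G x) := by
  unfold hdJ
  have hm : Measurable fun p : ℝ × X => hdAnn ε (p.1 • p.2) * G p.2 :=
    ((hdAnn_meas ε).comp hd_meas_smul).mul (hG.comp measurable_snd)
  rw [lintegral_lintegral_swap hm.aemeasurable,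
    ← lintegral_const_mul _ (by
      have := (hm.comp measurable_swap).lintegral_prod_right' (ν := volume.restrict (Set.Ioi (0:ℝ)))
      exact this)]
  refine lintegral_mono_ae ?_
  filter_upwards [hd_ae_ne (X := X)] with x hx
  have hx' : 0 < ‖x‖ := norm_pos_iff.mpr hx
  have h0 : Measurable fun τ : ℝ => hdAnn ε (τ • x) :=
    (hdAnn_meas ε).comp (by fun_prop : Continuous fun τ : ℝ => τ • x).measurable
  rw [lintegral_mul_const _ h0]
  have h1 : ENNReal.ofReal (ε / ‖x‖) ≤ ∫⁻ τ in Set.Ioi (0:ℝ), hdAnn ε (τ • x) := by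
    have hs : Set.Ico (ε / ‖x‖) (2 * ε / ‖x‖) ⊆ Set.Ioi 0 := fun t ht =>
      lt_of_lt_of_le (by positivity) ht.1
    calc ENNReal.ofReal (ε / ‖x‖) = volume (Set.Ico (ε / ‖x‖) (2 * ε / ‖x‖)) := by
          rw [Real.volume_Ico]; congr 1; ring
      _ = ∫⁻ τ in Set.Ico (ε / ‖x‖) (2 * ε / ‖x‖), 1 := by simp
      _ ≤ ∫⁻ τ in Set.Ico (ε / ‖x‖) (2 * ε / ‖x‖), hdAnn ε (τ • x) := by
          refine setLIntegral_mono' measurableSet_Ico fun τ hτ => ?_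
          have : (τ • x) ∈ {w : X | ε ≤ ‖w‖ ∧ ‖w‖ < 2 * ε} := by
            have hτ0 : 0 < τ := hs hτ
            change ε ≤ ‖τ • x‖ ∧ ‖τ • x‖ < 2 * ε
            rw [norm_smul, Real.norm_of_nonneg hτ0.le]
            exact ⟨(div_le_iff₀ hx').mp hτ.1, (lt_div_iff₀ hx').mp hτ.2⟩
          rw [hdAnn, Set.indicator_of_mem this]
      _ ≤ _ := lintegral_mono_set hs
  calc G x / ‖x‖ₑ = ENNReal.ofReal ε⁻¹ * (ENNReal.ofReal (ε / ‖x‖) * G x) := by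
        rw [← mul_assoc, ← ENNReal.ofReal_mul (by positivity), div_eq_mul_inv, mul_comm]
        congr 1
        rw [← ofReal_norm, ← ENNReal.ofReal_inv_of_pos hx']
        congr 1
        field_simp
    _ ≤ _ := by gcongr

lemma hd_len {a : X → ℝ≥0∞} {R : ℝ} (ha1 : ∀ w, a w ≤ 1)
    (haR : ∀ w, a w ≠ 0 → ‖w‖ < R) (y v : X) (hy : y ≠ 0) :
    ∫⁻ τ in Set.Ioi (0 : ℝ), a (τ • y - v) ≤ ENNReal.ofReal (2 * R) / ‖y‖ₑ := by
  have hy' : 0 < ‖y‖ := norm_pos_iff.mpr hy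
  set T : Set ℝ := {τ | ‖τ • y - v‖ < R} with hT
  have hTm : MeasurableSet T :=
    measurableSet_lt (by fun_prop : Continuous fun τ : ℝ => ‖τ • y - v‖).measurable measurable_const
  calc ∫⁻ τ in Set.Ioi (0 : ℝ), a (τ • y - v) ≤ ∫⁻ τ, a (τ • y - v) := setLIntegral_le_lintegral _ _
    _ ≤ ∫⁻ τ, T.indicator (fun _ => 1) τ := by
        refine lintegral_mono fun τ => ?_
        by_cases h : τ ∈ T
        · rw [Set.indicator_of_mem h]; exact ha1 _
        · rw [Set.indicator_of_notMem h]
          by_contra h2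
          exact h (haR _ (fun h3 => h2 (by rw [h3])))
    _ = volume T := by rw [lintegral_indicator hTm]; simp
    _ ≤ Metric.ediam T := Real.volume_le_diam T
    _ ≤ ENNReal.ofReal (2 * R) / ‖y‖ₑ := by
        refine Metric.ediam_le fun s hs t ht => ?_
        rw [← ofReal_norm, ← ENNReal.ofReal_div_of_pos hy', edist_dist]
        refine ENNReal.ofReal_le_ofReal ?_
        rw [le_div_iff₀ hy', Real.dist_eq, ← Real.norm_eq_abs, ← norm_smul]
        have : (s - t) • y = (s • y - v) - (t • y - v) := by rw [sub_smul]; abel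
        rw [this]
        refine (norm_sub_le _ _).trans ?_
        have h1 : ‖s • y - v‖ < R := hs
        have h2 : ‖t • y - v‖ < R := ht
        linarith

end IntegrationPart

section BoundPart

variable {X : Type*} [NormedAddCommGroup X] [InnerProductSpace ℝ X] [FiniteDimensional ℝ X]
  [MeasurableSpace X] [BorelSpace X]

lemma hd_div_meas {G : X → ℝ≥0∞} (hG : Measurable G) : Measurable fun y => G y / ‖y‖ₑ :=
  hG.div (by fun_prop)

lemma hd_K2 [Nontrivial X] {a : X → ℝ≥0∞} (ham : Measurable a) {R : ℝ} (ha1 : ∀ w, a w ≤ 1)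
    (haR : ∀ w, a w ≠ 0 → ‖w‖ < R) (μ : Measure X) [IsFiniteMeasure μ]
    {Φ : ℝ → X → ℝ≥0∞} (hΦ : Measurable (fun p : ℝ × X => Φ p.1 p.2))
    {φ : X → ℝ≥0∞} (hφ : Measurable φ) (M : ℝ≥0∞)
    (hM : ∀ᵐ v ∂μ, ∀ τ > 0, ∀ y, a (τ • y - v) ≠ 0 → Φ τ y ≤ M * ‖y‖ₑ * φ y) :
    hdJ a (fun τ x => hdI μ τ⁻¹ (Φ τ) x) ≤
      M * ENNReal.ofReal (2 * R) * μ Set.univ * ∫⁻ y, φ y := by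
  rw [hdJ_master' ham μ hΦ, ← lintegral_const_mul _ hφ]
  refine lintegral_mono_ae ?_
  filter_upwards [hd_ae_ne (X := X)] with y hy
  have h1 : ∀ᵐ v ∂μ, (∫⁻ τ in Set.Ioi (0 : ℝ), a (τ • y - v) * Φ τ y) ≤
      M * ENNReal.ofReal (2 * R) * φ y := by
    filter_upwards [hM] with v hv
    have hma : Measurable fun τ : ℝ => a (τ • y - v) :=
      ham.comp (by fun_prop : Continuous fun τ : ℝ => τ • y - v).measurable
    calc (∫⁻ τ in Set.Ioi (0 : ℝ), a (τ • y - v) * Φ τ y) ≤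
        ∫⁻ τ in Set.Ioi (0 : ℝ), a (τ • y - v) * (M * ‖y‖ₑ * φ y) := by
          refine setLIntegral_mono' measurableSet_Ioi fun τ hτ => ?_
          by_cases h0 : a (τ • y - v) = 0
          · simp [h0]
          · gcongr
            exact hv τ hτ y h0
      _ = (∫⁻ τ in Set.Ioi (0 : ℝ), a (τ • y - v)) * (M * ‖y‖ₑ * φ y) :=
          lintegral_mul_const _ hma
      _ ≤ (ENNReal.ofReal (2 * R) / ‖y‖ₑ) * (M * ‖y‖ₑ * φ y) := by
          gcongr
          exact hd_len ha1 haR y v hy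
      _ = (ENNReal.ofReal (2 * R) / ‖y‖ₑ * ‖y‖ₑ) * (M * φ y) := by ring
      _ = _ := by
          rw [ENNReal.div_mul_cancel (by simpa using hy) enorm_ne_top]
          ring
  calc _ ≤ ∫⁻ _, M * ENNReal.ofReal (2 * R) * φ y ∂μ := lintegral_mono_ae h1
    _ = _ := by rw [lintegral_const]; ring

lemma hd_K3 [Nontrivial X] {a : X → ℝ≥0∞} (ham : Measurable a) {R : ℝ} (ha1 : ∀ w, a w ≤ 1)
    (haR : ∀ w, a w ≠ 0 → ‖w‖ < R) (ν : Measure X) [IsFiniteMeasure ν]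
    {G : X → ℝ≥0∞} (hG : Measurable G) (θ : ℝ≥0∞)
    (hθ : ∀ y : X, y ≠ 0 → ν {v | ∃ τ : ℝ, ‖τ • y - v‖ < R} ≤ θ) :
    hdJ a (fun τ x => hdI ν τ⁻¹ G x) ≤
      θ * ENNReal.ofReal (2 * R) * ∫⁻ y, G y / ‖y‖ₑ := by
  rw [hdJ_master' ham ν (Φ := fun _ => G) (hG.comp measurable_snd),
    ← lintegral_const_mul _ (hd_div_meas hG)]
  refine lintegral_mono_ae ?_
  filter_upwards [hd_ae_ne (X := X)] with y hy
  set N := {v : X | ∃ τ : ℝ, ‖τ • y - v‖ < R} with hN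
  have h1 : ∀ v, (∫⁻ τ in Set.Ioi (0 : ℝ), a (τ • y - v) * G y) ≤
      (toMeasurable ν N).indicator (fun _ => ENNReal.ofReal (2 * R) / ‖y‖ₑ * G y) v := by
    intro v
    have hma : Measurable fun τ : ℝ => a (τ • y - v) :=
      ham.comp (by fun_prop : Continuous fun τ : ℝ => τ • y - v).measurable
    rw [lintegral_mul_const _ hma]
    by_cases hv : v ∈ N
    · rw [Set.indicator_of_mem (subset_toMeasurable _ _ hv)]
      gcongr
      exact hd_len ha1 haR y v hy
    · have : ∀ τ : ℝ, a (τ • y - v) = 0 := by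
        intro τ
        by_contra h
        exact hv ⟨τ, haR _ h⟩
      simp [this]
  calc _ ≤ ∫⁻ v, (toMeasurable ν N).indicator
        (fun _ => ENNReal.ofReal (2 * R) / ‖y‖ₑ * G y) v ∂ν := lintegral_mono h1
    _ = ENNReal.ofReal (2 * R) / ‖y‖ₑ * G y * ν N := by
        rw [lintegral_indicator (measurableSet_toMeasurable _ _), setLIntegral_const,
          measure_toMeasurable]
    _ ≤ ENNReal.ofReal (2 * R) / ‖y‖ₑ * G y * θ := by gcongr; exact hθ y hy
    _ = _ := by simp only [div_eq_mul_inv]; ring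

lemma hd_K4 [Nontrivial X] {a : X → ℝ≥0∞} (ham : Measurable a) (ha1 : ∀ w, a w ≤ 1)
    (μ : Measure X) [IsFiniteMeasure μ]
    {Φ : ℝ → X → ℝ≥0∞} (hΦ : Measurable (fun p : ℝ × X => Φ p.1 p.2))
    {G : X → ℝ≥0∞} (hG : Measurable G) (T : ℝ)
    (h1 : ∀ τ > 0, ∀ y, Φ τ y ≤ G y) (h2 : ∀ τ > 0, ∀ y, Φ τ y ≠ 0 → τ * ‖y‖ < T) :
    hdJ a (fun τ x => hdI μ τ⁻¹ (Φ τ) x) ≤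
      μ Set.univ * ENNReal.ofReal T * ∫⁻ y, G y / ‖y‖ₑ := by
  rw [hdJ_master ham μ hΦ, ← lintegral_const_mul _ (hd_div_meas hG)]
  refine lintegral_mono_ae ?_
  filter_upwards [hd_ae_ne (X := X)] with y hy
  have hy' : 0 < ‖y‖ := norm_pos_iff.mpr hy
  calc _ ≤ ∫⁻ τ in Set.Ioi (0 : ℝ), (Set.Ioo 0 (T / ‖y‖)).indicator
        (fun _ => G y * μ Set.univ) τ := by
        refine setLIntegral_mono' measurableSet_Ioi fun τ hτ => ?_
        by_cases h : τ ∈ Set.Ioo 0 (T / ‖y‖)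
        · rw [Set.indicator_of_mem h, ← lintegral_const]
          refine lintegral_mono fun v => ?_
          calc _ ≤ 1 * G y := by
                gcongr
                · exact ha1 _
                · exact h1 τ hτ y
            _ = _ := one_mul _
        · have : Φ τ y = 0 := by
            by_contra h0
            exact h ⟨hτ, (lt_div_iff₀ hy').mpr (h2 τ hτ y h0)⟩
          simp [this]
    _ ≤ ∫⁻ τ, (Set.Ioo 0 (T / ‖y‖)).indicator (fun _ => G y * μ Set.univ) τ :=
        setLIntegral_le_lintegral _ _
    _ = G y * μ Set.univ * ENNReal.ofReal (T / ‖y‖) := by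
        rw [lintegral_indicator measurableSet_Ioo, setLIntegral_const, Real.volume_Ioo, sub_zero]
    _ = _ := by
        rw [ENNReal.ofReal_div_of_pos hy', ofReal_norm]
        simp only [div_eq_mul_inv]; ring

lemma hd_K5 [Nontrivial X] {a : X → ℝ≥0∞} (ham : Measurable a) (ha1 : ∀ w, a w ≤ 1)
    (haR : ∀ w, a w ≠ 0 → ‖w‖ < 2) (m : Measure X) [IsFiniteMeasure m]
    (hm : ∀ᵐ v ∂m, ‖v‖ ≤ 1 / 2) {G : X → ℝ≥0∞} (hG : Measurable G) (θ : ℝ≥0∞)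
    (hθ : ∀ p : X, ‖p‖ ≤ 5 / 2 → m {v | a (p - v) ≠ 0} ≤ θ) :
    hdJ a (fun τ x => hdI m τ⁻¹ G x) ≤
      θ * ENNReal.ofReal (5 / 2) * ∫⁻ y, G y / ‖y‖ₑ := by
  rw [hdJ_master ham m (Φ := fun _ => G) (hG.comp measurable_snd),
    ← lintegral_const_mul _ (hd_div_meas hG)]
  refine lintegral_mono_ae ?_
  filter_upwards [hd_ae_ne (X := X)] with y hy
  have hy' : 0 < ‖y‖ := norm_pos_iff.mpr hy
  calc _ ≤ ∫⁻ τ in Set.Ioi (0 : ℝ), (Set.Ioc 0 (5 / 2 / ‖y‖)).indicator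
        (fun _ => θ * G y) τ := by
        refine setLIntegral_mono' measurableSet_Ioi fun τ hτ => ?_
        have hn : ‖τ • y‖ = τ * ‖y‖ := by rw [norm_smul, Real.norm_of_nonneg (le_of_lt hτ)]
        have hma : Measurable fun v : X => a (τ • y - v) :=
          ham.comp (by fun_prop : Continuous fun v : X => τ • y - v).measurable
        rw [lintegral_mul_const _ hma]
        by_cases h : τ ∈ Set.Ioc 0 (5 / 2 / ‖y‖)
        · rw [Set.indicator_of_mem h]
          gcongr
          refine le_trans ?_ (hθ (τ • y) ?_)
          · have hms : MeasurableSet {v | a (τ • y - v) ≠ 0} :=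
              hma (measurableSet_singleton 0).compl
            rw [← lintegral_indicator_one hms]
            refine lintegral_mono fun v => ?_
            by_cases hv : a (τ • y - v) = 0
            · simp [hv]
            · rw [Set.indicator_of_mem (by exact hv)]
              exact ha1 _
          · rw [hn]; exact (le_div_iff₀ hy').mp h.2
        · have : ∀ᵐ v ∂m, a (τ • y - v) = 0 := by
            filter_upwards [hm] with v hv
            by_contra h0
            refine h ⟨hτ, (le_div_iff₀ hy').mpr ?_⟩
            have h3 := haR _ h0
            have h4 := norm_le_norm_sub_add (τ • y) v
            rw [hn] at h4
            linarith
          rw [lintegral_congr_ae this]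
          simp
    _ ≤ ∫⁻ τ, (Set.Ioc 0 (5 / 2 / ‖y‖)).indicator (fun _ => θ * G y) τ :=
        setLIntegral_le_lintegral _ _
    _ = θ * G y * ENNReal.ofReal (5 / 2 / ‖y‖) := by
        rw [lintegral_indicator measurableSet_Ioc, setLIntegral_const, Real.volume_Ioc, sub_zero]
    _ = _ := by
        rw [ENNReal.ofReal_div_of_pos hy', ofReal_norm]
        simp only [div_eq_mul_inv]; ring

lemma hd_uniform {Z : Type*} [PseudoMetricSpace Z] {K : Set Z} (hK : IsCompact K)
    {g : Z → X → ℝ} (hg : Continuous fun p : Z × X => g p.1 p.2) (hg0 : ∀ z v, 0 ≤ g z v)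
    (ν : Measure X) [IsFiniteMeasure ν] (h0 : ∀ e ∈ K, ν {v | g e v = 0} = 0)
    {c : ℝ≥0∞} (hc : 0 < c) : ∃ η : ℝ, 0 < η ∧ ∀ e ∈ K, ν {v | g e v < η} ≤ c := by
  by_contra! hcon
  choose e heK he using fun k : ℕ => hcon (1 / (k + 1)) (by positivity)
  obtain ⟨z, hz, φ, hφ, hlim⟩ := hK.tendsto_subseq heK
  have hgk : ∀ k, Continuous (g (e k)) := fun k =>
    hg.comp (by fun_prop : Continuous fun v : X => (e k, v))
  have key := tendsto_measure_of_ae_tendsto_indicator_of_isFiniteMeasure (μ := ν)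
    (L := Filter.atTop) (As := fun k => {v | g (e (φ k)) v < 1 / ((φ k : ℝ) + 1)}) (A := ∅)
    MeasurableSet.empty
    (fun k => measurableSet_lt (hgk _).measurable measurable_const) ?_
  · rw [measure_empty] at key
    have := key.eventually (gt_mem_nhds hc)
    obtain ⟨k, hk⟩ := this.exists
    exact absurd hk (not_lt.mpr (he (φ k)).le)
  · have hne : ∀ᵐ v ∂ν, g z v ≠ 0 := measure_eq_zero_iff_ae_notMem.mp (h0 z hz)
    filter_upwards [hne] with v hv
    have hpos : 0 < g z v := lt_of_le_of_ne (hg0 z v) (Ne.symm hv)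
    have l1 : Filter.Tendsto (fun k => g (e (φ k)) v) Filter.atTop (nhds (g z v)) :=
      ((hg.comp (by fun_prop : Continuous fun w : Z => (w, v))).tendsto z).comp hlim
    have l2 : Filter.Tendsto (fun k => 1 / ((φ k : ℝ) + 1)) Filter.atTop (nhds 0) :=
      tendsto_one_div_add_atTop_nhds_zero_nat.comp hφ.tendsto_atTop
    filter_upwards [l2.eventually_lt l1 hpos] with k hk
    simp only [Set.mem_empty_iff_false, iff_false]
    exact not_lt.mpr hk.le

/-- distance to a subspace -/
def hdd (W : Submodule ℝ X) (x : X) : ℝ := ‖Wᗮ.starProjection x‖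

lemma hdd_cont (W : Submodule ℝ X) : Continuous (hdd W) := by unfold hdd; fun_prop

lemma hdd_le (W : Submodule ℝ X) (x : X) : hdd W x ≤ ‖x‖ := Submodule.norm_starProjection_apply_le _ _

lemma hdd_smul (W : Submodule ℝ X) (t : ℝ) (ht : 0 ≤ t) (x : X) : hdd W (t • x) = t * hdd W x := by
  unfold hdd; rw [map_smul, norm_smul, Real.norm_of_nonneg ht]

lemma hdd_zero_iff (W : Submodule ℝ X) (x : X) : hdd W x = 0 ↔ x ∈ W := by
  unfold hdd
  rw [norm_eq_zero, Submodule.starProjection_apply_eq_zero_iff, Submodule.orthogonal_orthogonal]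

lemma hdd_add (W : Submodule ℝ X) (x : X) {w : X} (hw : w ∈ W) : hdd W (x + w) = hdd W x := by
  have h := (hdd_zero_iff W w).mpr hw
  unfold hdd at h ⊢
  rw [norm_eq_zero] at h
  rw [map_add, h, add_zero]

lemma hd_small_plane (W : Submodule ℝ X) (m : Measure X) [IsFiniteMeasure m] (hm : HdNull m W)
    {c : ℝ≥0∞} (hc : 0 < c) :
    ∃ η : ℝ, 0 < η ∧ ∀ p : X, ‖p‖ ≤ 5 / 2 → m {v | hdd W (p - v) < η} ≤ c := by
  obtain ⟨η, hη, h⟩ := hd_uniform (K := Metric.closedBall (0 : X) (5 / 2))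
    (isCompact_closedBall _ _) (g := fun p v => hdd W (p - v))
    ((hdd_cont W).comp (by fun_prop)) (fun _ _ => norm_nonneg _) m (by
      intro p _
      refine measure_mono_null ?_ (hm p)
      intro v hv
      have : p - v ∈ W := (hdd_zero_iff W _).mp hv
      change v - p ∈ W
      rw [← neg_sub]
      exact W.neg_mem this) hc
  exact ⟨η, hη, fun p hp => h p (by simpa using hp)⟩

lemma hd_small_line (ν : Measure X) [IsFiniteMeasure ν]
    (hν : ∀ e : X, e ≠ 0 → HdNull ν (Submodule.span ℝ {e})) {c : ℝ≥0∞} (hc : 0 < c) :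
    ∃ R : ℝ, 0 < R ∧ ∀ y : X, y ≠ 0 → ν {v | ∃ τ : ℝ, ‖τ • y - v‖ < R} ≤ c := by
  obtain ⟨η, hη, h⟩ := hd_uniform (K := Metric.sphere (0 : X) 1)
    (isCompact_sphere _ _) (g := fun e v => ‖v - (inner ℝ e v : ℝ) • e‖)
    (by fun_prop) (fun _ _ => norm_nonneg _) ν (by
      intro e he
      have he0 : e ≠ 0 := by
        rintro rfl
        simp at he
      refine measure_mono_null ?_ (hν e he0 0)
      intro v hv
      have hv' : v - (inner ℝ e v : ℝ) • e = 0 := norm_eq_zero.mp hv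
      change v - 0 ∈ Submodule.span ℝ {e}
      rw [sub_zero, Submodule.mem_span_singleton]
      exact ⟨(inner ℝ e v : ℝ), (sub_eq_zero.mp hv').symm⟩) hc
  refine ⟨η / 2, by positivity, fun y hy => ?_⟩
  have hy' : 0 < ‖y‖ := norm_pos_iff.mpr hy
  set e := ‖y‖⁻¹ • y with he
  have hen : ‖e‖ = 1 := by rw [he, norm_smul, norm_inv, norm_norm, inv_mul_cancel₀ hy'.ne']
  refine le_trans (measure_mono ?_) (h e (by simpa using hen))
  rintro v ⟨τ, hτ⟩
  change ‖v - (inner ℝ e v : ℝ) • e‖ < η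
  set w := v - τ • y with hw
  have hwn : ‖w‖ < η / 2 := by rw [hw, norm_sub_rev]; exact hτ
  have hye : y = ‖y‖ • e := by rw [he, smul_inv_smul₀ hy'.ne']
  have hv : v = w + (τ * ‖y‖) • e := by rw [mul_smul, ← hye, hw]; abel
  have hee : inner ℝ e e = 1 := by rw [real_inner_self_eq_norm_sq, hen]; norm_num
  have : v - (inner ℝ e v : ℝ) • e = w - (inner ℝ e w : ℝ) • e := by
    rw [hv, inner_add_right, inner_smul_right, hee, add_smul, mul_one]
    abel
  rw [this]
  have h1 : ‖(inner ℝ e w : ℝ) • e‖ ≤ ‖w‖ := by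
    rw [norm_smul, hen, mul_one]
    have := norm_inner_le_norm (𝕜 := ℝ) e w
    rwa [hen, one_mul] at this
  have := norm_sub_le w ((inner ℝ e w : ℝ) • e)
  linarith

end BoundPart

section CorePart
open scoped BoundedContinuousFunction

lemma hd_choose (A c : ℝ≥0∞) (hA : A ≠ ⊤) (hc : c ≠ 0) :
    ∃ t : ℝ, 0 < t ∧ A * ENNReal.ofReal t ≤ c := by
  obtain ⟨d, hd0, hd⟩ : ∃ d : ℝ≥0, 0 < d ∧ (d : ℝ≥0∞) ≤ c := by
    by_cases h : c = ⊤
    · exact ⟨1, one_pos, by simp [h]⟩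
    · exact ⟨c.toNNReal, ENNReal.toNNReal_pos hc h, by rw [ENNReal.coe_toNNReal h]⟩
  lift A to ℝ≥0 using hA
  refine ⟨d / (A + 1), by positivity, le_trans ?_ hd⟩
  have : ENNReal.ofReal (d / (A + 1)) = ((d / (A + 1) : ℝ≥0) : ℝ≥0∞) := by
    rw [← ENNReal.ofReal_coe_nnreal]; rfl
  rw [this]
  norm_cast
  rw [mul_div_assoc', div_le_iff₀ (by positivity), mul_comm]
  gcongr
  simp

lemma hd_fin_min {ι : Type*} (s : Finset ι) (p : ι → ℝ → Prop)
    (hmono : ∀ i a b, p i a → b ≤ a → p i b) (h : ∀ i ∈ s, ∃ η : ℝ, 0 < η ∧ p i η) :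
    ∃ η : ℝ, 0 < η ∧ ∀ i ∈ s, p i η := by
  classical
  induction s using Finset.induction_on with
  | empty => exact ⟨1, one_pos, by simp⟩
  | insert k s hk ih =>
    obtain ⟨η, hη, h1⟩ := ih fun i hi => h i (Finset.mem_insert_of_mem hi)
    obtain ⟨η', hη', h2⟩ := h k (Finset.mem_insert_self _ _)
    refine ⟨min η η', lt_min hη hη', fun i hi => ?_⟩
    rcases Finset.mem_insert.mp hi with rfl | hi
    · exact hmono _ _ _ h2 (min_le_right _ _)
    · exact hmono _ _ _ (h1 i hi) (min_le_left _ _)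

variable {ι : Type*} [Fintype ι] [DecidableEq ι]
  {X : Type*} [NormedAddCommGroup X] [InnerProductSpace ℝ X] [FiniteDimensional ℝ X]
  [MeasurableSpace X] [BorelSpace X]
  {V : Type*} [NormedAddCommGroup V] [InnerProductSpace ℝ V] [FiniteDimensional ℝ V]

/-- the data used in the averaging argument -/
structure HdSys (ι X V : Type*) [NormedAddCommGroup X] [InnerProductSpace ℝ X]
    [MeasurableSpace X] [NormedAddCommGroup V] [InnerProductSpace ℝ V] where
  W : ι → Submodule ℝ X
  s : ι → Finset ι
  L : ι → ι → V →L[ℝ] V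
  μp : ι → Measure X
  μm : ι → Measure X
  κ : ι → Measure X
  m : ι → Measure X
  κ' : ι → Measure X
  fμp : ∀ i, IsFiniteMeasure (μp i)
  fμm : ∀ i, IsFiniteMeasure (μm i)
  fκ : ∀ i, IsFiniteMeasure (κ i)
  fm : ∀ i, IsFiniteMeasure (m i)
  fκ' : ∀ i, IsFiniteMeasure (κ' i)
  sμp : ∀ i, ∀ᵐ v ∂(μp i), v ∈ W i
  sμm : ∀ i, ∀ᵐ v ∂(μm i), v ∈ W i
  sκ : ∀ i, ∀ᵐ v ∂(κ i), v ∈ W i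
  sm : ∀ i, ∀ᵐ v ∂(m i), ‖v‖ ≤ 1 / 2
  sκ' : ∀ i, ∀ᵐ v ∂(κ' i), ‖v‖ ≤ 1 / 2
  hline : ∀ i, ∀ e : X, e ≠ 0 → (∀ k ∈ s i, HdNull (μp k + μm k) (Submodule.span ℝ {e})) ∨
    HdNull (μp i + μm i) (Submodule.span ℝ {e})
  hm : ∀ j, ∀ i ∈ s j, HdNull (m i) (W j)

attribute [instance] HdSys.fμp HdSys.fμm HdSys.fκ HdSys.fm HdSys.fκ'

/-- functions satisfying the averaging estimates -/
structure HdAdm (S : HdSys ι X V) (U : ι → X →ᵇ V) (φ : ι → X → ℝ≥0∞) : Prop where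
  meas : ∀ i, Measurable (φ i)
  rel : ∀ i x, U i x = ∑ j ∈ S.s i, S.L i j (U j x)
  hB : ∀ j r, 0 < r → ∀ x, ‖hdD (S.μp j) (S.μm j) r (U j) x‖ₑ ≤
    ENNReal.ofReal r * hdI (S.κ j) r (φ j) x
  hA : ∀ j r, 0 < r → ∀ x, ‖U j x‖ₑ ≤ hdI (S.m j) r (fun y => ‖U j y‖ₑ) x +
    ENNReal.ofReal r * hdI (S.κ' j) r (φ j) x

lemma hd_conc [Nontrivial X] (S : HdSys ι X V) (j : ι) {c : ℝ≥0∞} (hc : c ≠ 0) :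
    ∃ δ : ℝ, 0 < δ ∧ ∃ C : ℝ≥0∞, C ≠ ⊤ ∧ ∀ U φ, HdAdm S U φ →
      ∫⁻ x, ({x : X | hdd (S.W j) x < δ * ‖x‖}.indicator (fun x => ‖U j x‖ₑ) x) / ‖x‖ₑ ≤
        c * ∑ i, (∫⁻ x, ‖U i x‖ₑ / ‖x‖ₑ) + C * ∑ i, ∫⁻ x, φ i x := by
  set Λ : ℝ≥0∞ := ∑ i ∈ S.s j, ‖S.L j i‖ₑ with hΛ
  have hΛt : Λ ≠ ⊤ := ENNReal.sum_ne_top.mpr fun i _ => enorm_ne_top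
  obtain ⟨t, ht, htc⟩ := hd_choose (Λ * ENNReal.ofReal (5 / 2)) c
    (ENNReal.mul_ne_top hΛt ENNReal.ofReal_ne_top) hc
  obtain ⟨η, hη, hs⟩ := hd_fin_min (S.s j)
    (fun i η => ∀ p : X, ‖p‖ ≤ 5 / 2 → (S.m i) {v | hdd (S.W j) (p - v) < η} ≤ ENNReal.ofReal t)
    (fun i a b h hab p hp => (measure_mono fun v (hv : _ < _) => lt_of_lt_of_le hv hab).trans
      (h p hp))
    (fun i hi => hd_small_plane (S.W j) (S.m i) (S.hm j i hi) (by simpa using ht))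
  set C0 : ℝ≥0∞ := ∑ i, 2 * ENNReal.ofReal (2 * 2) * (S.κ' i) Set.univ with hC0
  refine ⟨η / 2, by positivity, Λ * C0, ?_, ?_⟩
  · refine ENNReal.mul_ne_top hΛt (ENNReal.sum_ne_top.mpr fun i _ => ?_)
    exact ENNReal.mul_ne_top (by finiteness) (measure_ne_top _ _)
  intro U φ hU
  set a : X → ℝ≥0∞ := {w : X | (1 ≤ ‖w‖ ∧ ‖w‖ < 2) ∧ hdd (S.W j) w < η}.indicator (fun _ => 1)
    with ha
  have ham : Measurable a := by
    refine measurable_const.indicator ?_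
    exact ((measurableSet_le measurable_const measurable_norm).inter
      (measurableSet_lt measurable_norm measurable_const)).inter
      (measurableSet_lt (hdd_cont _).measurable measurable_const)
  have ha1 : ∀ w, a w ≤ 1 := fun w => Set.indicator_le_self' (fun _ _ => zero_le) w
  have has : ∀ w, a w ≠ 0 → (1 ≤ ‖w‖ ∧ ‖w‖ < 2) ∧ hdd (S.W j) w < η := by
    intro w hw
    by_contra h
    have h' : w ∉ {w : X | (1 ≤ ‖w‖ ∧ ‖w‖ < 2) ∧ hdd (S.W j) w < η} := h
    exact hw (Set.indicator_of_notMem h' _)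
  set G : X → ℝ≥0∞ := {x : X | hdd (S.W j) x < η / 2 * ‖x‖}.indicator (fun x => ‖U j x‖ₑ) with hG
  have hGm : Measurable G := by
    refine (hd_bcf_meas _).indicator ?_
    exact measurableSet_lt (hdd_cont _).measurable (by fun_prop)
  set Ψ : ι → ℝ → X → ℝ≥0∞ := fun i τ y => ENNReal.ofReal τ⁻¹ * φ i y with hΨ
  have hΨm : ∀ i, Measurable fun p : ℝ × X => Ψ i p.1 p.2 := fun i =>
    (by fun_prop : Measurable fun p : ℝ × X => ENNReal.ofReal p.1⁻¹).mul
      ((hU.meas i).comp measurable_snd)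
  set F1 : ι → ℝ → X → ℝ≥0∞ := fun i τ x => hdI (S.m i) τ⁻¹ (fun y => ‖U i y‖ₑ) x with hF1
  set F2 : ι → ℝ → X → ℝ≥0∞ := fun i τ x => hdI (S.κ' i) τ⁻¹ (Ψ i τ) x with hF2
  have hF1m : ∀ i, Measurable fun p : ℝ × X => F1 i p.1 p.2 := fun i =>
    hdI_meas2 (S.m i) (Φ := fun _ y => ‖U i y‖ₑ) ((hd_bcf_meas (U i)).comp measurable_snd)
  have hF2m : ∀ i, Measurable fun p : ℝ × X => F2 i p.1 p.2 := fun i =>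
    hdI_meas2 (S.κ' i) (hΨm i)
  have h1 : hdJ (hdAnn 1) (fun _ x => G x) ≤
      hdJ a (fun τ x => ∑ i ∈ S.s j, ‖S.L j i‖ₑ * (F1 i τ x + F2 i τ x)) := by
    refine hdJ_mono fun τ hτ x => ?_
    by_cases hx : x ∈ {x : X | hdd (S.W j) x < η / 2 * ‖x‖}
    swap
    · simp [hG, Set.indicator_of_notMem hx]
    by_cases hx2 : τ • x ∈ {w : X | 1 ≤ ‖w‖ ∧ ‖w‖ < 2 * 1}
    swap
    · rw [hdAnn, Set.indicator_of_notMem hx2, zero_mul]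
      exact zero_le
    have hn : ‖τ • x‖ = τ * ‖x‖ := by rw [norm_smul, Real.norm_of_nonneg hτ.le]
    have hx3 : τ • x ∈ {w : X | (1 ≤ ‖w‖ ∧ ‖w‖ < 2) ∧ hdd (S.W j) w < η} := by
      have h4 : 1 ≤ ‖τ • x‖ ∧ ‖τ • x‖ < 2 * 1 := hx2
      have h5 : hdd (S.W j) x < η / 2 * ‖x‖ := hx
      refine ⟨⟨h4.1, by linarith [h4.2]⟩, ?_⟩
      rw [hdd_smul _ _ hτ.le]
      rw [hn] at h4
      nlinarith [mul_lt_mul_of_pos_left h5 hτ]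
    rw [ha, hdAnn, Set.indicator_of_mem hx2, Set.indicator_of_mem hx3, one_mul, one_mul, hG,
      Set.indicator_of_mem hx, hU.rel j x]
    refine (enorm_sum_le _ _).trans (Finset.sum_le_sum fun i _ => ?_)
    refine ((S.L j i).le_opENorm _).trans ?_
    gcongr
    refine (hU.hA i τ⁻¹ (by positivity) x).trans (le_of_eq ?_)
    simp only [hF1, hF2, hΨ]
    rw [hdI_mul _ _ (hU.meas i)]
  have h2 : ∀ i ∈ S.s j, hdJ a (fun τ x => ‖S.L j i‖ₑ * (F1 i τ x + F2 i τ x)) ≤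
      ‖S.L j i‖ₑ * (ENNReal.ofReal t * ENNReal.ofReal (5 / 2) * (∑ i, ∫⁻ x, ‖U i x‖ₑ / ‖x‖ₑ) +
        C0 * ∑ i, ∫⁻ x, φ i x) := by
    intro i hi
    rw [hdJ_mul ham ((hF1m i).add (hF2m i)), hdJ_add ham (hF1m i)]
    gcongr
    · refine (hd_K5 ham ha1 (fun w hw => (has w hw).1.2) (S.m i) (S.sm i) (hd_bcf_meas (U i))
        (ENNReal.ofReal t) (fun p hp => (measure_mono fun v hv => ?_).trans (hs i hi p hp))).trans ?_
      · exact (has _ hv).2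
      · gcongr
        exact Finset.single_le_sum (f := fun i => ∫⁻ x, ‖U i x‖ₑ / ‖x‖ₑ) (fun _ _ => zero_le)
          (Finset.mem_univ i)
    · refine (hd_K2 ham ha1 (fun w hw => (has w hw).1.2) (S.κ' i) (hΨm i) (hU.meas i) 2 ?_).trans ?_
      · filter_upwards [S.sκ' i] with v hv τ hτ y hy
        simp only [hΨ]
        gcongr
        have h3 := (has _ hy).1.1
        have hn : ‖τ • y‖ = τ * ‖y‖ := by rw [norm_smul, Real.norm_of_nonneg (le_of_lt hτ)]
        have h4 := norm_sub_le (τ • y) v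
        rw [hn] at h4
        have h5 : 1 / 2 ≤ τ * ‖y‖ := by linarith
        rw [← ofReal_norm, show (2 : ℝ≥0∞) = ENNReal.ofReal 2 by simp,
          ← ENNReal.ofReal_mul (by norm_num)]
        refine ENNReal.ofReal_le_ofReal ?_
        rw [inv_le_iff_one_le_mul₀ hτ]
        linarith
      · gcongr
        · exact Finset.single_le_sum
            (f := fun i => 2 * ENNReal.ofReal (2 * 2) * (S.κ' i) Set.univ) (fun _ _ => zero_le)
            (Finset.mem_univ i)
        · exact Finset.single_le_sum (f := fun i => ∫⁻ x, φ i x) (fun _ _ => zero_le)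
            (Finset.mem_univ i)
  calc ∫⁻ x, G x / ‖x‖ₑ ≤ ENNReal.ofReal 1⁻¹ * hdJ (hdAnn 1) (fun _ x => G x) :=
        hdJ_lower 1 one_pos hGm
    _ ≤ hdJ a (fun τ x => ∑ i ∈ S.s j, ‖S.L j i‖ₑ * (F1 i τ x + F2 i τ x)) := by simpa using h1
    _ = ∑ i ∈ S.s j, hdJ a (fun τ x => ‖S.L j i‖ₑ * (F1 i τ x + F2 i τ x)) :=
        hdJ_sum _ ham fun i => ((hF1m i).add (hF2m i)).const_mul _
    _ ≤ ∑ i ∈ S.s j, ‖S.L j i‖ₑ * (ENNReal.ofReal t * ENNReal.ofReal (5 / 2) *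
          (∑ i, ∫⁻ x, ‖U i x‖ₑ / ‖x‖ₑ) + C0 * ∑ i, ∫⁻ x, φ i x) := Finset.sum_le_sum h2
    _ = (Λ * ENNReal.ofReal (5 / 2) * ENNReal.ofReal t) * (∑ i, ∫⁻ x, ‖U i x‖ₑ / ‖x‖ₑ) +
          Λ * C0 * ∑ i, ∫⁻ x, φ i x := by rw [← Finset.sum_mul]; ring
    _ ≤ _ := by gcongr

end CorePart

section FinalPart
open scoped BoundedContinuousFunction

variable {ι : Type*} [Fintype ι] [DecidableEq ι]
  {X : Type*} [NormedAddCommGroup X] [InnerProductSpace ℝ X] [FiniteDimensional ℝ X]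
  [MeasurableSpace X] [BorelSpace X]
  {V : Type*} [NormedAddCommGroup V] [InnerProductSpace ℝ V] [FiniteDimensional ℝ V]

lemma hd_split (S : HdSys ι X V) {U : ι → X →ᵇ V} {φ : ι → X → ℝ≥0∞} (hU : HdAdm S U φ) (j : ι)
    (δ r : ℝ) (hr : 0 < r) (y : X) :
    ‖hdD (S.μp j) (S.μm j) r (U j) y‖ₑ ≤
      hdI (S.κ j) r (fun z => ENNReal.ofReal r *
        {z | δ * r ≤ hdd (S.W j) z}.indicator (φ j) z) y +
      hdI (Measure.dirac 0 + (S.μp j + S.μm j)) r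
        ({z | hdd (S.W j) z < δ * r}.indicator (fun z => ‖U j z‖ₑ)) y := by
  have hd : ∀ v ∈ S.W j, hdd (S.W j) (y + r • v) = hdd (S.W j) y := fun v hv =>
    hdd_add _ _ ((S.W j).smul_mem r hv)
  by_cases h : δ * r ≤ hdd (S.W j) y
  · refine le_trans ?_ le_self_add
    refine (hU.hB j r hr y).trans (le_of_eq ?_)
    rw [← hdI_mul _ _ (hU.meas j)]
    refine lintegral_congr_ae ?_
    filter_upwards [S.sκ j] with v hv
    have : y + r • v ∈ {z | δ * r ≤ hdd (S.W j) z} := by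
      change δ * r ≤ hdd (S.W j) (y + r • v)
      rw [hd v hv]; exact h
    rw [Set.indicator_of_mem this]
  · push Not at h
    refine le_trans ?_ le_add_self
    refine (hdD_enorm _ _ _ _ _).trans (le_of_eq ?_)
    refine lintegral_congr_ae ?_
    have : ∀ᵐ v ∂(Measure.dirac 0 + (S.μp j + S.μm j)), v ∈ S.W j := by
      rw [ae_add_measure_iff, ae_add_measure_iff]
      refine ⟨?_, S.sμp j, S.sμm j⟩
      exact (ae_dirac_iff (p := fun v => v ∈ S.W j)
        (S.W j).closed_of_finiteDimensional.measurableSet).mpr (S.W j).zero_mem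
    filter_upwards [this] with v hv
    have : y + r • v ∈ {z | hdd (S.W j) z < δ * r} := by
      change hdd (S.W j) (y + r • v) < δ * r
      rw [hd v hv]; exact h
    rw [Set.indicator_of_mem this]

set_option maxHeartbeats 2000000 in
lemma hd_core [Nontrivial X] (S : HdSys ι X V) (i : ι) {c : ℝ≥0∞} (hc : c ≠ 0) :
    ∃ C : ℝ≥0∞, C ≠ ⊤ ∧ ∀ U φ, HdAdm S U φ →
      ∫⁻ x, ‖U i x‖ₑ / ‖x‖ₑ ≤
        (c + c + c) * ∑ i, (∫⁻ x, ‖U i x‖ₑ / ‖x‖ₑ) + C * ∑ i, ∫⁻ x, φ i x := by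
  obtain ⟨α, ν, hα, hνf, hν, hpt⟩ := hd_pointwise (V := V) S.μp S.μm (S.s i) i (S.L i)
  obtain ⟨t1, ht1, ht1c⟩ := hd_choose 4 c (by norm_num) hc
  obtain ⟨R, hR, hline⟩ := hd_small_line ν (fun e he => hν _ (S.hline i e he))
    (c := ENNReal.ofReal t1) (by simpa using ht1)
  set ε := R / 2 with hε
  have hε0 : 0 < ε := by positivity
  set γ : ι → Measure X := fun j => Measure.dirac 0 + (S.μp j + S.μm j) with hγ
  have hγf : ∀ j, IsFiniteMeasure (γ j) := fun j => by rw [hγ]; infer_instance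
  set A : ι → ℝ≥0∞ := fun j => (α j ∗ γ j) Set.univ with hA
  have hAt : ∑ j, A j ≠ ⊤ := ENNReal.sum_ne_top.mpr fun j _ => measure_ne_top _ _
  obtain ⟨t2, ht2, ht2c⟩ := hd_choose (4 * ∑ j, A j) c (by finiteness) hc
  obtain ⟨δ', hδ', hconc⟩ := hd_fin_min Finset.univ (fun j δ => ∃ C : ℝ≥0∞, C ≠ ⊤ ∧ ∀ U φ, HdAdm S U φ →
      ∫⁻ x, ({x : X | hdd (S.W j) x < δ * ‖x‖}.indicator (fun x => ‖U j x‖ₑ) x) / ‖x‖ₑ ≤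
        ENNReal.ofReal t2 * ∑ i, (∫⁻ x, ‖U i x‖ₑ / ‖x‖ₑ) + C * ∑ i, ∫⁻ x, φ i x)
    (by
      rintro j a b ⟨C, hC, h⟩ hab
      refine ⟨C, hC, fun U φ hU => le_trans (lintegral_mono fun x => ?_) (h U φ hU)⟩
      refine ENNReal.div_le_div_right ?_ _
      have hsub : {x : X | hdd (S.W j) x < b * ‖x‖} ⊆ {x : X | hdd (S.W j) x < a * ‖x‖} :=
        fun x hx => lt_of_lt_of_le hx (mul_le_mul_of_nonneg_right hab (norm_nonneg x))
      exact Set.indicator_le_indicator_of_subset hsub (fun _ => zero_le) x)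
    (fun j _ => hd_conc S j (c := ENNReal.ofReal t2) (by simpa using ht2))
  choose C2 hC2 hconc using fun j => hconc j (Finset.mem_univ j)
  obtain ⟨t3, ht3, ht3c⟩ := hd_choose (ENNReal.ofReal ε⁻¹ * ∑ j, A j) c (by finiteness) hc
  set δ := t3 * δ' with hδ
  have hδ0 : 0 < δ := by positivity
  set B : ι → ℝ≥0∞ := fun j => ENNReal.ofReal ε⁻¹ * (ENNReal.ofReal δ⁻¹ *
    ENNReal.ofReal (2 * (2 * ε)) * (α j ∗ S.κ j) Set.univ) with hB
  refine ⟨∑ j, (B j + 4 * (A j * C2 j)), ?_, ?_⟩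
  · refine ENNReal.sum_ne_top.mpr fun j _ => ENNReal.add_ne_top.mpr ⟨?_, ?_⟩
    · have := measure_ne_top (α j ∗ S.κ j) Set.univ
      simp only [hB]
      finiteness
    · have := measure_ne_top (α j ∗ γ j) Set.univ
      have := hC2 j
      simp only [hA]
      finiteness
  intro U φ hU
  set H := ∑ i, (∫⁻ x, ‖U i x‖ₑ / ‖x‖ₑ) with hH
  set F := ∑ i, ∫⁻ x, φ i x with hF
  have hHi : ∀ i, ∫⁻ x, ‖U i x‖ₑ / ‖x‖ₑ ≤ H := fun i =>
    Finset.single_le_sum (f := fun i => ∫⁻ x, ‖U i x‖ₑ / ‖x‖ₑ) (fun _ _ => zero_le)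
      (Finset.mem_univ i)
  have hFi : ∀ i, ∫⁻ x, φ i x ≤ F := fun i =>
    Finset.single_le_sum (f := fun i => ∫⁻ x, φ i x) (fun _ _ => zero_le) (Finset.mem_univ i)
  have hUm : ∀ j, Measurable fun p : ℝ × X => ‖U j p.2‖ₑ := fun j =>
    (hd_bcf_meas (U j)).comp measurable_snd
  -- the three kernels
  set Φ1 : ι → ℝ → X → ℝ≥0∞ := fun j τ z => ENNReal.ofReal τ⁻¹ *
        {z | δ * τ⁻¹ ≤ hdd (S.W j) z}.indicator (φ j) z with hΦ1
  have hm1 : ∀ j, Measurable fun p : ℝ × X => Φ1 j p.1 p.2 := by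
    intro j
    refine (by fun_prop : Measurable fun p : ℝ × X => ENNReal.ofReal p.1⁻¹).mul ?_
    have : Measurable ({p : ℝ × X | δ * p.1⁻¹ ≤ hdd (S.W j) p.2}.indicator fun p => φ j p.2) := by
      refine ((hU.meas j).comp measurable_snd).indicator ?_
      exact measurableSet_le (by fun_prop) ((hdd_cont _).measurable.comp measurable_snd)
    exact this
  set G2 : ι → X → ℝ≥0∞ := fun j =>
    {x : X | hdd (S.W j) x < δ' * ‖x‖}.indicator (fun x => ‖U j x‖ₑ) with hG2
  have hG2m : ∀ j, Measurable (G2 j) := fun j => (hd_bcf_meas _).indicator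
    (measurableSet_lt (hdd_cont _).measurable (by fun_prop))
  set Φ3 : ι → ℝ → X → ℝ≥0∞ := fun j τ z =>
    {z | hdd (S.W j) z < δ * τ⁻¹ ∧ δ' * ‖z‖ ≤ hdd (S.W j) z}.indicator (fun z => ‖U j z‖ₑ) z with hΦ3
  have hm3 : ∀ j, Measurable fun p : ℝ × X => Φ3 j p.1 p.2 := by
    intro j
    have : Measurable ({p : ℝ × X | hdd (S.W j) p.2 < δ * p.1⁻¹ ∧
        δ' * ‖p.2‖ ≤ hdd (S.W j) p.2}.indicator fun p => ‖U j p.2‖ₑ) := by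
      refine (hUm j).indicator ?_
      exact (measurableSet_lt ((hdd_cont _).measurable.comp measurable_snd) (by fun_prop)).inter
        (measurableSet_le (by fun_prop) ((hdd_cont _).measurable.comp measurable_snd))
    exact this
  set F1 : ι → ℝ → X → ℝ≥0∞ := fun j τ x => hdI (α j ∗ S.κ j) τ⁻¹ (Φ1 j τ) x with hF1
  set F2 : ι → ℝ → X → ℝ≥0∞ := fun j τ x => hdI (α j ∗ γ j) τ⁻¹ (G2 j) x with hF2
  set F3 : ι → ℝ → X → ℝ≥0∞ := fun j τ x => hdI (α j ∗ γ j) τ⁻¹ (Φ3 j τ) x with hF3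
  set F4 : ℝ → X → ℝ≥0∞ := fun τ x => hdI ν τ⁻¹ (fun y => ‖U i y‖ₑ) x with hF4
  have hF1m : ∀ j, Measurable fun p : ℝ × X => F1 j p.1 p.2 := fun j => hdI_meas2 _ (hm1 j)
  have hF2m : ∀ j, Measurable fun p : ℝ × X => F2 j p.1 p.2 := fun j =>
    hdI_meas2 _ (Φ := fun _ => G2 j) ((hG2m j).comp measurable_snd)
  have hF3m : ∀ j, Measurable fun p : ℝ × X => F3 j p.1 p.2 := fun j => hdI_meas2 _ (hm3 j)
  have hpw : ∀ τ > 0, ∀ x, ‖U i x‖ₑ ≤ ∑ j, (F1 j τ x + (F2 j τ x + F3 j τ x)) + F4 τ x := by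
    intro τ hτ x
    have hτ' : 0 < τ⁻¹ := inv_pos.mpr hτ
    refine (hpt τ⁻¹ U (hU.rel i) x).trans ?_
    gcongr with j _
    have m1 : Measurable (Φ1 j τ) := (hm1 j).comp measurable_prodMk_left
    have m3 : Measurable (Φ3 j τ) := (hm3 j).comp measurable_prodMk_left
    have m23 : Measurable fun y => G2 j y + Φ3 j τ y := (hG2m j).add m3
    simp only [hF1, hF2, hF3]
    rw [← hdI_add _ _ (hG2m j), hdI_conv _ _ _ m1, hdI_conv _ _ _ m23,
      ← hdI_add _ _ (hdI_meas _ _ m1)]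
    refine hdI_mono _ _ (fun y => ?_) x
    refine (hd_split S hU j δ τ⁻¹ hτ' y).trans ?_
    gcongr
    refine hdI_mono _ _ (fun z => ?_) y
    by_cases h1 : hdd (S.W j) z < δ * τ⁻¹
    swap
    · rw [Set.indicator_of_notMem (by exact h1)]; exact zero_le
    rw [Set.indicator_of_mem (by exact h1)]
    by_cases h2 : hdd (S.W j) z < δ' * ‖z‖
    · simp only [hG2]
      rw [Set.indicator_of_mem (by exact h2)]
      exact le_self_add
    · simp only [hΦ3]
      have h3 : z ∈ {z | hdd (S.W j) z < δ * τ⁻¹ ∧ δ' * ‖z‖ ≤ hdd (S.W j) z} :=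
        ⟨h1, not_lt.mp h2⟩
      rw [Set.indicator_of_mem h3]
      exact le_add_self
  have ham := hdAnn_meas (X := X) ε
  have ha1 := hdAnn_le (X := X) ε
  have haR : ∀ w : X, hdAnn ε w ≠ 0 → ‖w‖ < 2 * ε := by
    intro w hw
    by_contra h
    have h' : w ∉ {w : X | ε ≤ ‖w‖ ∧ ‖w‖ < 2 * ε} := fun h2 => h h2.2
    exact hw (Set.indicator_of_notMem h' _)
  have b1 : ∀ j, hdJ (hdAnn ε) (F1 j) ≤ ENNReal.ofReal δ⁻¹ *
    ENNReal.ofReal (2 * (2 * ε)) * (α j ∗ S.κ j) Set.univ * F := by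
    intro j
    refine (hd_K2 ham ha1 haR (α j ∗ S.κ j) (hm1 j) (hU.meas j) (ENNReal.ofReal δ⁻¹) ?_).trans ?_
    · refine Filter.Eventually.of_forall fun v τ hτ y _ => ?_
      simp only [hΦ1]
      by_cases h : δ * τ⁻¹ ≤ hdd (S.W j) y
      · rw [Set.indicator_of_mem (by exact h)]
        gcongr
        rw [← ofReal_norm, ← ENNReal.ofReal_mul (by positivity)]
        refine ENNReal.ofReal_le_ofReal ?_
        rw [inv_mul_eq_div, le_div_iff₀ hδ0, mul_comm]
        exact h.trans (hdd_le _ _)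
      · rw [Set.indicator_of_notMem (by exact h), mul_zero]
        exact zero_le
    · gcongr
      exact hFi j
  have b2 : ∀ j, hdJ (hdAnn ε) (F2 j) ≤ A j * ENNReal.ofReal (2 * (2 * ε)) *
      (ENNReal.ofReal t2 * H + C2 j * F) := by
    intro j
    refine (hd_K3 ham ha1 haR (α j ∗ γ j) (hG2m j) (A j) (fun y _ => ?_)).trans ?_
    · exact measure_mono (Set.subset_univ _)
    · gcongr
      exact hconc j U φ hU
  have b3 : ∀ j, hdJ (hdAnn ε) (F3 j) ≤ A j * ENNReal.ofReal t3 * H := by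
    intro j
    refine (hd_K4 ham ha1 (α j ∗ γ j) (hm3 j) (hd_bcf_meas (U j)) t3 ?_ ?_).trans ?_
    · intro τ _ y
      exact Set.indicator_le_self' (fun _ _ => zero_le) y
    · intro τ hτ y hy
      have h3 : y ∈ {z | hdd (S.W j) z < δ * τ⁻¹ ∧ δ' * ‖z‖ ≤ hdd (S.W j) z} := by
        by_contra h
        exact hy (Set.indicator_of_notMem h _)
      have h4 : δ' * ‖y‖ < t3 * δ' * τ⁻¹ := lt_of_le_of_lt h3.2 h3.1
      rw [← div_eq_mul_inv, lt_div_iff₀ hτ] at h4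
      have h5 : δ' * (τ * ‖y‖) < δ' * t3 := by linarith
      exact lt_of_mul_lt_mul_left h5 hδ'.le
    · gcongr
      exact hHi j
  have b4 : hdJ (hdAnn ε) F4 ≤ ENNReal.ofReal t1 * ENNReal.ofReal (2 * (2 * ε)) * H := by
    refine (hd_K3 ham ha1 haR ν (hd_bcf_meas (U i)) (ENNReal.ofReal t1) (fun y hy => ?_)).trans ?_
    · have : 2 * ε = R := by rw [hε]; ring
      rw [this]
      exact hline y hy
    · gcongr
      exact hHi i
  have e4 : ENNReal.ofReal ε⁻¹ * ENNReal.ofReal (2 * (2 * ε)) = 4 := by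
    rw [← ENNReal.ofReal_mul (by positivity)]
    have : ε⁻¹ * (2 * (2 * ε)) = 4 := by field_simp; norm_num
    rw [this]; norm_num
  have hsm : ∀ j, Measurable fun p : ℝ × X => F1 j p.1 p.2 + (F2 j p.1 p.2 + F3 j p.1 p.2) :=
    fun j => (hF1m j).add ((hF2m j).add (hF3m j))
  calc ∫⁻ x, ‖U i x‖ₑ / ‖x‖ₑ
      ≤ ENNReal.ofReal ε⁻¹ * hdJ (hdAnn ε) (fun _ x => ‖U i x‖ₑ) :=
        hdJ_lower ε hε0 (hd_bcf_meas (U i))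
    _ ≤ ENNReal.ofReal ε⁻¹ * hdJ (hdAnn ε)
        (fun τ x => ∑ j, (F1 j τ x + (F2 j τ x + F3 j τ x)) + F4 τ x) := by
        gcongr
        refine hdJ_mono fun τ hτ x => ?_
        gcongr
        exact hpw τ hτ x
    _ = ENNReal.ofReal ε⁻¹ * (∑ j, (hdJ (hdAnn ε) (F1 j) + (hdJ (hdAnn ε) (F2 j) +
          hdJ (hdAnn ε) (F3 j))) + hdJ (hdAnn ε) F4) := by
        rw [hdJ_add ham (Finset.measurable_fun_sum _ fun j _ => hsm j), hdJ_sum _ ham hsm]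
        congr 3
        funext j
        rw [hdJ_add ham (hF1m j), hdJ_add ham (hF2m j)]
    _ ≤ ENNReal.ofReal ε⁻¹ * (∑ j, (ENNReal.ofReal δ⁻¹ *
          ENNReal.ofReal (2 * (2 * ε)) * (α j ∗ S.κ j) Set.univ * F +
          (A j * ENNReal.ofReal (2 * (2 * ε)) * (ENNReal.ofReal t2 * H + C2 j * F) +
          A j * ENNReal.ofReal t3 * H)) +
          ENNReal.ofReal t1 * ENNReal.ofReal (2 * (2 * ε)) * H) := by
        gcongr with j _ j _
        · exact b1 j
        · exact b2 j
        · exact b3 j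
    _ = ∑ j, (B j * F + ((ENNReal.ofReal ε⁻¹ * ENNReal.ofReal (2 * (2 * ε))) * A j *
          (ENNReal.ofReal t2 * H + C2 j * F) + ENNReal.ofReal ε⁻¹ * A j * ENNReal.ofReal t3 * H)) +
          (ENNReal.ofReal ε⁻¹ * ENNReal.ofReal (2 * (2 * ε))) * ENNReal.ofReal t1 * H := by
        rw [mul_add, Finset.mul_sum]
        congr 1
        · refine Finset.sum_congr rfl fun j _ => ?_
          simp only [hB]
          ring
        · ring
    _ = (4 * ∑ j, A j) * ENNReal.ofReal t2 * H +
        (ENNReal.ofReal ε⁻¹ * ∑ j, A j) * ENNReal.ofReal t3 * H + 4 * ENNReal.ofReal t1 * H +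
        (∑ j, (B j + 4 * (A j * C2 j))) * F := by
        rw [e4]
        simp only [Finset.mul_sum, Finset.sum_mul, ← Finset.sum_add_distrib]
        rw [add_right_comm, ← Finset.sum_add_distrib]
        congr 1
        refine Finset.sum_congr rfl fun j _ => ?_
        ring
    _ ≤ c * H + c * H + c * H + (∑ j, (B j + 4 * (A j * C2 j))) * F := by gcongr
    _ = _ := by ring

end FinalPart

section ConclusionPart
open scoped BoundedContinuousFunction ContDiff

variable {ι : Type*} [Fintype ι] [DecidableEq ι]
  {X : Type*} [NormedAddCommGroup X] [InnerProductSpace ℝ X] [FiniteDimensional ℝ X]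
  [MeasurableSpace X] [BorelSpace X]
  {V : Type*} [NormedAddCommGroup V] [InnerProductSpace ℝ V] [FiniteDimensional ℝ V]

lemma hd_absorb [Nontrivial X] (S : HdSys ι X V) :
    ∃ C : ℝ≥0∞, C ≠ ⊤ ∧ ∀ U φ, HdAdm S U φ → ∑ i, (∫⁻ x, ‖U i x‖ₑ / ‖x‖ₑ) ≠ ⊤ →
      ∑ i, (∫⁻ x, ‖U i x‖ₑ / ‖x‖ₑ) ≤ C * ∑ i, ∫⁻ x, φ i x := by
  obtain ⟨t, ht, htc⟩ := hd_choose ((Fintype.card ι : ℝ≥0∞) * 3) 2⁻¹ (by finiteness) (by simp)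
  choose C hC hcore using fun i => hd_core S i (c := ENNReal.ofReal t) (by simpa using ht)
  refine ⟨2 * ∑ i, C i, ENNReal.mul_ne_top (by norm_num) (ENNReal.sum_ne_top.mpr fun i _ => hC i), ?_⟩
  intro U φ hU hfin
  set H := ∑ i, (∫⁻ x, ‖U i x‖ₑ / ‖x‖ₑ) with hH
  set F := ∑ i, ∫⁻ x, φ i x with hF
  have h1 : H ≤ 2⁻¹ * H + (∑ i, C i) * F := by
    calc H ≤ ∑ i, ((ENNReal.ofReal t + ENNReal.ofReal t + ENNReal.ofReal t) * H + C i * F) :=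
          Finset.sum_le_sum fun i _ => hcore i U φ hU
      _ = (Fintype.card ι : ℝ≥0∞) * 3 * ENNReal.ofReal t * H + (∑ i, C i) * F := by
          rw [Finset.sum_add_distrib, Finset.sum_const, Finset.sum_mul, Finset.card_univ,
            nsmul_eq_mul]
          ring
      _ ≤ _ := by gcongr
  have h2 : 2⁻¹ * H + 2⁻¹ * H = H := by rw [← add_mul, ENNReal.inv_two_add_inv_two, one_mul]
  have h3 : 2⁻¹ * H ≠ ⊤ := ENNReal.mul_ne_top (by simp) hfin
  have h4 : 2⁻¹ * H ≤ (∑ i, C i) * F := by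
    rw [← ENNReal.add_le_add_iff_left h3, h2]; exact h1
  calc H = 2 * (2⁻¹ * H) := by rw [← mul_assoc, ENNReal.mul_inv_cancel (by simp) (by simp), one_mul]
    _ ≤ 2 * ((∑ i, C i) * F) := by gcongr
    _ = _ := by ring

lemma hd_factor (Q : ι → V →ₗ[ℝ] V) (s : Finset ι) (T : V →ₗ[ℝ] V)
    (h : ∀ v, (∀ j ∈ s, Q j v = 0) → T v = 0) :
    ∃ L : ι → V →L[ℝ] V, ∀ v, T v = ∑ j ∈ s, L j (Q j v) := by
  set A : V →ₗ[ℝ] (ι → V) := LinearMap.pi (fun j => if j ∈ s then Q j else 0) with hA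
  have hker : LinearMap.ker A ≤ LinearMap.ker T := by
    intro v hv
    refine h v fun j hj => ?_
    have := congrFun (LinearMap.mem_ker.mp hv) j
    simpa [hA, hj] using this
  obtain ⟨g, hg⟩ := LinearMap.exists_leftInverse_of_injective
    ((LinearMap.ker A).liftQ A le_rfl) (Submodule.ker_liftQ_eq_bot _ _ _ le_rfl)
  set B := ((LinearMap.ker A).liftQ T hker) ∘ₗ g with hB
  have hBA : ∀ v, B (A v) = T v := by
    intro v
    have := LinearMap.congr_fun hg ((LinearMap.ker A).mkQ v)
    simp only [LinearMap.comp_apply, Submodule.mkQ_apply, Submodule.liftQ_apply,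
      LinearMap.id_apply] at this
    rw [hB, LinearMap.comp_apply, this, Submodule.liftQ_apply]
  refine ⟨fun j => LinearMap.toContinuousLinearMap (B ∘ₗ LinearMap.single ℝ (fun _ => V) j),
    fun v => ?_⟩
  rw [← hBA v]
  have : A v = ∑ j ∈ s, LinearMap.single ℝ (fun _ => V) j (Q j v) := by
    funext k
    simp [hA, Finset.sum_apply, Pi.single_apply]
    split_ifs <;> simp
  rw [this, map_sum]
  rfl

lemma hd_finite (hX : 2 ≤ Module.finrank ℝ X) {u : X → V} (hu : Continuous u)
    (hs : HasCompactSupport u) : ∫⁻ x, ‖u x‖ₑ / ‖x‖ₑ ≠ ⊤ := by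
  have : Nontrivial X := Module.nontrivial_of_finrank_pos (R := ℝ) (by omega)
  obtain ⟨M, hM⟩ := hs.exists_bound_of_continuous hu
  obtain ⟨R, hR⟩ := hs.isBounded.subset_ball 0
  have hi : IntegrableOn (fun x => ‖u x‖ / ‖x‖) (Metric.ball (0 : X) R) := by
    refine integrableOn_ball_of_norm_le_rpow (C := M) (α := 1) (by omega) ?_ ?_ ?_
    · have : (2 : ℝ) ≤ Module.finrank ℝ X := by exact_mod_cast hX
      linarith
    · refine Filter.Eventually.of_forall fun x => ?_
      rw [Real.rpow_neg_one, norm_div, norm_norm, norm_norm, div_eq_mul_inv]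
      gcongr
      exact hM x
    · exact (hu.norm.measurable.div measurable_norm).aestronglyMeasurable
  have h2 : ∫⁻ x, ‖u x‖ₑ / ‖x‖ₑ ≤ ∫⁻ x in Metric.ball (0 : X) R, ‖‖u x‖ / ‖x‖‖ₑ := by
    rw [← lintegral_indicator Metric.isOpen_ball.measurableSet]
    refine lintegral_mono_ae ?_
    filter_upwards [hd_ae_ne (X := X)] with x hx
    by_cases hxs : x ∈ Metric.ball (0 : X) R
    · rw [Set.indicator_of_mem hxs, ← ofReal_norm, ← ofReal_norm x,
        ← ENNReal.ofReal_div_of_pos (norm_pos_iff.mpr hx), ← ofReal_norm (‖u x‖ / ‖x‖),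
        Real.norm_of_nonneg (by positivity)]
    · have : u x = 0 := image_eq_zero_of_notMem_tsupport fun h => hxs (hR h)
      simp [this]
  exact ne_top_of_le_ne_top hi.2.ne h2

lemma hd_line_comparable {e : X} {A B : Submodule ℝ X} (hA : A ≤ Submodule.span ℝ {e})
    (hB : B ≤ Submodule.span ℝ {e}) : A ≤ B ∨ B ≤ A := by
  by_cases h : A = ⊥
  · left; rw [h]; exact bot_le
  · right
    obtain ⟨a, ha, ha0⟩ := A.exists_mem_ne_zero_of_ne_bot h
    obtain ⟨t, rfl⟩ := Submodule.mem_span_singleton.mp (hA ha)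
    have ht : t ≠ 0 := fun h => ha0 (by simp [h])
    refine hB.trans ?_
    rw [Submodule.span_singleton_le_iff_mem]
    have := A.smul_mem t⁻¹ ha
    rwa [inv_smul_smul₀ ht] at this

lemma hd_main {E : ι → Type*} [∀ i, NormedAddCommGroup (E i)] [∀ i, InnerProductSpace ℝ (E i)]
    [∀ i, FiniteDimensional ℝ (E i)] (P : ι → X →ₗ[ℝ] X) (Q : ι → V →ₗ[ℝ] V)
    (σ : ∀ i, X →ₗ[ℝ] V →ₗ[ℝ] E i) {κ : Type*} [Fintype κ] (e : OrthonormalBasis κ ℝ X)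
    (hell : ∀ i, ∀ ξ ∈ LinearMap.range (P i), ξ ≠ 0 →
      ∀ v ∈ LinearMap.range (Q i), σ i ξ v = 0 → v = 0)
    (hQ0 : ∀ v, (∀ i, Q i v = 0) → v = 0)
    (hIQ : ∀ i v, (∀ j, ¬ (LinearMap.ker (P i) ≤ LinearMap.ker (P j)) →
      ¬ (LinearMap.ker (P j) ≤ LinearMap.ker (P i)) → Q j v = 0) → Q i v = 0) :
    ∃ C : ℝ≥0∞, C ≠ ⊤ ∧ ∀ u : X → V, ContDiff ℝ ∞ u → HasCompactSupport u →
      ∫⁻ x, ‖u x‖ₑ / ‖x‖ₑ ≤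
        C * ∑ i, ∫⁻ x, ‖∑ j, σ i (P i (e j)) (Q i (fderiv ℝ u x (e j)))‖ₑ := by
  classical
  by_cases hinc : ∃ i j, ¬ (LinearMap.ker (P i) ≤ LinearMap.ker (P j)) ∧
      ¬ (LinearMap.ker (P j) ≤ LinearMap.ker (P i))
  swap
  · push Not at hinc
    have hV : ∀ v : V, v = 0 := fun v => hQ0 v fun i => hIQ i v fun j h1 h2 => absurd (hinc i j h1) h2
    refine ⟨1, by simp, fun u _ _ => ?_⟩
    simp [hV (u _)]
  have hX : 2 ≤ Module.finrank ℝ X := by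
    by_contra hlt
    obtain ⟨i, j, h1, h2⟩ := hinc
    obtain ⟨w, hw⟩ := finrank_le_one_iff.mp (by omega : Module.finrank ℝ X ≤ 1)
    have htop : ∀ A : Submodule ℝ X, A ≤ Submodule.span ℝ {w} := fun A x _ =>
      Submodule.mem_span_singleton.mpr (hw x)
    exact (hd_line_comparable (htop _) (htop _)).elim h1 h2
  have hnt : Nontrivial X := Module.nontrivial_of_finrank_pos (R := ℝ) (by omega)
  choose μp μm κ1 m κ2 fμp fμm fκ fm fκ' sμp sμm sκ sm sκ' hnull hest using fun i =>
    hd_transport (P i) (Q i) (σ i) e (hell i)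
  set s : ι → Finset ι := fun i => Finset.univ.filter fun j =>
    ¬ (LinearMap.ker (P i) ≤ LinearMap.ker (P j)) ∧
      ¬ (LinearMap.ker (P j) ≤ LinearMap.ker (P i)) with hs
  choose L hL using fun i => hd_factor Q (s i) (Q i) (fun v hv => hIQ i v fun j h1 h2 =>
    hv j (by simp [hs, h1, h2]))
  obtain ⟨L0, hL0⟩ := hd_factor Q Finset.univ LinearMap.id
    (fun v hv => hQ0 v fun i => hv i (Finset.mem_univ i))
  set W : ι → Submodule ℝ X := fun i => (LinearMap.ker (P i))ᗮ with hW
  have hWs : ∀ i j, j ∈ s i → ¬ W i ≤ W j ∧ ¬ W j ≤ W i := by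
    intro i j hj
    simp only [hs, Finset.mem_filter, Finset.mem_univ, true_and] at hj
    simp only [hW, Submodule.orthogonal_le_orthogonal_iff]
    exact ⟨hj.2, hj.1⟩
  let S : HdSys ι X V :=
    { W := W, s := s, L := L, μp := μp, μm := μm, κ := κ1, m := m, κ' := κ2
      fμp := fμp, fμm := fμm, fκ := fκ, fm := fm, fκ' := fκ'
      sμp := sμp, sμm := sμm, sκ := sκ, sm := sm, sκ' := sκ'
      hline := by
        intro i w hw
        by_cases h : W i ≤ Submodule.span ℝ {w}
        · left
          intro k hk
          have hk' : ¬ W k ≤ Submodule.span ℝ {w} := fun h2 =>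
            (hd_line_comparable h h2).elim (hWs i k hk).1 (hWs i k hk).2
          exact (hnull k _ hk').1.add (hnull k _ hk').2.1
        · right
          exact (hnull i _ h).1.add (hnull i _ h).2.1
      hm := fun j i hi => (hnull i _ (hWs j i hi).2).2.2 }
  obtain ⟨C, hC, habs⟩ := hd_absorb S
  refine ⟨(∑ i, ‖L0 i‖ₑ) * C, ENNReal.mul_ne_top (ENNReal.sum_ne_top.mpr fun i _ => enorm_ne_top) hC,
    fun u hu hus => ?_⟩
  obtain ⟨M, hM⟩ := hus.exists_bound_of_continuous hu.continuous
  have hQc : ∀ i, Continuous (Q i) := fun i => LinearMap.continuous_of_finiteDimensional _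
  have hcs : ∀ i, HasCompactSupport fun x => Q i (u x) := fun i => hus.comp_left (map_zero _)
  have hcc : ∀ i, Continuous fun x => Q i (u x) := fun i => (hQc i).comp hu.continuous
  choose M hM using fun i => (hcs i).exists_bound_of_continuous (hcc i)
  set U : ι → X →ᵇ V := fun i => BoundedContinuousFunction.ofNormedAddCommGroup
    (fun x => Q i (u x)) (hcc i) (M i) (hM i) with hU
  have hUx : ∀ i x, U i x = Q i (u x) := fun _ _ => rfl
  set φ : ι → X → ℝ≥0∞ := fun i x => ‖∑ j, σ i (P i (e j)) (Q i (fderiv ℝ u x (e j)))‖ₑ with hφ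
  have hadm : HdAdm S U φ :=
    { meas := by
        intro i
        refine Continuous.measurable (Continuous.enorm (continuous_finsetSum _ fun j _ => ?_))
        have h1 : Continuous fun x => fderiv ℝ u x (e j) :=
          (hu.continuous_fderiv (by simp)).clm_apply continuous_const
        exact (LinearMap.continuous_of_finiteDimensional (σ i (P i (e j)))).comp ((hQc i).comp h1)
      rel := fun i x => hL i (u x)
      hB := fun j r hr x => (hest j u hu hus x r hr).1
      hA := fun j r hr x => (hest j u hu hus x r hr).2 }
  have hfin : ∑ i, (∫⁻ x, ‖U i x‖ₑ / ‖x‖ₑ) ≠ ⊤ :=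
    ENNReal.sum_ne_top.mpr fun i _ => hd_finite hX (hcc i) (hcs i)
  have hmain := habs U φ hadm hfin
  calc ∫⁻ x, ‖u x‖ₑ / ‖x‖ₑ ≤ ∫⁻ x, ∑ i, ‖L0 i‖ₑ * (‖U i x‖ₑ / ‖x‖ₑ) := by
        refine lintegral_mono fun x => ?_
        have h1 : ‖u x‖ₑ ≤ ∑ i, ‖L0 i‖ₑ * ‖U i x‖ₑ := by
          have := hL0 (u x)
          rw [LinearMap.id_apply] at this
          conv_lhs => rw [this]
          refine (enorm_sum_le _ _).trans (Finset.sum_le_sum fun i _ => ?_)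
          exact (L0 i).le_opENorm _
        calc ‖u x‖ₑ / ‖x‖ₑ ≤ (∑ i, ‖L0 i‖ₑ * ‖U i x‖ₑ) / ‖x‖ₑ := ENNReal.div_le_div_right h1 _
          _ = _ := by simp only [div_eq_mul_inv, Finset.sum_mul, mul_assoc]
    _ = ∑ i, ‖L0 i‖ₑ * ∫⁻ x, ‖U i x‖ₑ / ‖x‖ₑ := by
        rw [lintegral_finsetSum _ fun i _ => (hd_div_meas (hd_bcf_meas (U i))).const_mul _]
        refine Finset.sum_congr rfl fun i _ => ?_
        rw [lintegral_const_mul _ (hd_div_meas (hd_bcf_meas (U i)))]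
    _ ≤ ∑ i, ‖L0 i‖ₑ * ∑ i, ∫⁻ x, ‖U i x‖ₑ / ‖x‖ₑ := by
        gcongr with i _
        exact Finset.single_le_sum (f := fun i => ∫⁻ x, ‖U i x‖ₑ / ‖x‖ₑ) (fun _ _ => zero_le)
          (Finset.mem_univ i)
    _ = (∑ i, ‖L0 i‖ₑ) * ∑ i, ∫⁻ x, ‖U i x‖ₑ / ‖x‖ₑ := by rw [Finset.sum_mul]
    _ ≤ (∑ i, ‖L0 i‖ₑ) * (C * ∑ i, ∫⁻ x, φ i x) := by gcongr
    _ = _ := by rw [mul_assoc]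

end ConclusionPart

/-- Proposition: Hardy inequality for direct sums of general first order
operators. `A(ξ) = ∑ᵢ A_i(P_i(ξ)) ∘ Q_i : V → E = E_1 ⊕ ⋯ ⊕ E_ℓ` (orthogonal Hilbert sum,
formalized as `PiLp 2 E`), where `P_i, Q_i` are linear projections and each `A_i` is an
elliptic first-order operator on `Π_i = range P_i` from `V_i = range Q_i` to `E_i`, encoded
by its (bilinear) symbol `σ i`, so that the first-order operator `A(D)` acts by
`A(D)u(x) = ∑_j A(e_j)[∂_j u(x)]`. If `⋂ᵢ ker Q_i = {0}` and
`⋂_{j ∈ I_i} ker Q_j ⊆ ker Q_i` with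
`I_i = {j : ker P_i ⊄ ker P_j ∧ ker P_j ⊄ ker P_i}`, then
`∫ |u(x)|/|x| dx ≤ C ∫ |A(D)u| dx` for all `u ∈ C_c^∞(ℝⁿ; V)`. -/
theorem statement15
    {n ℓ : ℕ} (hn : 0 < n) (hℓ : 0 < ℓ)
    {V : Type*} [NormedAddCommGroup V] [InnerProductSpace ℝ V] [FiniteDimensional ℝ V]
    {E : Fin ℓ → Type*} [∀ i, NormedAddCommGroup (E i)] [∀ i, InnerProductSpace ℝ (E i)]
    [∀ i, FiniteDimensional ℝ (E i)]
    (P : Fin ℓ → (EuclideanSpace ℝ (Fin n) →ₗ[ℝ] EuclideanSpace ℝ (Fin n)))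
    (hP : ∀ i x, P i (P i x) = P i x)
    (Q : Fin ℓ → (V →ₗ[ℝ] V)) (hQ : ∀ i v, Q i (Q i v) = Q i v)
    -- the symbol of the elliptic operator `A_i`, defined on `Π_i = range (P i)`,
    -- extended (arbitrarily) to a linear map on all of `ℝⁿ`:
    (σ : ∀ i, EuclideanSpace ℝ (Fin n) →ₗ[ℝ] V →ₗ[ℝ] E i)
    -- ellipticity of each `A_i` on `Π_i` from `V_i = range (Q i)`:
    (hell : ∀ i, ∀ ξ ∈ LinearMap.range (P i), ξ ≠ 0 →
      ∀ v ∈ LinearMap.range (Q i), σ i ξ v = 0 → v = 0)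
    (hQ0 : (⋂ i, (LinearMap.ker (Q i) : Set V)) = {0})
    (hIQ : ∀ i,
      (⋂ j ∈ {j | ¬ (LinearMap.ker (P i) ≤ LinearMap.ker (P j)) ∧
          ¬ (LinearMap.ker (P j) ≤ LinearMap.ker (P i))},
        (LinearMap.ker (Q j) : Set V)) ⊆ (LinearMap.ker (Q i) : Set V)) :
    ∃ C : ℝ, 0 < C ∧ ∀ u : EuclideanSpace ℝ (Fin n) → V, IsTestFun u →
      ∫⁻ x, (‖u x‖₊ : ℝ≥0∞) / (‖x‖₊ : ℝ≥0∞)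
        ≤ ENNReal.ofReal C *
          ∫⁻ x, (‖(WithLp.equiv 2 (∀ i, E i)).symm
            (fun i => ∑ j : Fin n,
              σ i (P i (EuclideanSpace.single j (1 : ℝ)))
                (Q i (fderiv ℝ u x (EuclideanSpace.single j (1 : ℝ)))))‖₊ : ℝ≥0∞) := by
  have hIQ' : ∀ i v, (∀ j, ¬ (LinearMap.ker (P i) ≤ LinearMap.ker (P j)) →
      ¬ (LinearMap.ker (P j) ≤ LinearMap.ker (P i)) → Q j v = 0) → Q i v = 0 := by
    intro i v h
    exact hIQ i (Set.mem_iInter₂.mpr fun j hj => h j hj.1 hj.2)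
  have hQ0' : ∀ v, (∀ i, Q i v = 0) → v = 0 := by
    intro v h
    have h1 : v ∈ (⋂ i, (LinearMap.ker (Q i) : Set V)) := Set.mem_iInter.mpr h
    rw [hQ0] at h1
    exact h1
  obtain ⟨C, hC, hmain⟩ := hd_main P Q σ (EuclideanSpace.basisFun (Fin n) ℝ) hell hQ0' hIQ'
  refine ⟨(C * ℓ).toReal + 1, by positivity, fun u hu => ?_⟩
  have h1 := hmain u hu.1 hu.2
  simp only [EuclideanSpace.basisFun_apply] at h1
  have hCl : C * ℓ ≠ ⊤ := ENNReal.mul_ne_top hC (ENNReal.natCast_ne_top ℓ)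
  have hle : C * ℓ ≤ ENNReal.ofReal ((C * ℓ).toReal + 1) := by
    conv_lhs => rw [← ENNReal.ofReal_toReal hCl]
    exact ENNReal.ofReal_le_ofReal (by linarith)
  refine h1.trans (le_trans ?_ (mul_le_mul_left hle _))
  rw [mul_assoc]
  refine mul_le_mul_right ?_ C
  refine (Finset.sum_le_card_nsmul _ _ _ fun i _ => lintegral_mono fun x => ?_).trans
    (le_of_eq (by rw [Finset.card_univ, Fintype.card_fin, nsmul_eq_mul]))
  exact ENNReal.coe_le_coe.mpr (PiLp.nnnorm_apply_le ((WithLp.equiv 2 (∀ i, E i)).symm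
            (fun i => ∑ j : Fin n,
              σ i (P i (EuclideanSpace.single j (1 : ℝ)))
                (Q i (fderiv ℝ u x (EuclideanSpace.single j (1 : ℝ)))))) i)
end
end
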